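/- arXiv:0706.2807 — 2 statements merged into one kernel-verified Lean document; each statement's English description precedes it below -/
import Mathlib

section
/- As x → ∞, (log x) · ( ∏_{p ≤ x, p ≡ 1 (mod 8)} (1 − 1/p) )⁴ tends to ( π² · e^{−γ} / log(3 + 2√2) ) · ( ∏_{p ≡ 1 (mod 8)} (1 − 1/p²) )², where the product over all primes p ≡ 1 (mod 8) is absolutely convergent. Equivalently, Grosswald's formula C(8,1)⁴ = π² e^{−γ} (log(3 + 2√2))^{−1} ∏_{p ≡ 1 (mod 8)} (1 − 1/p²)² holds. -/
open Filter Topology Finset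

open MeasureTheory in
/-- A Dirichlet series as a Laplace transform of its coefficient sums. -/
lemma tsum_mul_rpow_neg_eq_integral {a : ℕ → ℝ} (h0 : a 0 = 0) {ε : ℝ} (hε : 0 < ε)
    (hs : Summable fun n : ℕ => |a n| * (n : ℝ) ^ (-ε)) :
    ∑' n : ℕ, a n * (n : ℝ) ^ (-ε) =
      ∫ u in Set.Ioi (0 : ℝ),
        (∑ n ∈ range (⌊Real.exp (u / ε)⌋₊ + 1), a n) * Real.exp (-u) := by
  set F : ℕ → ℝ → ℝ := fun n =>
    (Set.Ici (ε * Real.log n)).indicator (fun u => a n * Real.exp (-u)) with hF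
  have hlog (n : ℕ) : 0 ≤ ε * Real.log n := mul_nonneg hε.le (Real.log_natCast_nonneg n)
  have hexp (n : ℕ) (hn : n ≠ 0) : Real.exp (-(ε * Real.log n)) = (n : ℝ) ^ (-ε) := by
    rw [Real.rpow_def_of_pos (by positivity)]; ring_nf
  have hIci (c : ℝ) (n : ℕ) : ∫ u in Set.Ioi (0 : ℝ),
      (Set.Ici (ε * Real.log n)).indicator (fun u => c * Real.exp (-u)) u =
      c * Real.exp (-(ε * Real.log n)) := by
    rw [← integral_Ici_eq_integral_Ioi, setIntegral_indicator measurableSet_Ici,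
      Set.inter_eq_right.mpr (Set.Ici_subset_Ici.mpr (hlog n)),
      integral_Ici_eq_integral_Ioi, integral_const_mul, integral_exp_neg_Ioi]
  have hint (n : ℕ) : Integrable (F n) (volume.restrict (Set.Ioi 0)) := by
    refine Integrable.indicator ?_ measurableSet_Ici
    exact (integrableOn_exp_neg_Ioi 0).const_mul _
  have hval (n : ℕ) : ∫ u in Set.Ioi (0 : ℝ), F n u = a n * (n : ℝ) ^ (-ε) := by
    rw [hF, hIci]
    rcases eq_or_ne n 0 with rfl | hn
    · simp [h0]
    · rw [hexp n hn]
  have hnorm (n : ℕ) : ∫ u in Set.Ioi (0 : ℝ), ‖F n u‖ = |a n| * (n : ℝ) ^ (-ε) := by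
    have : (fun u => ‖F n u‖) =
        (Set.Ici (ε * Real.log n)).indicator (fun u => |a n| * Real.exp (-u)) := by
      funext u
      simp only [hF, norm_indicator_eq_indicator_norm, norm_mul, Real.norm_eq_abs, Real.abs_exp]
    rw [this, hIci]
    rcases eq_or_ne n 0 with rfl | hn
    · simp [h0]
    · rw [hexp n hn]
  have key := hasSum_integral_of_summable_integral_norm hint (by simpa only [hnorm] using hs)
  simp only [hval] at key
  rw [key.tsum_eq]
  refine integral_congr_ae (Eventually.of_forall fun u => ?_)
  simp only
  rw [sum_mul, tsum_eq_sum (s := range (⌊Real.exp (u / ε)⌋₊ + 1))]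
  · refine sum_congr rfl fun n hn => ?_
    rcases eq_or_ne n 0 with rfl | hn0
    · simp [hF, h0]
    have h1 : (n : ℝ) ≤ Real.exp (u / ε) :=
      (Nat.le_floor_iff (Real.exp_pos _).le).mp (by simpa [Nat.lt_succ_iff] using hn)
    have h2 : Real.log n ≤ u / ε := (Real.log_le_iff_le_exp (by positivity)).mpr h1
    have : u ∈ Set.Ici (ε * Real.log n) := by
      rw [le_div_iff₀ hε] at h2
      rw [Set.mem_Ici]; linarith
    simp only [hF, Set.indicator_of_mem this]
  · intro n hn
    have h1 : ¬ (n : ℝ) ≤ Real.exp (u / ε) := by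
      intro h
      exact hn (by simpa [Nat.lt_succ_iff] using Nat.le_floor h)
    rcases eq_or_ne n 0 with rfl | hn0
    · simp [hF, h0]
    have : u ∉ Set.Ici (ε * Real.log n) := by
      rw [Set.mem_Ici, not_le]
      have h2 := (Real.lt_log_iff_exp_lt (by positivity)).mpr (not_le.mp h1)
      rw [div_lt_iff₀ hε] at h2
      linarith
    simp only [hF, Set.indicator_of_notMem this]

open MeasureTheory in
lemma integral_log_mul_exp_neg :
    ∫ u in Set.Ioi (0 : ℝ), Real.log u * Real.exp (-u) = -Real.eulerMascheroniConstant := by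
  have h1 := Complex.hasDerivAt_GammaIntegral (s := 1) (by simp)
  have h2 : HasDerivAt Complex.GammaIntegral (-(Real.eulerMascheroniConstant : ℂ)) 1 := by
    refine Complex.hasDerivAt_Gamma_one.congr_of_eventuallyEq ?_
    have : ∀ᶠ s : ℂ in 𝓝 1, 0 < s.re :=
      Complex.continuous_re.continuousAt.eventually (lt_mem_nhds (by simp))
    filter_upwards [this] with s hs
    exact (Complex.Gamma_eq_integral hs).symm
  have h3 := h1.unique h2
  have h4 : ∫ u in Set.Ioi (0 : ℝ), (u : ℂ) ^ ((1 : ℂ) - 1) * (Real.log u * Real.exp (-u)) =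
      ((∫ u in Set.Ioi (0 : ℝ), Real.log u * Real.exp (-u) : ℝ) : ℂ) := by
    rw [← integral_complex_ofReal]
    congr 1
    funext u
    simp
  rw [h4] at h3
  exact_mod_cast h3

lemma abs_log_le_add_rpow {v : ℝ} (hv : 0 < v) : |Real.log v| ≤ v + 2 * v ^ (-(1 / 2) : ℝ) := by
  have h1 : Real.log v ≤ v := (Real.log_le_sub_one_of_pos hv).trans (by linarith)
  have h2 : 0 < v ^ (-(1 / 2) : ℝ) := by positivity
  have h3 := Real.log_le_sub_one_of_pos h2
  rw [Real.log_rpow hv] at h3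
  rw [abs_le]
  constructor <;> linarith

lemma tendsto_log_log_floor_exp_sub_log :
    Tendsto (fun v : ℝ => Real.log (Real.log (⌊Real.exp v⌋₊ : ℝ)) - Real.log v) atTop (𝓝 0) := by
  have h1 : Tendsto (fun v : ℝ => (⌊Real.exp v⌋₊ : ℝ) / Real.exp v) atTop (𝓝 1) :=
    (tendsto_nat_floor_div_atTop (R := ℝ)).comp Real.tendsto_exp_atTop
  have h2 : Tendsto (fun v : ℝ => Real.log ((⌊Real.exp v⌋₊ : ℝ) / Real.exp v)) atTop (𝓝 0) := by
    simpa using h1.log one_ne_zero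
  have h3 : Tendsto (fun v : ℝ => 1 + Real.log ((⌊Real.exp v⌋₊ : ℝ) / Real.exp v) * v⁻¹) atTop
      (𝓝 (1 + 0 * 0)) := tendsto_const_nhds.add (h2.mul tendsto_inv_atTop_zero)
  have h4 := h3.log (by norm_num)
  simp only [mul_zero, add_zero, Real.log_one] at h4
  refine h4.congr' ?_
  filter_upwards [eventually_gt_atTop 1] with v hv
  have hfl : 2 ≤ ⌊Real.exp v⌋₊ := by
    refine Nat.le_floor ?_
    push_cast
    linarith [Real.add_one_le_exp v]
  have hfl' : (2 : ℝ) ≤ ⌊Real.exp v⌋₊ := by exact_mod_cast hfl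
  have hl : 0 < Real.log (⌊Real.exp v⌋₊ : ℝ) := Real.log_pos (by linarith)
  rw [Real.log_div (by positivity) (by positivity), Real.log_exp,
    ← Real.log_div hl.ne' (by positivity)]
  congr 1
  field_simp
  ring

open MeasureTheory in
lemma integrableOn_exp_neg_mul_rpow_neg_half :
    IntegrableOn (fun u : ℝ => Real.exp (-u) * u ^ (-(1 / 2) : ℝ)) (Set.Ioi 0) := by
  have := Real.GammaIntegral_convergent (s := 1 / 2) (by norm_num)
  norm_num at this ⊢
  exact this

open MeasureTheory in
lemma integrableOn_log_mul_exp_neg :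
    IntegrableOn (fun u : ℝ => Real.log u * Real.exp (-u)) (Set.Ioi 0) := by
  have h2 := Real.GammaIntegral_convergent (s := 2) (by norm_num)
  have h3 := h2.add (integrableOn_exp_neg_mul_rpow_neg_half.const_mul 2)
  refine Integrable.mono' h3 (by fun_prop) ?_
  refine (ae_restrict_iff' measurableSet_Ioi).mpr (Eventually.of_forall fun u hu => ?_)
  have := abs_log_le_add_rpow (Set.mem_Ioi.mp hu)
  have h1 : u ^ ((2 : ℝ) - 1) = u := by norm_num
  simp only [norm_mul, Real.norm_eq_abs, Real.abs_exp, Pi.add_apply, h1]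
  nlinarith [Real.exp_pos (-u)]

open MeasureTheory in
/-- An Abelian theorem: if the coefficient sums satisfy `S(N) = δ log log N + c + o(1)` then the
Dirichlet series is `δ log (1 / ε) + c - δ γ + o(1)` as `ε → 0⁺`. -/
theorem tendsto_tsum_mul_rpow_neg_add_log {a : ℕ → ℝ} (h0 : a 0 = 0)
    (hs : ∀ ε : ℝ, 0 < ε → Summable fun n : ℕ => |a n| * (n : ℝ) ^ (-ε)) {δ c : ℝ}
    (hS : Tendsto (fun N : ℕ => ∑ n ∈ range (N + 1), a n - δ * Real.log (Real.log N))
      atTop (𝓝 c)) :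
    Tendsto (fun ε : ℝ => ∑' n : ℕ, a n * (n : ℝ) ^ (-ε) + δ * Real.log ε) (𝓝[>] 0)
      (𝓝 (c - δ * Real.eulerMascheroniConstant)) := by
  set S : ℝ → ℝ := fun v => ∑ n ∈ range (⌊Real.exp v⌋₊ + 1), a n with hSdef
  set D : ℝ → ℝ := fun v => S v - δ * Real.log v with hD
  have hmeasS : Measurable S :=
    (measurable_from_nat (f := fun N : ℕ => ∑ n ∈ range (N + 1), a n)).comp
      (Nat.measurable_floor.comp Real.measurable_exp)
  have hmeasD : Measurable D := hmeasS.sub (Real.measurable_log.const_mul δ)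
  have hDlim : Tendsto D atTop (𝓝 c) := by
    have h1 := hS.comp (tendsto_nat_floor_atTop.comp Real.tendsto_exp_atTop)
    have h2 := h1.add (tendsto_log_log_floor_exp_sub_log.const_mul δ)
    rw [mul_zero, add_zero] at h2
    refine h2.congr fun v => ?_
    simp only [hD, hSdef, Function.comp_apply]
    ring
  obtain ⟨K, hK0, hK⟩ : ∃ K : ℝ, 0 ≤ K ∧
      ∀ v : ℝ, 0 < v → |D v| ≤ K * (1 + v ^ (-(1 / 2) : ℝ)) := by
    have h1 : ∀ᶠ v in atTop, |D v| ≤ |c| + 1 :=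
      (hDlim.abs.eventually (gt_mem_nhds (lt_add_one |c|))).mono fun _ h => h.le
    obtain ⟨V, hV⟩ := eventually_atTop.mp h1
    set K₁ := ∑ n ∈ range (⌊Real.exp V⌋₊ + 1), |a n| with hK₁
    have hK₁0 : 0 ≤ K₁ := sum_nonneg fun _ _ => abs_nonneg _
    refine ⟨|c| + 1 + K₁ + |δ| * (|V| + 2), by positivity, fun v hv => ?_⟩
    have hr : 0 < v ^ (-(1 / 2) : ℝ) := by positivity
    have hδ : 0 ≤ |δ| * (|V| + 2) := by positivity
    rcases le_or_gt V v with h | h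
    · have := hV v h
      nlinarith [abs_nonneg c, mul_nonneg (by positivity : 0 ≤ |c| + 1 + K₁ + |δ| * (|V| + 2)) hr.le]
    · have hS1 : |S v| ≤ K₁ := by
        refine (abs_sum_le_sum_abs _ _).trans ?_
        refine sum_le_sum_of_subset_of_nonneg ?_ fun _ _ _ => abs_nonneg _
        refine range_subset_range.mpr ?_
        have := Nat.floor_mono (Real.exp_le_exp.mpr h.le)
        omega
      have hl := abs_log_le_add_rpow hv
      have hl' : |Real.log v| ≤ (|V| + 2) * (1 + v ^ (-(1 / 2) : ℝ)) := by
        nlinarith [le_abs_self V, mul_nonneg (abs_nonneg V) hr.le]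
      have hD1 : |D v| ≤ |S v| + |δ| * |Real.log v| := by
        rw [← abs_mul]; exact abs_sub _ _
      have h5 := mul_le_mul_of_nonneg_left hl' (abs_nonneg δ)
      nlinarith [abs_nonneg c, mul_nonneg (by positivity : 0 ≤ |c| + 1 + K₁) hr.le]
  have hbint : IntegrableOn
      (fun u : ℝ => K * (1 + u ^ (-(1 / 2) : ℝ)) * Real.exp (-u)) (Set.Ioi 0) := by
    have := ((integrableOn_exp_neg_Ioi 0).add integrableOn_exp_neg_mul_rpow_neg_half).const_mul K
    refine this.congr (Eventually.of_forall fun u => ?_)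
    simp only [Pi.add_apply]
    ring
  have hbound : ∀ ε : ℝ, 0 < ε → ε ≤ 1 → ∀ u : ℝ, 0 < u →
      ‖D (u / ε) * Real.exp (-u)‖ ≤ K * (1 + u ^ (-(1 / 2) : ℝ)) * Real.exp (-u) := by
    intro ε hε hε1 u hu
    rw [norm_mul, Real.norm_eq_abs, Real.norm_eq_abs, Real.abs_exp]
    refine mul_le_mul_of_nonneg_right ((hK _ (by positivity)).trans ?_) (Real.exp_pos _).le
    have : (u / ε) ^ (-(1 / 2) : ℝ) ≤ u ^ (-(1 / 2) : ℝ) :=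
      Real.rpow_le_rpow_of_nonpos hu ((le_div_iff₀ hε).mpr (by nlinarith)) (by norm_num)
    gcongr
  have hmeas (ε : ℝ) : Measurable fun u : ℝ => D (u / ε) * Real.exp (-u) :=
    (hmeasD.comp (measurable_id.div_const ε)).mul (by fun_prop)
  have hsmall : ∀ᶠ ε : ℝ in 𝓝[>] 0, 0 < ε ∧ ε ≤ 1 := by
    filter_upwards [Ioc_mem_nhdsGT (zero_lt_one (α := ℝ))] with ε hε using hε
  have hlim : Tendsto (fun ε : ℝ => ∫ u in Set.Ioi (0 : ℝ), D (u / ε) * Real.exp (-u))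
      (𝓝[>] 0) (𝓝 (∫ u in Set.Ioi (0 : ℝ), c * Real.exp (-u))) := by
    refine tendsto_integral_filter_of_dominated_convergence
      (fun u : ℝ => K * (1 + u ^ (-(1 / 2) : ℝ)) * Real.exp (-u)) ?_ ?_ hbint ?_
    · exact Eventually.of_forall fun ε => (hmeas ε).aestronglyMeasurable
    · filter_upwards [hsmall] with ε hε
      exact (ae_restrict_iff' measurableSet_Ioi).mpr
        (Eventually.of_forall fun u hu => hbound ε hε.1 hε.2 u hu)
    · refine (ae_restrict_iff' measurableSet_Ioi).mpr (Eventually.of_forall fun u hu => ?_)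
      refine (hDlim.comp ?_).mul_const _
      have : Tendsto (fun ε : ℝ => u * ε⁻¹) (𝓝[>] 0) atTop :=
        tendsto_inv_nhdsGT_zero.const_mul_atTop hu
      exact this.congr fun ε => (div_eq_mul_inv u ε).symm
  rw [integral_const_mul, integral_exp_neg_Ioi_zero, mul_one] at hlim
  have hfin := hlim.add (tendsto_const_nhds (x := δ * -Real.eulerMascheroniConstant))
  rw [mul_neg, ← sub_eq_add_neg] at hfin
  refine hfin.congr' ?_
  filter_upwards [hsmall] with ε ⟨hε, hε1⟩
  have hint : IntegrableOn (fun u => D (u / ε) * Real.exp (-u)) (Set.Ioi 0) :=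
    Integrable.mono' hbint (hmeas ε).aestronglyMeasurable
      ((ae_restrict_iff' measurableSet_Ioi).mpr
        (Eventually.of_forall fun u hu => hbound ε hε hε1 u hu))
  have hexp0 : δ * Real.log ε =
      ∫ u in Set.Ioi (0 : ℝ), (δ * Real.log ε) * Real.exp (-u) := by
    rw [integral_const_mul, integral_exp_neg_Ioi_zero, mul_one]
  have hSe : ∫ u in Set.Ioi (0 : ℝ), S (u / ε) * Real.exp (-u) =
      ∫ u in Set.Ioi (0 : ℝ), (D (u / ε) * Real.exp (-u) +
        δ * (Real.log u * Real.exp (-u)) - (δ * Real.log ε) * Real.exp (-u)) := by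
    refine setIntegral_congr_fun measurableSet_Ioi fun u hu => ?_
    have hu' : 0 < u := hu
    simp only [hD, Real.log_div hu'.ne' hε.ne']
    ring
  rw [tsum_mul_rpow_neg_eq_integral h0 hε (hs ε hε)]
  change _ = (∫ u in Set.Ioi (0 : ℝ), S (u / ε) * Real.exp (-u)) + _
  have hadd : IntegrableOn (fun u => D (u / ε) * Real.exp (-u) +
      δ * (Real.log u * Real.exp (-u))) (Set.Ioi 0) :=
    hint.add (integrableOn_log_mul_exp_neg.const_mul δ)
  rw [hSe, integral_sub hadd
    ((integrableOn_exp_neg_Ioi 0).const_mul _),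
    integral_add hint (integrableOn_log_mul_exp_neg.const_mul δ), ← hexp0, integral_const_mul,
    integral_log_mul_exp_neg]
  ring

lemma log_log_increment_bounds {x y : ℝ} (hy : 0 < y) (hyx : y ≤ x) (hxy : x - y ≤ 1) :
    0 ≤ Real.log x - Real.log y - (x - y) / x ∧
      Real.log x - Real.log y - (x - y) / x ≤ 1 / y - 1 / x := by
  have hx : 0 < x := hy.trans_le hyx
  rw [← Real.log_div hx.ne' hy.ne']
  have h1 := Real.one_sub_inv_le_log_of_pos (div_pos hx hy)
  have h2 := Real.log_le_sub_one_of_pos (div_pos hx hy)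
  have h3 : (x - y) / x = 1 - (x / y)⁻¹ := by field_simp
  refine ⟨by linarith, ?_⟩
  have h4 : 1 / y - 1 / x - (x / y - 1 - (x - y) / x) = (x - y) * (1 - (x - y)) / (x * y) := by
    field_simp
  have h5 : 0 ≤ (x - y) * (1 - (x - y)) / (x * y) :=
    div_nonneg (mul_nonneg (by linarith) (by linarith)) (by positivity)
  linarith

/-- Partial summation against `1 / log n`. -/
theorem exists_tendsto_sum_div_log {b : ℕ → ℝ} {δ K : ℝ}
    (hb : ∀ N : ℕ, 1 ≤ N → |∑ n ∈ range (N + 1), b n - δ * Real.log N| ≤ K) :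
    ∃ c, Tendsto (fun N : ℕ => ∑ n ∈ range (N + 1), b n / Real.log n -
      δ * Real.log (Real.log N)) atTop (𝓝 c) := by
  set l : ℕ → ℝ := fun i => Real.log ((i : ℝ) + 1) with hl
  have hlpos (i : ℕ) : 0 < l (i + 1) := by
    simp only [hl]; push_cast
    exact Real.log_pos (by linarith [(Nat.cast_nonneg i : (0 : ℝ) ≤ i)])
  have hlmono : Monotone l := fun i j hij => by
    simp only [hl]
    have : (i : ℝ) ≤ j := by exact_mod_cast hij
    exact Real.log_le_log (by positivity) (by linarith)
  have hlstep (i : ℕ) : l (i + 1) - l i ≤ 1 := by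
    simp only [hl]; push_cast
    rw [← Real.log_div (by positivity) (by positivity)]
    refine (Real.log_le_sub_one_of_pos (by positivity)).trans ?_
    rw [sub_le_iff_le_add, div_le_iff₀ (by positivity)]
    linarith [(Nat.cast_nonneg i : (0 : ℝ) ≤ i)]
  have hltop : Tendsto l atTop atTop :=
    Real.tendsto_log_atTop.comp
      (tendsto_atTop_add_const_right _ _ tendsto_natCast_atTop_atTop)
  obtain ⟨c₁, hc₁⟩ : ∃ c₁, Tendsto (fun n => ∑ i ∈ range n,
      (1 / l (i + 1)) • (b (i + 2) - δ * (l (i + 1) - l i))) atTop (𝓝 c₁) := by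
    refine cauchySeq_tendsto_of_complete
      (Antitone.cauchySeq_series_mul_of_tendsto_zero_of_bounded (b := K + |b 0| + |b 1|)
        ?_ ?_ ?_)
    · exact fun i j hij => one_div_le_one_div_of_le (hlpos i) (hlmono (by omega))
    · simp only [one_div]
      exact tendsto_inv_atTop_zero.comp (hltop.comp (tendsto_add_atTop_nat 1))
    · intro n
      have h1 := hb (n + 1) (by omega)
      have h2 : ∑ i ∈ range n, (b (i + 2) - δ * (l (i + 1) - l i)) =
          (∑ i ∈ range (n + 1 + 1), b i - δ * Real.log ((n + 1 : ℕ) : ℝ)) - b 0 - b 1 := by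
        rw [sum_sub_distrib, ← mul_sum, sum_range_sub, sum_range_succ' _ (n + 1),
          sum_range_succ' _ n]
        simp only [hl]
        push_cast
        simp
        ring
      rw [h2, Real.norm_eq_abs]
      refine (abs_sub _ _).trans (add_le_add ((abs_sub _ _).trans (add_le_add h1 le_rfl)) le_rfl)
  set w : ℕ → ℝ := fun i => Real.log (l (i + 2)) - Real.log (l (i + 1)) -
    (l (i + 2) - l (i + 1)) / l (i + 2) with hw
  have hwb (i : ℕ) := log_log_increment_bounds (hlpos i) (hlmono (by omega : i + 1 ≤ i + 2))
    (hlstep (i + 1))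
  have hwsum : Summable w := by
    refine summable_of_sum_range_le (c := 1 / l 1) (fun i => (hwb i).1) fun n => ?_
    refine (sum_le_sum fun i _ => (hwb i).2).trans ?_
    rw [sum_range_sub' (fun i => 1 / l (i + 1))]
    have := one_div_pos.mpr (hlpos n)
    simp only [zero_add]
    linarith
  have hc₂ := hwsum.hasSum.tendsto_sum_nat
  refine ⟨c₁ + δ - δ * Real.log (l 1) - δ * ∑' i, w i, ?_⟩
  rw [← tendsto_add_atTop_iff_nat 2]
  have hlim := (((hc₁.comp (tendsto_add_atTop_nat 1)).add_const δ).sub_const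
    (δ * Real.log (l 1))).sub (hc₂.const_mul δ)
  refine hlim.congr fun n => ?_
  simp only [Function.comp_apply, smul_eq_mul]
  have e1 : ∑ k ∈ range (n + 2 + 1), b k / Real.log k =
      ∑ i ∈ range (n + 1), b (i + 2) / l (i + 1) := by
    rw [sum_range_succ' _ (n + 2), sum_range_succ' _ (n + 1)]
    simp only [hl]
    push_cast
    norm_num
  have e2 : ∑ i ∈ range (n + 1), 1 / l (i + 1) * (b (i + 2) - δ * (l (i + 1) - l i)) =
      ∑ i ∈ range (n + 1), b (i + 2) / l (i + 1) -
        δ * ∑ i ∈ range (n + 1), (l (i + 1) - l i) / l (i + 1) := by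
    rw [mul_sum, ← sum_sub_distrib]
    exact sum_congr rfl fun i _ => by ring
  have e3 : ∑ i ∈ range (n + 1), (l (i + 1) - l i) / l (i + 1) =
      ∑ i ∈ range n, (l (i + 2) - l (i + 1)) / l (i + 2) + 1 := by
    rw [sum_range_succ']
    have h0 : l 0 = 0 := by simp [hl]
    rw [zero_add, h0, sub_zero, div_self (hlpos 0).ne']
  have e4 : ∑ i ∈ range n, w i = Real.log (l (n + 1)) - Real.log (l 1) -
      ∑ i ∈ range n, (l (i + 2) - l (i + 1)) / l (i + 2) := by
    simp only [hw]
    rw [sum_sub_distrib, sum_range_sub (fun i => Real.log (l (i + 1)))]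
  have e5 : Real.log ((n + 2 : ℕ) : ℝ) = l (n + 1) := by
    simp only [hl]; push_cast; ring_nf
  rw [e1, e2, e3, e4, e5]
  ring

lemma sum_Ioc_log_eq_log_factorial (N : ℕ) :
    ∑ n ∈ Ioc 0 N, Real.log n = Real.log (N.factorial : ℝ) := by
  induction N with
  | zero => simp
  | succ k ih =>
    rw [sum_Ioc_succ_top (by omega), ih, Nat.factorial_succ, Nat.cast_mul,
      Real.log_mul (by positivity) (by positivity)]
    ring

lemma sum_Ioc_vonMangoldt_le (N : ℕ) :
    ∑ n ∈ Ioc 0 N, ArithmeticFunction.vonMangoldt n ≤ (Real.log 4 + 4) * N := by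
  simpa [Chebyshev.psi] using Chebyshev.psi_le_const_mul_self (Nat.cast_nonneg N (α := ℝ))

/-- **Mertens' first theorem**, in terms of the von Mangoldt function. -/
theorem abs_sum_vonMangoldt_div_sub_log_le {N : ℕ} (hN : 1 ≤ N) :
    |∑ n ∈ Ioc 0 N, ArithmeticFunction.vonMangoldt n / n - Real.log N| ≤ Real.log 4 + 5 := by
  have hN0 : (0 : ℝ) < N := by exact_mod_cast hN
  have h1 : Real.log (N.factorial : ℝ) =
      ∑ d ∈ Ioc 0 N, ArithmeticFunction.vonMangoldt d * ((N / d : ℕ) : ℝ) := by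
    rw [← sum_Ioc_log_eq_log_factorial, ← ArithmeticFunction.sum_Ioc_mul_zeta_eq_sum,
      ArithmeticFunction.vonMangoldt_mul_zeta]
    simp [ArithmeticFunction.log_apply]
  have hfac_le : Real.log (N.factorial : ℝ) ≤ N * Real.log N := by
    rw [← Real.log_pow]
    exact Real.log_le_log (by positivity) (by exact_mod_cast Nat.factorial_le_pow N)
  have hfac_ge : N * Real.log N - N ≤ Real.log (N.factorial : ℝ) := by
    have h := Real.pow_div_factorial_le_exp (N : ℝ) hN0.le N
    have h' := Real.log_le_log (by positivity) h
    rw [Real.log_exp, Real.log_div (by positivity) (by positivity), Real.log_pow] at h'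
    linarith
  set M := ∑ n ∈ Ioc 0 N, ArithmeticFunction.vonMangoldt n / n with hM
  have hfloor_le : Real.log (N.factorial : ℝ) ≤ N * M := by
    rw [h1, hM, mul_sum]
    refine sum_le_sum fun d _ => ?_
    rw [mul_div_left_comm]
    exact mul_le_mul_of_nonneg_left Nat.cast_div_le ArithmeticFunction.vonMangoldt_nonneg
  have hfloor_ge : N * M - (Real.log 4 + 4) * N ≤ Real.log (N.factorial : ℝ) := by
    have : N * M - ∑ n ∈ Ioc 0 N, ArithmeticFunction.vonMangoldt n ≤
        Real.log (N.factorial : ℝ) := by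
      rw [h1, hM, mul_sum, ← sum_sub_distrib]
      refine sum_le_sum fun d hd => ?_
      have h2 : (N : ℝ) / d ≤ ((N / d : ℕ) : ℝ) + 1 := by
        rw [← Nat.floor_div_eq_div (K := ℝ)]
        exact (Nat.lt_floor_add_one _).le
      have h3 := mul_le_mul_of_nonneg_left h2
        (ArithmeticFunction.vonMangoldt_nonneg (n := d))
      have h4 : (N : ℝ) * (ArithmeticFunction.vonMangoldt d / d) =
        ArithmeticFunction.vonMangoldt d * (N / d) := by ring
      linarith
    linarith [sum_Ioc_vonMangoldt_le N]
  rw [abs_le]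
  have hlog4 : 0 < Real.log 4 := Real.log_pos (by norm_num)
  constructor
  · refine le_of_mul_le_mul_left ?_ hN0
    nlinarith
  · refine le_of_mul_le_mul_left ?_ hN0
    nlinarith

lemma abs_sub_le_of_tendsto_sum_div {f : ℕ → ℝ} {C L : ℝ}
    (hC : ∀ N : ℕ, |∑ n ∈ Ioc 0 N, f n| ≤ C)
    (hL : Tendsto (fun N : ℕ => ∑ n ∈ Ioc 0 N, f n / n) atTop (𝓝 L)) (N : ℕ) :
    |∑ n ∈ Ioc 0 N, f n / n - L| ≤ 2 * C / (N + 1) := by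
  set A : ℕ → ℝ := fun N => ∑ n ∈ Ioc 0 N, f n with hA
  set T : ℕ → ℝ := fun N => ∑ n ∈ Ioc 0 N, f n / n with hT
  set W : ℕ → ℝ := fun N => T N - A N * (1 / ((N : ℝ) + 1)) with hW
  have hlim0 : Tendsto (fun N : ℕ => 1 / ((N : ℝ) + 1)) atTop (𝓝 0) :=
    tendsto_one_div_add_atTop_nhds_zero_nat
  have hWlim : Tendsto W atTop (𝓝 L) := by
    have h0 : Tendsto (fun N : ℕ => A N * (1 / ((N : ℝ) + 1))) atTop (𝓝 0) := by
      refine squeeze_zero_norm (a := fun N : ℕ => C * (1 / ((N : ℝ) + 1))) (fun N => ?_) ?_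
      · rw [norm_mul, Real.norm_eq_abs, Real.norm_eq_abs,
          abs_of_nonneg (by positivity : 0 ≤ 1 / ((N : ℝ) + 1))]
        exact mul_le_mul_of_nonneg_right (hC N) (by positivity)
      · simpa using hlim0.const_mul C
    have h := hL.sub h0
    rwa [sub_zero] at h
  have hstep (N : ℕ) : W (N + 1) - W N =
      A (N + 1) * (1 / ((N : ℝ) + 1) - 1 / ((N : ℝ) + 1 + 1)) := by
    have h1 : A (N + 1) = A N + f (N + 1) := by
      simp only [hA]; rw [sum_Ioc_succ_top (by omega)]
    have h2 : T (N + 1) = T N + f (N + 1) / ((N : ℝ) + 1) := by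
      simp only [hT]; rw [sum_Ioc_succ_top (by omega)]; push_cast; ring
    simp only [hW, h1, h2]
    push_cast
    ring
  have hdiff (N : ℕ) : 0 ≤ 1 / ((N : ℝ) + 1) - 1 / ((N : ℝ) + 1 + 1) :=
    sub_nonneg.mpr (one_div_le_one_div_of_le (by positivity) (by linarith))
  have hup : Antitone fun N : ℕ => W N + C * (1 / ((N : ℝ) + 1)) := by
    refine antitone_nat_of_succ_le fun N => ?_
    have := mul_le_mul_of_nonneg_right (abs_le.mp (hC (N + 1))).2 (hdiff N)
    have := hstep N
    simp only [hA] at this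
    push_cast
    linarith
  have hlow : Monotone fun N : ℕ => W N - C * (1 / ((N : ℝ) + 1)) := by
    refine monotone_nat_of_le_succ fun N => ?_
    have := mul_le_mul_of_nonneg_right (abs_le.mp (hC (N + 1))).1 (hdiff N)
    have := hstep N
    simp only [hA] at this
    push_cast
    linarith
  have h1 := hup.le_of_tendsto (by simpa using hWlim.add (hlim0.const_mul C)) N
  have h2 := hlow.ge_of_tendsto (by simpa using hWlim.sub (hlim0.const_mul C)) N
  have h3 := abs_le.mp (hC N)
  have hp : 0 ≤ 1 / ((N : ℝ) + 1) := by positivity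
  have h4 := mul_le_mul_of_nonneg_right h3.1 hp
  have h5 := mul_le_mul_of_nonneg_right h3.2 hp
  have e : 2 * C / ((N : ℝ) + 1) = C * (1 / ((N : ℝ) + 1)) + C * (1 / ((N : ℝ) + 1)) := by ring
  simp only [hW, hA] at h1 h2
  rw [e, abs_le]
  constructor <;> linarith

lemma exists_bound_sum_mul_log_div {f : ℕ → ℝ} {C : ℝ}
    (hC : ∀ N : ℕ, |∑ n ∈ Ioc 0 N, f n| ≤ C) :
    ∃ K, ∀ N : ℕ, |∑ n ∈ Ioc 0 N, f n * Real.log n / n| ≤ K := by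
  have hsplit (g : ℕ → ℝ) (n : ℕ) : ∑ i ∈ Ioc 0 (n + 2), g i =
      g 1 + g 2 + ∑ i ∈ range n, g (i + 3) := by
    induction n with
    | zero => simp [sum_Ioc_succ_top]
    | succ k ih => rw [sum_Ioc_succ_top (by omega), ih, sum_range_succ]; ring
  have hcauchy : CauchySeq fun n => ∑ i ∈ range n,
      (Real.log ((i : ℝ) + 3) / ((i : ℝ) + 3)) • f (i + 3) := by
    refine Antitone.cauchySeq_series_mul_of_tendsto_zero_of_bounded
      (b := C + |f 1 + f 2|) ?_ ?_ ?_
    · intro i j hij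
      have hij' : (i : ℝ) ≤ j := by exact_mod_cast hij
      have he : Real.exp 1 ≤ 3 := by linarith [Real.exp_one_lt_d9]
      have hi : (0 : ℝ) ≤ i := Nat.cast_nonneg i
      exact Real.log_div_self_antitoneOn (Set.mem_Ici.mpr (by linarith))
        (Set.mem_Ici.mpr (by linarith)) (by linarith)
    · have h1 : Tendsto (fun x : ℝ => Real.log x / x) atTop (𝓝 0) := by
        simpa using Real.isLittleO_log_id_atTop.tendsto_div_nhds_zero
      exact h1.comp (tendsto_atTop_add_const_right _ _ tendsto_natCast_atTop_atTop)
    · intro n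
      have h1 := hsplit f n
      have h2 : ∑ i ∈ range n, f (i + 3) = ∑ i ∈ Ioc 0 (n + 2), f i - (f 1 + f 2) := by
        rw [h1]; ring
      rw [h2]
      exact (abs_sub _ _).trans (add_le_add (hC _) le_rfl)
  obtain ⟨c, hc⟩ := cauchySeq_tendsto_of_complete hcauchy
  have hconv : Tendsto (fun N : ℕ => ∑ n ∈ Ioc 0 N, f n * Real.log n / n) atTop
      (𝓝 (f 2 * Real.log 2 / 2 + c)) := by
    rw [← tendsto_add_atTop_iff_nat 2]
    refine (hc.const_add (f 2 * Real.log 2 / 2)).congr fun n => ?_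
    rw [hsplit (fun n => f n * Real.log n / n)]
    simp only [smul_eq_mul, Nat.cast_one, Real.log_one, mul_zero, zero_div, zero_add]
    push_cast
    congr 1
    exact sum_congr rfl fun i _ => by ring
  obtain ⟨K, hK⟩ := (Metric.isBounded_range_of_tendsto _ hconv).exists_norm_le
  exact ⟨K, fun N => hK _ (Set.mem_range_self N)⟩

/-- The analogue of Mertens' first theorem for a completely multiplicative function with bounded
partial sums and non-vanishing `∑ f(n) / n`. -/
theorem exists_bound_sum_mul_vonMangoldt_div {f : ℕ →*₀ ℝ} (hf1 : ∀ n, |f n| ≤ 1) {C L : ℝ}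
    (hC : ∀ N : ℕ, |∑ n ∈ Ioc 0 N, f n| ≤ C)
    (hL : Tendsto (fun N : ℕ => ∑ n ∈ Ioc 0 N, f n / n) atTop (𝓝 L)) (hL0 : L ≠ 0) :
    ∃ K, ∀ N : ℕ, |∑ n ∈ Ioc 0 N, f n * ArithmeticFunction.vonMangoldt n / n| ≤ K := by
  obtain ⟨K, hK⟩ := exists_bound_sum_mul_log_div hC
  have hC0 : 0 ≤ C := (abs_nonneg _).trans (hC 0)
  refine ⟨(K + 2 * C * (Real.log 4 + 4)) / |L|, fun N => ?_⟩
  set T : ℕ → ℝ := fun N => ∑ n ∈ Ioc 0 N, f n / n with hT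
  have hconv : ∑ n ∈ Ioc 0 N, f n * Real.log n / n =
      ∑ d ∈ Ioc 0 N, f d * ArithmeticFunction.vonMangoldt d / d * T (N / d) := by
    let F : ArithmeticFunction ℝ := ⟨fun n => f n * ArithmeticFunction.vonMangoldt n / n, by simp⟩
    let G : ArithmeticFunction ℝ := ⟨fun n => f n / n, by simp⟩
    have h1 : ∀ n ∈ Ioc 0 N, f n * Real.log n / n = (F * G) n := by
      intro n _
      rw [ArithmeticFunction.mul_apply, ← ArithmeticFunction.log_apply,
        ← ArithmeticFunction.vonMangoldt_mul_zeta, ArithmeticFunction.mul_apply, mul_sum, sum_div]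
      refine sum_congr rfl fun x hx => ?_
      obtain ⟨hx1, hx2⟩ := Nat.mem_divisorsAntidiagonal.mp hx
      have hx2' : x.2 ≠ 0 := fun h => hx2 (by rw [← hx1, h, mul_zero])
      change _ = f x.1 * ArithmeticFunction.vonMangoldt x.1 / x.1 * (f x.2 / x.2)
      rw [← hx1, map_mul, ArithmeticFunction.natCoe_apply,
        ArithmeticFunction.zeta_apply_ne hx2']
      push_cast
      rw [div_mul_div_comm]
      ring
    rw [sum_congr rfl h1, ArithmeticFunction.sum_Ioc_mul_eq_sum_sum]
    rfl
  have herr : |∑ d ∈ Ioc 0 N, f d * ArithmeticFunction.vonMangoldt d / d * (T (N / d) - L)| ≤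
      2 * C * (Real.log 4 + 4) := by
    rcases Nat.eq_zero_or_pos N with rfl | hN
    · have : 0 < Real.log 4 := Real.log_pos (by norm_num)
      simp only [Ioc_self, sum_empty, abs_zero]
      positivity
    have hN0 : (0 : ℝ) < N := by exact_mod_cast hN
    have hterm : ∀ d ∈ Ioc 0 N,
        |f d * ArithmeticFunction.vonMangoldt d / d * (T (N / d) - L)| ≤
          ArithmeticFunction.vonMangoldt d * (2 * C / N) := by
      intro d hd
      have hd0 : (0 : ℝ) < d := by exact_mod_cast (mem_Ioc.mp hd).1
      have hΛ := ArithmeticFunction.vonMangoldt_nonneg (n := d)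
      have h2 : (N : ℝ) / d ≤ ((N / d : ℕ) : ℝ) + 1 := by
        rw [← Nat.floor_div_eq_div (K := ℝ)]
        exact (Nat.lt_floor_add_one _).le
      have h3 : |T (N / d) - L| ≤ 2 * C / (N / d) :=
        (abs_sub_le_of_tendsto_sum_div hC hL (N / d)).trans
          (div_le_div_of_nonneg_left (by positivity) (by positivity) h2)
      rw [abs_mul, abs_div, abs_mul, abs_of_nonneg hΛ, abs_of_pos hd0]
      calc |f d| * ArithmeticFunction.vonMangoldt d / d * |T (N / d) - L|
          ≤ 1 * ArithmeticFunction.vonMangoldt d / d * (2 * C / (N / d)) := by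
            gcongr
            exact hf1 d
        _ = _ := by field_simp
    refine (abs_sum_le_sum_abs _ _).trans ((sum_le_sum hterm).trans ?_)
    rw [← sum_mul]
    calc _ ≤ (Real.log 4 + 4) * N * (2 * C / N) :=
          mul_le_mul_of_nonneg_right (sum_Ioc_vonMangoldt_le N) (by positivity)
      _ = _ := by field_simp
  have hmain : L * ∑ n ∈ Ioc 0 N, f n * ArithmeticFunction.vonMangoldt n / n =
      ∑ n ∈ Ioc 0 N, f n * Real.log n / n -
        ∑ d ∈ Ioc 0 N, f d * ArithmeticFunction.vonMangoldt d / d * (T (N / d) - L) := by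
    rw [hconv, ← sum_sub_distrib, mul_sum]
    exact sum_congr rfl fun d _ => by ring
  rw [le_div_iff₀ (abs_pos.mpr hL0), mul_comm, ← abs_mul, hmain]
  exact (abs_sub _ _).trans (add_le_add (hK N) herr)

lemma summable_nonprime_vonMangoldt_div :
    Summable fun n : ℕ => (if n.Prime then 0 else ArithmeticFunction.vonMangoldt n) / (n : ℝ) := by
  have := ArithmeticFunction.vonMangoldt.summable_residueClass_non_primes_div (q := 1) 0
  refine this.congr fun n => ?_
  have : n ∈ {m : ℕ | (m : ZMod 1) = 0} := Subsingleton.elim _ _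
  rw [ArithmeticFunction.vonMangoldt.residueClass, Set.indicator_of_mem this]

/-- Passing from the von Mangoldt function to primes in sums with bounded weights. -/
lemma exists_bound_sum_prime_sub_sum_vonMangoldt {f : ℕ → ℝ} (hf1 : ∀ n, |f n| ≤ 1) :
    ∃ K, ∀ N : ℕ, |∑ n ∈ range (N + 1), (if n.Prime then f n * Real.log n / n else 0) -
      ∑ n ∈ Ioc 0 N, f n * ArithmeticFunction.vonMangoldt n / n| ≤ K := by
  set g : ℕ → ℝ := fun n => (if n.Prime then 0 else ArithmeticFunction.vonMangoldt n) / (n : ℝ)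
    with hg
  have hg0 (n : ℕ) : 0 ≤ g n := by
    simp only [hg]
    split_ifs
    · simp
    · exact div_nonneg ArithmeticFunction.vonMangoldt_nonneg (Nat.cast_nonneg n)
  refine ⟨∑' n, g n, fun N => ?_⟩
  have h1 : ∑ n ∈ Ioc 0 N, f n * ArithmeticFunction.vonMangoldt n / n =
      ∑ n ∈ range (N + 1), f n * ArithmeticFunction.vonMangoldt n / n := by
    refine sum_subset (fun n hn => ?_) fun n hn hn' => ?_
    · simp only [mem_Ioc, mem_range] at hn ⊢; omega
    · have : n = 0 := by simp only [mem_Ioc, mem_range] at hn hn'; omega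
      simp [this]
  rw [h1, ← sum_sub_distrib]
  refine (abs_sum_le_sum_abs _ _).trans ((sum_le_sum fun n _ => ?_).trans
    (summable_nonprime_vonMangoldt_div.sum_le_tsum (range (N + 1)) fun n _ => hg0 n))
  split_ifs with hp
  · rw [ArithmeticFunction.vonMangoldt_apply_prime hp, sub_self, abs_zero]
    exact hg0 n
  · simp only [hg, if_neg hp]
    rw [zero_sub, abs_neg, mul_div_assoc, abs_mul,
      abs_of_nonneg (div_nonneg ArithmeticFunction.vonMangoldt_nonneg (Nat.cast_nonneg n))]
    exact mul_le_of_le_one_left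
      (div_nonneg ArithmeticFunction.vonMangoldt_nonneg (Nat.cast_nonneg n)) (hf1 n)

lemma abs_neg_log_one_sub_sub_le {x : ℝ} (hx : |x| ≤ 1 / 2) :
    |-Real.log (1 - x) - x| ≤ 2 * x ^ 2 := by
  have h := Real.abs_log_sub_add_sum_range_le (x := x) (by linarith) 1
  simp only [range_one, sum_singleton, zero_add, pow_one, Nat.cast_zero, div_one] at h
  rw [show -Real.log (1 - x) - x = -(x + Real.log (1 - x)) by ring, abs_neg]
  refine h.trans ?_
  rw [div_le_iff₀ (by linarith), show |x| ^ (1 + 1) = x ^ 2 from sq_abs x]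
  nlinarith [sq_nonneg x]

/-- The twist `n ↦ f n / n ^ (1 + ε)` of a completely multiplicative function. -/
noncomputable def dirichletTwist (f : ℕ →*₀ ℝ) (ε : ℝ) : ℕ →*₀ ℝ where
  toFun n := f n / n * (n : ℝ) ^ (-ε)
  map_zero' := by simp
  map_one' := by simp
  map_mul' m n := by
    rw [map_mul, Nat.cast_mul, Real.mul_rpow (Nat.cast_nonneg m) (Nat.cast_nonneg n)]
    ring

lemma dirichletTwist_apply (f : ℕ →*₀ ℝ) (ε : ℝ) (n : ℕ) :
    dirichletTwist f ε n = f n / n * (n : ℝ) ^ (-ε) := rfl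

section Twist

variable {f : ℕ →*₀ ℝ}

lemma abs_dirichletTwist_le (hf1 : ∀ n, |f n| ≤ 1) (ε : ℝ) (n : ℕ) :
    |dirichletTwist f ε n| ≤ 1 / n * (n : ℝ) ^ (-ε) := by
  rw [dirichletTwist_apply, abs_mul, abs_div, Nat.abs_cast,
    abs_of_nonneg (Real.rpow_nonneg (Nat.cast_nonneg n) _)]
  gcongr
  exact hf1 n

lemma abs_dirichletTwist_le_one_div (hf1 : ∀ n, |f n| ≤ 1) {ε : ℝ} (hε : 0 ≤ ε) {n : ℕ}
    (hn : 1 ≤ n) : |dirichletTwist f ε n| ≤ 1 / n := by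
  refine (abs_dirichletTwist_le hf1 ε n).trans (mul_le_of_le_one_right (by positivity) ?_)
  exact Real.rpow_le_one_of_one_le_of_nonpos (by exact_mod_cast hn) (by linarith)

lemma summable_one_div_mul_rpow_neg {ε : ℝ} (hε : 0 < ε) :
    Summable fun n : ℕ => 1 / (n : ℝ) * (n : ℝ) ^ (-ε) := by
  refine (Real.summable_nat_rpow.mpr (by linarith : -1 - ε < -1)).congr fun n => ?_
  rcases Nat.eq_zero_or_pos n with rfl | hn
  · rw [Nat.cast_zero, Real.zero_rpow (by linarith)]
    simp
  · rw [Real.rpow_sub (by positivity), Real.rpow_neg_one, Real.rpow_neg (by positivity)]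
    field_simp

lemma summable_abs_dirichletTwist (hf1 : ∀ n, |f n| ≤ 1) {ε : ℝ} (hε : 0 < ε) :
    Summable fun n => |dirichletTwist f ε n| :=
  Summable.of_nonneg_of_le (fun _ => abs_nonneg _) (abs_dirichletTwist_le hf1 ε)
    (summable_one_div_mul_rpow_neg hε)

/-- The second-order part of the Euler factor at a prime. -/
noncomputable def eulerLogRemainder (f : ℕ →*₀ ℝ) (ε : ℝ) (n : ℕ) : ℝ :=
  if n.Prime then -Real.log (1 - dirichletTwist f ε n) - dirichletTwist f ε n else 0

lemma abs_dirichletTwist_prime_le_half (hf1 : ∀ n, |f n| ≤ 1) {ε : ℝ} (hε : 0 ≤ ε) {p : ℕ}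
    (hp : p.Prime) : |dirichletTwist f ε p| ≤ 1 / 2 := by
  refine (abs_dirichletTwist_le_one_div hf1 hε hp.one_le).trans ?_
  have : (2 : ℝ) ≤ p := by exact_mod_cast hp.two_le
  exact one_div_le_one_div_of_le (by norm_num) this

lemma abs_eulerLogRemainder_le (hf1 : ∀ n, |f n| ≤ 1) {ε : ℝ} (hε : 0 ≤ ε) (n : ℕ) :
    |eulerLogRemainder f ε n| ≤ 2 * (1 / (n : ℝ) ^ 2) := by
  unfold eulerLogRemainder
  split_ifs with hp
  · refine (abs_neg_log_one_sub_sub_le (abs_dirichletTwist_prime_le_half hf1 hε hp)).trans ?_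
    have h := abs_dirichletTwist_le_one_div hf1 hε hp.one_le
    have h2 := pow_le_pow_left₀ (abs_nonneg _) h 2
    rw [sq_abs, div_pow, one_pow] at h2
    linarith
  · rw [abs_zero]; positivity

lemma summable_two_mul_one_div_sq : Summable fun n : ℕ => 2 * (1 / (n : ℝ) ^ 2) :=
  (Real.summable_one_div_nat_pow.mpr one_lt_two).mul_left 2

lemma summable_eulerLogRemainder (hf1 : ∀ n, |f n| ≤ 1) {ε : ℝ} (hε : 0 ≤ ε) :
    Summable (eulerLogRemainder f ε) :=
  Summable.of_norm_bounded summable_two_mul_one_div_sq (abs_eulerLogRemainder_le hf1 hε)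

lemma tendsto_dirichletTwist (n : ℕ) (hn : n ≠ 0) :
    Tendsto (fun ε => dirichletTwist f ε n) (𝓝[>] 0) (𝓝 (dirichletTwist f 0 n)) := by
  have hn' : (n : ℝ) ≠ 0 := by exact_mod_cast hn
  have : Continuous fun ε : ℝ => (n : ℝ) ^ (-ε) :=
    (Real.continuous_const_rpow hn').comp continuous_neg
  exact (this.const_mul (f n / n)).continuousWithinAt.tendsto

lemma tendsto_tsum_eulerLogRemainder (hf1 : ∀ n, |f n| ≤ 1) :
    Tendsto (fun ε => ∑' n, eulerLogRemainder f ε n) (𝓝[>] 0)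
      (𝓝 (∑' n, eulerLogRemainder f 0 n)) := by
  refine tendsto_tsum_of_dominated_convergence summable_two_mul_one_div_sq (fun n => ?_) ?_
  · unfold eulerLogRemainder
    split_ifs with hp
    · have h := tendsto_dirichletTwist (f := f) n hp.ne_zero
      have hb := (abs_le.mp (abs_dirichletTwist_prime_le_half hf1 le_rfl hp)).2
      exact ((tendsto_const_nhds.sub h).log (by linarith)).neg.sub h
    · exact tendsto_const_nhds
  · filter_upwards [self_mem_nhdsWithin] with ε hε n
    exact abs_eulerLogRemainder_le hf1 (le_of_lt hε) n

lemma summable_prime_dirichletTwist (hf1 : ∀ n, |f n| ≤ 1) {ε : ℝ} (hε : 0 < ε) :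
    Summable fun n : ℕ => if n.Prime then dirichletTwist f ε n else 0 := by
  refine Summable.of_norm_bounded (summable_abs_dirichletTwist hf1 hε) fun n => ?_
  split_ifs
  · exact le_rfl
  · simp

/-- The logarithm of the Euler product. -/
lemma log_tsum_dirichletTwist (hf1 : ∀ n, |f n| ≤ 1) {ε : ℝ} (hε : 0 < ε) :
    Real.log (∑' n, dirichletTwist f ε n) =
      (∑' n : ℕ, if n.Prime then dirichletTwist f ε n else 0) +
        ∑' n, eulerLogRemainder f ε n := by
  have hs1 := summable_prime_dirichletTwist hf1 hε
  have hs2 := summable_eulerLogRemainder hf1 hε.le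
  rw [← hs1.tsum_add hs2]
  have h1 := (hs1.add hs2).hasSum.tendsto_sum_nat
  have h2 := EulerProduct.eulerProduct_completely_multiplicative
    (f := dirichletTwist f ε) (summable_abs_dirichletTwist hf1 hε)
  have h3 := (Real.continuous_exp.tendsto _).comp h1
  have h4 : ∀ N : ℕ, ∏ p ∈ N.primesBelow, (1 - dirichletTwist f ε p)⁻¹ =
      Real.exp (∑ n ∈ range N, ((if n.Prime then dirichletTwist f ε n else 0) +
        eulerLogRemainder f ε n)) := by
    intro N
    rw [Real.exp_sum, Nat.primesBelow, prod_filter]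
    refine prod_congr rfl fun n _ => ?_
    unfold eulerLogRemainder
    split_ifs with hp
    · have hb := (abs_le.mp (abs_dirichletTwist_prime_le_half hf1 hε.le hp)).2
      rw [add_sub_cancel, Real.exp_neg, Real.exp_log (by linarith)]
    · simp
  have h5 := tendsto_nhds_unique h2 (h3.congr fun N => (h4 N).symm)
  rw [h5, Real.log_exp]

/-- **Mertens' third theorem** for a completely multiplicative weight `f`, from the analogue of
the first theorem and the behaviour of `∑ f(n) / n ^ (1 + ε)` as `ε → 0⁺`. -/
theorem tendsto_sum_neg_log_one_sub_div (hf1 : ∀ n, |f n| ≤ 1) {δ K ℓ : ℝ}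
    (hK : ∀ N : ℕ, 1 ≤ N →
      |∑ n ∈ Ioc 0 N, f n * ArithmeticFunction.vonMangoldt n / n - δ * Real.log N| ≤ K)
    (hℓ : Tendsto (fun ε : ℝ => Real.log (∑' n, dirichletTwist f ε n) + δ * Real.log ε)
      (𝓝[>] 0) (𝓝 ℓ)) :
    Tendsto (fun N : ℕ => ∑ p ∈ (N + 1).primesBelow, -Real.log (1 - f p / p) -
      δ * Real.log (Real.log N)) atTop (𝓝 (ℓ + δ * Real.eulerMascheroniConstant)) := by
  set a : ℕ → ℝ := fun n => if n.Prime then f n / n else 0 with ha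
  obtain ⟨K', hK'⟩ := exists_bound_sum_prime_sub_sum_vonMangoldt hf1
  obtain ⟨c, hc⟩ := exists_tendsto_sum_div_log
    (b := fun n : ℕ => if n.Prime then f n * Real.log n / n else 0) (δ := δ) (K := K' + K)
    fun N hN => (abs_sub_le _ _ _).trans (add_le_add (hK' N) (hK N hN))
  have hc' : Tendsto (fun N : ℕ => ∑ n ∈ range (N + 1), a n - δ * Real.log (Real.log N))
      atTop (𝓝 c) := by
    refine hc.congr fun N => ?_
    congr 1
    refine sum_congr rfl fun n _ => ?_
    simp only [ha]
    split_ifs with hp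
    · have : Real.log n ≠ 0 := (Real.log_pos (by exact_mod_cast hp.one_lt)).ne'
      field_simp
    · simp
  have haε (ε : ℝ) (n : ℕ) : a n * (n : ℝ) ^ (-ε) =
      if n.Prime then dirichletTwist f ε n else 0 := by
    simp only [ha, dirichletTwist_apply, ite_mul, zero_mul]
  have hs (ε : ℝ) (hε : 0 < ε) : Summable fun n : ℕ => |a n| * (n : ℝ) ^ (-ε) := by
    refine (summable_prime_dirichletTwist hf1 hε).abs.congr fun n => ?_
    rw [← haε, abs_mul, abs_of_nonneg (Real.rpow_nonneg (Nat.cast_nonneg n) _)]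
  have hA := tendsto_tsum_mul_rpow_neg_add_log (by simp [ha]) hs hc'
  have hB := hℓ.sub (tendsto_tsum_eulerLogRemainder hf1)
  have hAB := tendsto_nhds_unique hA (hB.congr' (by
    filter_upwards [self_mem_nhdsWithin] with ε hε
    rw [log_tsum_dirichletTwist hf1 hε]
    simp only [haε]
    ring))
  have hfin := (((summable_eulerLogRemainder hf1 le_rfl).hasSum.tendsto_sum_nat).comp
    (tendsto_add_atTop_nat 1)).add hc'
  have hval : ∑' n, eulerLogRemainder f 0 n + c = ℓ + δ * Real.eulerMascheroniConstant := by
    linarith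
  rw [hval] at hfin
  refine hfin.congr fun N => ?_
  have h0 (n : ℕ) : dirichletTwist f 0 n = f n / n := by simp [dirichletTwist_apply]
  simp only [Function.comp_apply]
  rw [← add_sub_assoc, ← sum_add_distrib, Nat.primesBelow, sum_filter]
  congr 1
  refine sum_congr rfl fun n _ => ?_
  simp only [eulerLogRemainder, ha, h0]
  split_ifs <;> ring

end Twist

/-- The completely multiplicative function equal to `1` away from `0`. -/
noncomputable def trivialWeight : ℕ →*₀ ℝ where
  toFun n := if n = 0 then 0 else 1
  map_zero' := by simp
  map_one' := by simp
  map_mul' m n := by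
    rcases eq_or_ne m 0 with rfl | hm
    · simp
    rcases eq_or_ne n 0 with rfl | hn
    · simp
    simp [hm, hn]

lemma trivialWeight_apply {n : ℕ} (hn : n ≠ 0) : trivialWeight n = 1 := if_neg hn

lemma abs_trivialWeight_le_one (n : ℕ) : |trivialWeight n| ≤ 1 := by
  rcases eq_or_ne n 0 with rfl | hn
  · simp
  · simp [trivialWeight_apply hn]

lemma exp_sum_log_primesBelow {f : ℕ →*₀ ℝ} (hf1 : ∀ n, |f n| ≤ 1) (N : ℕ) :
    Real.exp (-∑ p ∈ N.primesBelow, -Real.log (1 - f p / p)) =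
      ∏ p ∈ N.primesBelow, (1 - f p / p) := by
  rw [sum_neg_distrib, neg_neg, Real.exp_sum]
  refine prod_congr rfl fun p hp => Real.exp_log ?_
  have hb := (abs_le.mp (abs_dirichletTwist_prime_le_half hf1 le_rfl
    (Nat.prime_of_mem_primesBelow hp))).2
  rw [dirichletTwist_apply, neg_zero, Real.rpow_zero, mul_one] at hb
  linarith

/-- **Mertens' third theorem**. -/
theorem tendsto_log_mul_prod_one_sub_inv_prime :
    Tendsto (fun N : ℕ => Real.log N * ∏ p ∈ (N + 1).primesBelow, (1 - 1 / (p : ℝ))) atTop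
      (𝓝 (Real.exp (-Real.eulerMascheroniConstant))) := by
  have hℓ : Tendsto (fun ε : ℝ => Real.log (∑' n, dirichletTwist trivialWeight ε n) +
      1 * Real.log ε) (𝓝[>] 0) (𝓝 0) := by
    have hmap : Tendsto (fun ε : ℝ => 1 + ε) (𝓝[>] 0) (𝓝[>] 1) := by
      refine tendsto_nhdsWithin_of_tendsto_nhds_of_eventually_within _ ?_ ?_
      · have : Continuous fun ε : ℝ => 1 + ε := by fun_prop
        simpa using (this.continuousWithinAt (s := Set.Ioi 0) (x := 0)).tendsto
      · filter_upwards [self_mem_nhdsWithin] with ε hε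
        have : 0 < ε := hε
        rw [Set.mem_Ioi]
        linarith
    have h := (tendsto_sub_mul_tsum_nat_rpow.comp hmap).log one_ne_zero
    rw [Real.log_one] at h
    refine h.congr' ?_
    filter_upwards [self_mem_nhdsWithin] with ε hε
    have hε' : (0 : ℝ) < ε := hε
    have heq (n : ℕ) : 1 / (n : ℝ) ^ (1 + ε) = dirichletTwist trivialWeight ε n := by
      rw [dirichletTwist_apply]
      rcases Nat.eq_zero_or_pos n with rfl | hn
      · rw [Nat.cast_zero, Real.zero_rpow (by linarith)]
        simp
      · rw [trivialWeight_apply hn.ne', Real.rpow_add (by positivity), Real.rpow_one,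
          Real.rpow_neg (by positivity)]
        field_simp
    have hpos : 0 < ∑' n, dirichletTwist trivialWeight ε n := by
      refine (summable_abs_dirichletTwist abs_trivialWeight_le_one hε').of_abs.tsum_pos
        (fun n => ?_) 1 (by simp)
      rw [← heq]
      positivity
    simp only [Function.comp_apply, add_sub_cancel_left, heq]
    rw [Real.log_mul hε'.ne' hpos.ne']
    ring
  have hK (N : ℕ) (hN : 1 ≤ N) :
      |∑ n ∈ Ioc 0 N, trivialWeight n * ArithmeticFunction.vonMangoldt n / n -
        1 * Real.log N| ≤ Real.log 4 + 5 := by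
    rw [one_mul, sum_congr rfl (g := fun n : ℕ => ArithmeticFunction.vonMangoldt n / (n : ℝ))]
    · exact abs_sum_vonMangoldt_div_sub_log_le hN
    · intro n hn
      rw [trivialWeight_apply (mem_Ioc.mp hn).1.ne', one_mul]
  have h := tendsto_sum_neg_log_one_sub_div abs_trivialWeight_le_one hK hℓ
  have h' := (Real.continuous_exp.tendsto _).comp h.neg
  rw [zero_add, one_mul] at h'
  refine h'.congr' ?_
  filter_upwards [eventually_ge_atTop 2] with N hN
  have hlog : 0 < Real.log N := Real.log_pos (by exact_mod_cast hN)
  simp only [Function.comp_apply]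
  rw [neg_sub, sub_eq_add_neg, Real.exp_add, one_mul, Real.exp_log hlog,
    exp_sum_log_primesBelow abs_trivialWeight_le_one]
  congr 1
  refine prod_congr rfl fun p hp => ?_
  rw [trivialWeight_apply (Nat.prime_of_mem_primesBelow hp).ne_zero]

/-- Conditional convergence of the Euler product at `1`. -/
theorem tendsto_prod_one_sub_div {f : ℕ →*₀ ℝ} (hf1 : ∀ n, |f n| ≤ 1) {C L : ℝ}
    (hC : ∀ N : ℕ, |∑ n ∈ Ioc 0 N, f n| ≤ C)
    (hL : Tendsto (fun N : ℕ => ∑ n ∈ Ioc 0 N, f n / n) atTop (𝓝 L)) (hL0 : 0 < L) :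
    Tendsto (fun N : ℕ => ∏ p ∈ (N + 1).primesBelow, (1 - f p / p)) atTop (𝓝 L⁻¹) := by
  obtain ⟨K, hK⟩ := exists_bound_sum_mul_vonMangoldt_div hf1 hC hL hL0.ne'
  have hL' : Tendsto (fun N : ℕ => ∑ n ∈ range (N + 1), f n / n - 0 * Real.log (Real.log N))
      atTop (𝓝 L) := by
    refine hL.congr fun N => ?_
    rw [zero_mul, sub_zero]
    refine sum_subset (fun n hn => ?_) fun n hn hn' => ?_
    · simp only [mem_Ioc, mem_range] at hn ⊢; omega
    · have : n = 0 := by simp only [mem_Ioc, mem_range] at hn hn'; omega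
      simp [this]
  have hs (ε : ℝ) (hε : 0 < ε) : Summable fun n : ℕ => |f n / n| * (n : ℝ) ^ (-ε) := by
    refine (summable_abs_dirichletTwist hf1 hε).congr fun n => ?_
    rw [dirichletTwist_apply, abs_mul, abs_of_nonneg (Real.rpow_nonneg (Nat.cast_nonneg n) _)]
  have hA := tendsto_tsum_mul_rpow_neg_add_log (a := fun n : ℕ => f n / n) (by simp) hs hL'
  have hℓ : Tendsto (fun ε : ℝ => Real.log (∑' n, dirichletTwist f ε n) + 0 * Real.log ε)
      (𝓝[>] 0) (𝓝 (Real.log L)) := by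
    simp only [zero_mul, add_zero, sub_zero] at hA ⊢
    exact hA.log hL0.ne'
  have h := tendsto_sum_neg_log_one_sub_div hf1 (δ := 0) (K := K)
    (fun N _ => by simpa using hK N) hℓ
  have h' := (Real.continuous_exp.tendsto _).comp h.neg
  rw [zero_mul, add_zero, Real.exp_neg, Real.exp_log hL0] at h'
  refine h'.congr fun N => ?_
  simp only [Function.comp_apply, zero_mul, sub_zero]
  exact exp_sum_log_primesBelow hf1 _

lemma exists_tendsto_sum_div {f : ℕ → ℝ} {C : ℝ} (hC : ∀ N : ℕ, |∑ n ∈ Ioc 0 N, f n| ≤ C) :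
    ∃ L, Tendsto (fun N : ℕ => ∑ n ∈ Ioc 0 N, f n / n) atTop (𝓝 L) := by
  have hshift (g : ℕ → ℝ) (N : ℕ) : ∑ n ∈ Ioc 0 N, g n = ∑ i ∈ range N, g (i + 1) := by
    induction N with
    | zero => simp
    | succ k ih => rw [sum_Ioc_succ_top (by omega), ih, sum_range_succ]
  have h : CauchySeq fun N => ∑ i ∈ range N, (1 / ((i : ℝ) + 1)) • f (i + 1) := by
    refine Antitone.cauchySeq_series_mul_of_tendsto_zero_of_bounded (b := C) ?_
      tendsto_one_div_add_atTop_nhds_zero_nat fun N => ?_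
    · intro i j hij
      have : (i : ℝ) ≤ j := by exact_mod_cast hij
      exact one_div_le_one_div_of_le (by positivity) (by linarith)
    · rw [← hshift]
      exact hC N
  obtain ⟨L, hL⟩ := cauchySeq_tendsto_of_complete h
  refine ⟨L, hL.congr fun N => ?_⟩
  rw [hshift]
  refine sum_congr rfl fun i _ => ?_
  push_cast
  rw [smul_eq_mul]
  ring

/-- Evaluation of a series with coefficients of period `8`, supported on odd integers, by
integrating its generating function `R`. -/
lemma tendsto_sum_block_of_hasDerivAt {c₁ c₃ c₅ c₇ : ℝ} {R G : ℝ → ℝ}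
    (hR : Continuous R) (hG : ∀ t, HasDerivAt G (R t) t)
    (hRb : ∀ t ∈ Set.Icc (0 : ℝ) 1, |R t| ≤ 2)
    (hP : ∀ t, c₁ + c₃ * t ^ 2 + c₅ * t ^ 4 + c₇ * t ^ 6 = R t * (1 - t ^ 8)) :
    Tendsto (fun k : ℕ => ∑ j ∈ range k, (c₁ / (8 * j + 1) + c₃ / (8 * j + 3) +
      c₅ / (8 * j + 5) + c₇ / (8 * j + 7) : ℝ)) atTop (𝓝 (G 1 - G 0)) := by
  set H : ℕ → ℝ → ℝ := fun k t => ∑ j ∈ range k, (c₁ / (8 * j + 1) * t ^ (8 * j + 1) +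
    c₃ / (8 * j + 3) * t ^ (8 * j + 3) + c₅ / (8 * j + 5) * t ^ (8 * j + 5) +
    c₇ / (8 * j + 7) * t ^ (8 * j + 7)) with hH
  have hmono (c : ℝ) (m : ℕ) (t : ℝ) :
      HasDerivAt (fun t : ℝ => c / ((m : ℝ) + 1) * t ^ (m + 1)) (c * t ^ m) t := by
    have h := (hasDerivAt_pow (m + 1) t).const_mul (c / ((m : ℝ) + 1))
    refine h.congr_deriv ?_
    push_cast
    field_simp
  have hHd (k : ℕ) (t : ℝ) : HasDerivAt (H k)
      (∑ j ∈ range k, (c₁ + c₃ * t ^ 2 + c₅ * t ^ 4 + c₇ * t ^ 6) * (t ^ 8) ^ j) t := by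
    simp only [hH]
    refine HasDerivAt.fun_sum fun j _ => ?_
    have h := (((hmono c₁ (8 * j) t).add (hmono c₃ (8 * j + 2) t)).add
      (hmono c₅ (8 * j + 4) t)).add (hmono c₇ (8 * j + 6) t)
    convert h using 1
    · funext x
      simp only [Pi.add_apply]
      push_cast
      ring
    · ring
  have hderiv (k : ℕ) (t : ℝ) : HasDerivAt (fun t => G t - H k t) (R t * t ^ (8 * k)) t := by
    refine ((hG t).sub (hHd k t)).congr_deriv ?_
    have hgeom : (1 - t ^ 8) * ∑ j ∈ range k, (t ^ 8) ^ j = 1 - (t ^ 8) ^ k :=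
      mul_neg_geom_sum _ _
    rw [← mul_sum, hP, mul_assoc, hgeom, pow_mul]
    ring
  have hH1 (k : ℕ) : H k 1 = ∑ j ∈ range k, (c₁ / (8 * j + 1) + c₃ / (8 * j + 3) +
      c₅ / (8 * j + 5) + c₇ / (8 * j + 7) : ℝ) := by
    simp [hH]
  have hH0 (k : ℕ) : H k 0 = 0 := by simp [hH]
  have hint (k : ℕ) : ∫ t in (0 : ℝ)..1, R t * t ^ (8 * k) = G 1 - G 0 - H k 1 := by
    rw [intervalIntegral.integral_eq_sub_of_hasDerivAt (fun t _ => hderiv k t)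
      ((hR.mul (continuous_pow _)).intervalIntegrable _ _), hH0]
    ring
  have hbound (k : ℕ) : |G 1 - G 0 - H k 1| ≤ 2 * (1 / ((k : ℝ) + 1)) := by
    rw [← hint]
    have h1 : ‖∫ t in (0 : ℝ)..1, R t * t ^ (8 * k)‖ ≤ ∫ t in (0 : ℝ)..1, 2 * t ^ (8 * k) := by
      refine intervalIntegral.norm_integral_le_of_norm_le zero_le_one
        (Eventually.of_forall fun t ht => ?_)
        ((continuous_const.mul (continuous_pow _)).intervalIntegrable _ _)
      rw [norm_mul, Real.norm_eq_abs, Real.norm_eq_abs,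
        abs_of_nonneg (pow_nonneg ht.1.le _)]
      exact mul_le_mul_of_nonneg_right (hRb t ⟨ht.1.le, ht.2⟩) (pow_nonneg ht.1.le _)
    refine h1.trans ?_
    rw [intervalIntegral.integral_const_mul, integral_pow]
    simp only [one_pow, zero_pow (Nat.succ_ne_zero _), sub_zero]
    push_cast
    gcongr
    linarith [(Nat.cast_nonneg k : (0 : ℝ) ≤ k)]
  have hlim : Tendsto (fun k : ℕ => G 1 - G 0 - H k 1) atTop (𝓝 0) := by
    refine squeeze_zero_norm hbound ?_
    simpa using (tendsto_one_div_add_atTop_nhds_zero_nat (𝕜 := ℝ)).const_mul 2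
  have h := hlim.const_sub (G 1 - G 0)
  rw [sub_zero] at h
  refine h.congr fun k => ?_
  rw [← hH1]
  ring

/-- The real completely multiplicative function attached to an integer-valued character
modulo `8`. -/
noncomputable def charWeight (χ : MulChar (ZMod 8) ℤ) : ℕ →*₀ ℝ where
  toFun n := (χ (n : ZMod 8) : ℝ)
  map_zero' := by
    rw [Nat.cast_zero, χ.map_nonunit (by decide), Int.cast_zero]
  map_one' := by simp
  map_mul' m n := by simp

lemma charWeight_apply (χ : MulChar (ZMod 8) ℤ) (n : ℕ) :
    charWeight χ n = (χ (n : ZMod 8) : ℝ) := rfl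

lemma charWeight_eight_mul_add (χ : MulChar (ZMod 8) ℤ) (j i : ℕ) :
    charWeight χ (8 * j + i) = charWeight χ i := by
  have h8 : (8 : ZMod 8) = 0 := by decide
  simp [charWeight_apply, h8]

lemma charWeight_mod_eight (χ : MulChar (ZMod 8) ℤ) (n : ℕ) :
    charWeight χ (n % 8) = charWeight χ n := by
  conv_rhs => rw [← Nat.div_add_mod n 8, charWeight_eight_mul_add]

lemma charWeight_of_even (χ : MulChar (ZMod 8) ℤ) {n : ℕ} (hn : 2 ∣ n) :
    charWeight χ n = 0 := by
  obtain ⟨m, rfl⟩ := hn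
  have h2 : charWeight χ 2 = 0 := by
    rw [charWeight_apply, χ.map_nonunit (by decide), Int.cast_zero]
  rw [map_mul, h2, zero_mul]

lemma abs_charWeight_le_one {χ : MulChar (ZMod 8) ℤ} (hχ : ∀ a, |χ a| ≤ 1) (n : ℕ) :
    |charWeight χ n| ≤ 1 := by
  rw [charWeight_apply]
  exact_mod_cast hχ n

lemma sum_Ioc_charWeight_eight_mul (χ : MulChar (ZMod 8) ℤ) (g : ℕ → ℝ) (k : ℕ) :
    ∑ n ∈ Ioc 0 (8 * k), charWeight χ n * g n =
      ∑ j ∈ range k, (charWeight χ 1 * g (8 * j + 1) + charWeight χ 3 * g (8 * j + 3) +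
        charWeight χ 5 * g (8 * j + 5) + charWeight χ 7 * g (8 * j + 7)) := by
  induction k with
  | zero => simp
  | succ k ih =>
    rw [sum_range_succ, ← ih, show 8 * (k + 1) = 8 * k + 7 + 1 by ring]
    simp only [sum_Ioc_succ_top, Nat.zero_le, show 8 * k + 7 = 8 * k + 6 + 1 by ring,
      show 8 * k + 6 = 8 * k + 5 + 1 by ring, show 8 * k + 5 = 8 * k + 4 + 1 by ring,
      show 8 * k + 4 = 8 * k + 3 + 1 by ring, show 8 * k + 3 = 8 * k + 2 + 1 by ring,
      show 8 * k + 2 = 8 * k + 1 + 1 by ring]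
    simp only [add_assoc, Nat.reduceAdd]
    rw [charWeight_of_even χ (n := 8 * k + 2) (by omega),
      charWeight_of_even χ (n := 8 * k + 4) (by omega),
      charWeight_of_even χ (n := 8 * k + 6) (by omega),
      charWeight_of_even χ (n := 8 * k + 8) (by omega)]
    simp only [charWeight_eight_mul_add]
    ring

lemma abs_sum_charWeight_le {χ : MulChar (ZMod 8) ℤ} (hχ : ∀ a, |χ a| ≤ 1)
    (hsum : χ 1 + χ 3 + χ 5 + χ 7 = 0) (N : ℕ) :
    |∑ n ∈ Ioc 0 N, charWeight χ n| ≤ 8 := by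
  have hzero : ∑ n ∈ Ioc 0 (8 * (N / 8)), charWeight χ n = 0 := by
    have h := sum_Ioc_charWeight_eight_mul χ (fun _ => 1) (N / 8)
    simp only [mul_one] at h
    rw [h]
    refine sum_eq_zero fun j _ => ?_
    simp only [charWeight_apply]
    exact_mod_cast hsum
  rw [← sum_Ioc_consecutive _ (Nat.zero_le _) (Nat.mul_div_le N 8), hzero, zero_add]
  refine (abs_sum_le_sum_abs _ _).trans
    ((sum_le_card_nsmul _ _ 1 fun n _ => abs_charWeight_le_one hχ n).trans ?_)
  rw [Nat.card_Ioc, nsmul_eq_mul, mul_one]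
  exact_mod_cast (by omega : N - 8 * (N / 8) ≤ 8)

/-- Euler product at `1` for a non-principal quadratic character modulo `8`, with the value of the
`L`-series computed from a primitive `G` of the generating function `R`. -/
lemma tendsto_prod_one_sub_charWeight_div {χ : MulChar (ZMod 8) ℤ} (hχ : ∀ a, |χ a| ≤ 1)
    (hsum : χ 1 + χ 3 + χ 5 + χ 7 = 0) {R G : ℝ → ℝ} {L : ℝ} (hR : Continuous R)
    (hG : ∀ t, HasDerivAt G (R t) t) (hRb : ∀ t ∈ Set.Icc (0 : ℝ) 1, |R t| ≤ 2)
    (hP : ∀ t, (χ 1 : ℝ) + χ 3 * t ^ 2 + χ 5 * t ^ 4 + χ 7 * t ^ 6 = R t * (1 - t ^ 8))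
    (hL : G 1 - G 0 = L) (hL0 : 0 < L) :
    Tendsto (fun N : ℕ => ∏ p ∈ (N + 1).primesBelow, (1 - charWeight χ p / p)) atTop
      (𝓝 L⁻¹) := by
  have hC := abs_sum_charWeight_le hχ hsum
  obtain ⟨L', hL'⟩ := exists_tendsto_sum_div hC
  have h8 : Tendsto (fun k : ℕ => 8 * k) atTop atTop :=
    tendsto_id.const_mul_atTop' (by norm_num)
  have hsub := hL'.comp h8
  have hblock := tendsto_sum_block_of_hasDerivAt hR hG hRb hP
  have hLL : L' = L := by
    rw [← hL]
    refine tendsto_nhds_unique hsub (hblock.congr fun k => ?_)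
    simp only [Function.comp_apply, div_eq_mul_inv]
    rw [sum_Ioc_charWeight_eight_mul χ (fun n => (n : ℝ)⁻¹)]
    refine sum_congr rfl fun j _ => ?_
    simp only [charWeight_apply]
    push_cast
    rfl
  rw [hLL] at hL'
  exact tendsto_prod_one_sub_div (abs_charWeight_le_one hχ) hC hL' hL0

/-- The non-principal character modulo `4`, viewed modulo `8`. -/
def modFourChar : MulChar (ZMod 8) ℤ := ZMod.χ₈ * ZMod.χ₈'

lemma tendsto_prod_modFourChar :
    Tendsto (fun N : ℕ => ∏ p ∈ (N + 1).primesBelow, (1 - charWeight modFourChar p / p)) atTop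
      (𝓝 (Real.pi / 4)⁻¹) := by
  have h1 : modFourChar 1 = 1 := by decide
  have h3 : modFourChar 3 = -1 := by decide
  have h5 : modFourChar 5 = 1 := by decide
  have h7 : modFourChar 7 = -1 := by decide
  refine tendsto_prod_one_sub_charWeight_div (R := fun t => 1 / (1 + t ^ 2)) (G := Real.arctan)
    (by decide) (by decide) ?_ Real.hasDerivAt_arctan (fun t _ => ?_) (fun t => ?_) ?_
    (by positivity)
  · exact continuous_const.div (by fun_prop) fun t => by positivity
  · rw [abs_of_nonneg (by positivity), div_le_iff₀ (by positivity)]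
    nlinarith [sq_nonneg t]
  · rw [h1, h3, h5, h7]
    field_simp
    push_cast
    ring
  · rw [Real.arctan_one, Real.arctan_zero, sub_zero]

lemma tendsto_prod_χ₈ :
    Tendsto (fun N : ℕ => ∏ p ∈ (N + 1).primesBelow, (1 - charWeight ZMod.χ₈ p / p)) atTop
      (𝓝 (Real.log (3 + 2 * √2) / (2 * √2))⁻¹) := by
  have h1 : ZMod.χ₈ 1 = 1 := by decide
  have h3 : ZMod.χ₈ 3 = -1 := by decide
  have h5 : ZMod.χ₈ 5 = -1 := by decide
  have h7 : ZMod.χ₈ 7 = 1 := by decide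
  have hs : √2 ^ 2 = 2 := Real.sq_sqrt (by norm_num)
  have hs0 : 0 < √2 := by positivity
  have hplus (t : ℝ) : 0 < t ^ 2 + √2 * t + 1 := by nlinarith [sq_nonneg (√2 * t + 1)]
  have hminus (t : ℝ) : 0 < t ^ 2 - √2 * t + 1 := by nlinarith [sq_nonneg (√2 * t - 1)]
  have hfac (t : ℝ) : 1 + t ^ 4 = (t ^ 2 + √2 * t + 1) * (t ^ 2 - √2 * t + 1) := by
    linear_combination t ^ 2 * hs
  refine tendsto_prod_one_sub_charWeight_div (R := fun t => (1 - t ^ 2) / (1 + t ^ 4))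
    (G := fun t => (Real.log (t ^ 2 + √2 * t + 1) - Real.log (t ^ 2 - √2 * t + 1)) / (2 * √2))
    (by decide) (by decide) ?_ (fun t => ?_) (fun t ht => ?_) (fun t => ?_) ?_ ?_
  · exact Continuous.div (by fun_prop) (by fun_prop) fun t => by positivity
  · have hd := (((((hasDerivAt_id t).pow 2).add ((hasDerivAt_id t).const_mul √2)).add_const
      1).log (hplus t).ne').sub (((((hasDerivAt_id t).pow 2).sub
        ((hasDerivAt_id t).const_mul √2)).add_const 1).log (hminus t).ne')
    refine (hd.div_const (2 * √2)).congr_deriv ?_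
    have hp := (hplus t).ne'
    have hm := (hminus t).ne'
    rw [hfac]
    simp only [Pi.add_apply, Pi.sub_apply, Pi.pow_apply, id, Nat.add_one_sub_one, pow_one,
      Nat.cast_ofNat, mul_one]
    rw [div_sub_div _ _ hp hm, div_div, div_eq_div_iff (by positivity) (by positivity)]
    ring
  · rw [abs_le, div_le_iff₀ (by positivity), le_div_iff₀ (by positivity)]
    constructor <;> nlinarith [sq_nonneg t, sq_nonneg (t ^ 2 - 1)]
  · rw [h1, h3, h5, h7]
    have : 1 + t ^ 4 ≠ 0 := by positivity
    field_simp
    push_cast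
    ring
  · have h : (2 + √2) / (2 - √2) = 3 + 2 * √2 := by
      rw [div_eq_iff (by nlinarith)]
      linear_combination 2 * hs
    simp only [one_pow, mul_one, mul_zero, sub_zero, add_zero, ne_eq, OfNat.ofNat_ne_zero,
      not_false_eq_true, zero_pow, zero_add, Real.log_one, zero_div, sub_self]
    rw [← h, Real.log_div (by positivity) (by nlinarith)]
    ring_nf
  · exact div_pos (Real.log_pos (by linarith)) (by positivity)

lemma tendsto_prod_χ₈' :
    Tendsto (fun N : ℕ => ∏ p ∈ (N + 1).primesBelow, (1 - charWeight ZMod.χ₈' p / p)) atTop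
      (𝓝 (Real.pi / (2 * √2))⁻¹) := by
  have h1 : ZMod.χ₈' 1 = 1 := by decide
  have h3 : ZMod.χ₈' 3 = 1 := by decide
  have h5 : ZMod.χ₈' 5 = -1 := by decide
  have h7 : ZMod.χ₈' 7 = -1 := by decide
  have hs : √2 ^ 2 = 2 := Real.sq_sqrt (by norm_num)
  have hs0 : 0 < √2 := by positivity
  refine tendsto_prod_one_sub_charWeight_div (R := fun t => (1 + t ^ 2) / (1 + t ^ 4))
    (G := fun t => (Real.arctan (√2 * t + 1) + Real.arctan (√2 * t - 1)) / √2)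
    (by decide) (by decide) ?_ (fun t => ?_) (fun t ht => ?_) (fun t => ?_) ?_ (by positivity)
  · exact Continuous.div (by fun_prop) (by fun_prop) fun t => by positivity
  · have hd := ((((hasDerivAt_id t).const_mul √2).add_const 1).arctan).add
      ((((hasDerivAt_id t).const_mul √2).sub_const 1).arctan)
    refine (hd.div_const √2).congr_deriv ?_
    have hp : 1 + (√2 * t + 1) ^ 2 ≠ 0 := by positivity
    have hm : 1 + (√2 * t - 1) ^ 2 ≠ 0 := by positivity
    have h4 : 1 + t ^ 4 ≠ 0 := by positivity
    simp only [id]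
    have hfac : (1 + (√2 * t + 1) ^ 2) * (1 + (√2 * t - 1) ^ 2) = 4 * (1 + t ^ 4) := by
      linear_combination (t ^ 4 * (√2 ^ 2 + 2)) * hs
    have hadd : (1 + (√2 * t + 1) ^ 2) + (1 + (√2 * t - 1) ^ 2) = 4 * (1 + t ^ 2) := by
      linear_combination (2 * t ^ 2) * hs
    have : 1 / (1 + (√2 * t + 1) ^ 2) + 1 / (1 + (√2 * t - 1) ^ 2) =
        (1 + t ^ 2) / (1 + t ^ 4) := by
      rw [div_add_div _ _ hp hm, hfac, one_mul, mul_one, add_comm (1 + (√2 * t - 1) ^ 2), hadd,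
        mul_div_mul_left _ _ (by norm_num)]
    rw [← this]
    field_simp
  · rw [abs_of_nonneg (by positivity), div_le_iff₀ (by positivity)]
    nlinarith [sq_nonneg t, sq_nonneg (t ^ 2 - 1)]
  · rw [h1, h3, h5, h7]
    have : 1 + t ^ 4 ≠ 0 := by positivity
    field_simp
    push_cast
    ring
  · have hinv : (√2 + 1)⁻¹ = √2 - 1 := by
      refine inv_eq_of_mul_eq_one_right ?_
      linear_combination hs
    have harc : Real.arctan (√2 - 1) = Real.pi / 2 - Real.arctan (√2 + 1) := by
      rw [← hinv, Real.arctan_inv_of_pos (by positivity)]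
    simp only [mul_one, mul_zero, zero_add, zero_sub, Real.arctan_neg, harc]
    field_simp
    ring

/-- The completely multiplicative function `n ↦ 1 / n ^ 2`. -/
noncomputable def invSqWeight : ℕ →*₀ ℝ where
  toFun n := 1 / (n : ℝ) ^ 2
  map_zero' := by simp
  map_one' := by simp
  map_mul' m n := by
    push_cast
    rw [mul_pow, one_div_mul_one_div]

/-- The Euler product for `ζ(2)`. -/
lemma tendsto_prod_inv_one_sub_inv_sq :
    Tendsto (fun N : ℕ => ∏ p ∈ (N + 1).primesBelow, (1 - 1 / (p : ℝ) ^ 2)⁻¹) atTop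
      (𝓝 (Real.pi ^ 2 / 6)) := by
  have hsum : Summable fun n => ‖invSqWeight n‖ := hasSum_zeta_two.summable.norm
  have h := EulerProduct.eulerProduct_completely_multiplicative hsum
  rw [show ∑' n, invSqWeight n = Real.pi ^ 2 / 6 from hasSum_zeta_two.tsum_eq] at h
  exact h.comp (tendsto_add_atTop_nat 1)

lemma multipliable_one_sub_inv_sq (s : Set ℕ) :
    Multipliable fun p : s => 1 - 1 / ((p : ℕ) : ℝ) ^ 2 := by
  have h := Real.multipliable_one_add_of_summable
    (hasSum_zeta_two.summable.neg.comp_injective (Subtype.val_injective (p := (· ∈ s))))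
  refine h.congr fun p => ?_
  simp [sub_eq_add_neg]

lemma tendsto_prod_primesBelow_filter_one_sub_inv_sq :
    Tendsto (fun N : ℕ => ∏ p ∈ (N + 1).primesBelow with p % 8 = 1, (1 - 1 / (p : ℝ) ^ 2)) atTop
      (𝓝 (∏' p : {p : ℕ // p.Prime ∧ p % 8 = 1}, (1 - 1 / ((p : ℕ) : ℝ) ^ 2))) := by
  set s : Set ℕ := {p | p.Prime ∧ p % 8 = 1}
  have h := (hasProd_subtype_iff_mulIndicator (s := s)
    (f := fun p : ℕ => 1 - 1 / (p : ℝ) ^ 2)).mp (multipliable_one_sub_inv_sq s).hasProd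
  refine (h.tendsto_prod_nat.comp (tendsto_add_atTop_nat 1)).congr fun N => ?_
  rw [Nat.primesBelow, filter_filter, prod_filter]
  refine prod_congr rfl fun p _ => ?_
  rw [Set.mulIndicator_apply]
  rfl

/-- The identity between local factors underlying the formula. -/
lemma one_sub_inv_pow_four_eq {p : ℕ} (hp : p.Prime) :
    (if p % 8 = 1 then 1 - 1 / (p : ℝ) else 1) ^ 4 =
      (1 - 1 / (p : ℝ)) * (1 - charWeight modFourChar p / p) * (1 - charWeight ZMod.χ₈ p / p) *
        (1 - charWeight ZMod.χ₈' p / p) * ((1 - 1 / (p : ℝ) ^ 2)⁻¹) ^ 2 *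
        (if p % 8 = 1 then 1 - 1 / (p : ℝ) ^ 2 else 1) ^ 2 * (if p = 2 then 9 / 8 else 1) := by
  rw [← charWeight_mod_eight modFourChar, ← charWeight_mod_eight ZMod.χ₈,
    ← charWeight_mod_eight ZMod.χ₈']
  simp only [charWeight_apply]
  have hpos : (1 : ℝ) < p := by exact_mod_cast hp.one_lt
  have hp0 : (p : ℝ) ≠ 0 := by positivity
  have h1 : 1 - 1 / (p : ℝ) ≠ 0 := by
    rw [one_sub_div hp0]
    exact div_ne_zero (by linarith) hp0
  have h2 : 1 + 1 / (p : ℝ) ≠ 0 := by positivity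
  have hfac : 1 - 1 / (p : ℝ) ^ 2 = (1 - 1 / (p : ℝ)) * (1 + 1 / (p : ℝ)) := by
    field_simp
    ring
  rw [hfac]
  rcases hp.eq_two_or_odd with rfl | hodd
  · have e1 : modFourChar 2 = 0 := by decide
    have e2 : ZMod.χ₈ 2 = 0 := by decide
    have e3 : ZMod.χ₈' 2 = 0 := by decide
    norm_num [e1, e2, e3]
  have hne : p ≠ 2 := by omega
  have hcases : p % 8 = 1 ∨ p % 8 = 3 ∨ p % 8 = 5 ∨ p % 8 = 7 := by omega
  rcases hcases with h | h | h | h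
  · have e1 : modFourChar 1 = 1 := by decide
    have e2 : ZMod.χ₈ 1 = 1 := by decide
    have e3 : ZMod.χ₈' 1 = 1 := by decide
    simp only [h, hne, Nat.cast_one, e1, e2, e3, Int.cast_one, if_true, if_false]
    generalize 1 / (p : ℝ) = u at *
    field_simp
  · have e1 : modFourChar 3 = -1 := by decide
    have e2 : ZMod.χ₈ 3 = -1 := by decide
    have e3 : ZMod.χ₈' 3 = 1 := by decide
    norm_num only [h, hne, e1, e2, e3, neg_div, sub_neg_eq_add, if_false]
    generalize 1 / (p : ℝ) = u at *
    field_simp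
  · have e1 : modFourChar 5 = 1 := by decide
    have e2 : ZMod.χ₈ 5 = -1 := by decide
    have e3 : ZMod.χ₈' 5 = -1 := by decide
    norm_num only [h, hne, e1, e2, e3, neg_div, sub_neg_eq_add, if_false]
    generalize 1 / (p : ℝ) = u at *
    field_simp
  · have e1 : modFourChar 7 = -1 := by decide
    have e2 : ZMod.χ₈ 7 = 1 := by decide
    have e3 : ZMod.χ₈' 7 = -1 := by decide
    norm_num only [h, hne, e1, e2, e3, neg_div, sub_neg_eq_add, if_false]
    generalize 1 / (p : ℝ) = u at *
    field_simp

lemma prod_one_sub_inv_pow_four_eq {N : ℕ} (hN : 2 ≤ N) :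
    (∏ p ∈ (N + 1).primesBelow with p % 8 = 1, (1 - 1 / (p : ℝ))) ^ 4 =
      (∏ p ∈ (N + 1).primesBelow, (1 - 1 / (p : ℝ))) *
        (∏ p ∈ (N + 1).primesBelow, (1 - charWeight modFourChar p / p)) *
        (∏ p ∈ (N + 1).primesBelow, (1 - charWeight ZMod.χ₈ p / p)) *
        (∏ p ∈ (N + 1).primesBelow, (1 - charWeight ZMod.χ₈' p / p)) *
        (∏ p ∈ (N + 1).primesBelow, (1 - 1 / (p : ℝ) ^ 2)⁻¹) ^ 2 *
        (∏ p ∈ (N + 1).primesBelow with p % 8 = 1, (1 - 1 / (p : ℝ) ^ 2)) ^ 2 * (9 / 8) := by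
  have h2 : ∏ p ∈ (N + 1).primesBelow, (if p = 2 then (9 / 8 : ℝ) else 1) = 9 / 8 := by
    rw [prod_ite_eq', if_pos (Nat.mem_primesBelow.mpr ⟨by omega, Nat.prime_two⟩)]
  rw [← h2, prod_filter, prod_filter]
  simp only [← prod_pow, ← prod_mul_distrib]
  exact prod_congr rfl fun p hp => one_sub_inv_pow_four_eq (Nat.prime_of_mem_primesBelow hp)

lemma tendsto_log_mul_prod_pow_four_nat :
    Tendsto (fun N : ℕ => Real.log N *
        (∏ p ∈ (N + 1).primesBelow with p % 8 = 1, (1 - 1 / (p : ℝ))) ^ 4)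
      atTop (𝓝 (Real.pi ^ 2 * Real.exp (-Real.eulerMascheroniConstant) /
          Real.log (3 + 2 * √2) *
        (∏' p : {p : ℕ // p.Prime ∧ p % 8 = 1}, (1 - 1 / ((p : ℕ) : ℝ) ^ 2)) ^ 2)) := by
  have h := (((((tendsto_log_mul_prod_one_sub_inv_prime.mul tendsto_prod_modFourChar).mul
    tendsto_prod_χ₈).mul tendsto_prod_χ₈').mul (tendsto_prod_inv_one_sub_inv_sq.pow 2)).mul
    (tendsto_prod_primesBelow_filter_one_sub_inv_sq.pow 2)).mul_const (9 / 8 : ℝ)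
  have hs : √2 ^ 2 = 2 := Real.sq_sqrt (by norm_num)
  have hlog : Real.log (3 + 2 * √2) ≠ 0 :=
    (Real.log_pos (by linarith [Real.sqrt_nonneg 2])).ne'
  refine (h.congr' ?_).trans_eq ?_
  · filter_upwards [eventually_ge_atTop 2] with N hN
    rw [prod_one_sub_inv_pow_four_eq hN]
    ring
  · congr 1
    field_simp
    rw [hs]
    ring

lemma tendsto_log_sub_log_floor :
    Tendsto (fun x : ℝ => Real.log x - Real.log ⌊x⌋₊) atTop (𝓝 0) := by
  have h := ((tendsto_nat_floor_div_atTop (R := ℝ)).log one_ne_zero).neg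
  rw [Real.log_one, neg_zero] at h
  refine h.congr' ?_
  filter_upwards [eventually_ge_atTop 1] with x hx
  have hfloor : 0 < ⌊x⌋₊ := Nat.floor_pos.mpr hx
  rw [Real.log_div (by positivity) (by positivity), neg_sub]

/-- **Grosswald's formula for `C(8,1)`:**
`log x · (∏_{p ≤ x, p ≡ 1 (8)} (1 - 1/p))⁴
  → (π² e^{-γ} / log(3 + 2√2)) (∏_{p ≡ 1 (8)} (1 - 1/p²))²`,
the product over all primes `p ≡ 1 (mod 8)` being absolutely convergent. -/
theorem grosswald_C81 :
    Multipliable (fun p : {p : ℕ // p.Prime ∧ p % 8 = 1} =>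
      1 - 1 / ((p : ℕ) : ℝ) ^ 2) ∧
    Tendsto (fun x : ℝ => Real.log x *
        (∏ p ∈ (Nat.floor x + 1).primesBelow.filter (fun p => p % 8 = 1),
          (1 - 1 / (p : ℝ))) ^ 4)
      atTop (𝓝 (Real.pi ^ 2 * Real.exp (-Real.eulerMascheroniConstant) /
          Real.log (3 + 2 * Real.sqrt 2) *
        (∏' p : {p : ℕ // p.Prime ∧ p % 8 = 1}, (1 - 1 / ((p : ℕ) : ℝ) ^ 2)) ^ 2)) := by
  refine ⟨multipliable_one_sub_inv_sq {p | p.Prime ∧ p % 8 = 1}, ?_⟩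
  have hmain := tendsto_log_mul_prod_pow_four_nat.comp (tendsto_nat_floor_atTop (α := ℝ))
  have herr : Tendsto (fun x : ℝ => (Real.log x - Real.log ⌊x⌋₊) *
      (∏ p ∈ (⌊x⌋₊ + 1).primesBelow with p % 8 = 1, (1 - 1 / (p : ℝ))) ^ 4) atTop (𝓝 0) := by
    refine tendsto_log_sub_log_floor.zero_mul_isBoundedUnder_le
      (isBoundedUnder_of ⟨1, fun x => ?_⟩)
    have hmem (p : ℕ) (hp : p ∈ {p ∈ (⌊x⌋₊ + 1).primesBelow | p % 8 = 1}) :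
        0 ≤ 1 - 1 / (p : ℝ) ∧ 1 - 1 / (p : ℝ) ≤ 1 := by
      have h1 : (1 : ℝ) ≤ p := by
        exact_mod_cast (Nat.prime_of_mem_primesBelow (mem_filter.mp hp).1).one_le
      exact ⟨sub_nonneg.mpr ((div_le_one (by positivity)).mpr h1),
        sub_le_self _ (by positivity)⟩
    have h0 := prod_nonneg fun p hp => (hmem p hp).1
    simp only [Function.comp_apply, Real.norm_eq_abs]
    rw [abs_of_nonneg (pow_nonneg h0 4)]
    exact pow_le_one₀ h0 (prod_le_one (fun p hp => (hmem p hp).1) fun p hp => (hmem p hp).2)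
  have h := hmain.add herr
  rw [add_zero] at h
  refine h.congr fun x => ?_
  simp only [Function.comp_apply]
  ring
end

section
/- As x → ∞, (log x) · ( ∏_{p ≤ x, p ≡ 1 (mod 24)} (1 − 1/p) )⁸ tends to ( 2π⁴ · e^{−γ} / ( 9 · log(2 + √3) · log(1 + √2) · log(5 + 2√6) ) ) · ( ∏_{p ≡ 1 (mod 24)} (1 − 1/p²) )⁴, where the product over all primes p ≡ 1 (mod 24) is absolutely convergent. Equivalently, Williams's formula C(24,1)⁸ = 2π⁴ e^{−γ} / (9 log(2+√3) log(1+√2) log(5+2√6)) · ∏_{p ≡ 1 (mod 24)} (1 − 1/p²)⁴ holds. -/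
open Filter Topology Finset

/-- The sum `∑ aᵢ f(e^{-δ uᵢ})`: the weights `a` at the points `u`, tested against `f` after the
substitution `y = e^{-δ u}`. -/
noncomputable def laplaceSum {ι : Type*} (a u : ι → ℝ) (f : ℝ → ℝ) (δ : ℝ) : ℝ :=
  ∑' i, a i * f (Real.exp (-δ * u i))

section Karamata

variable {ι κ : Type*} {a u : ι → ℝ} {b v : κ → ℝ}

lemma exp_neg_mul_mem_Icc {δ x : ℝ} (hδ : 0 < δ) (hx : 0 ≤ x) :
    Real.exp (-δ * x) ∈ Set.Icc (0 : ℝ) 1 :=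
  ⟨(Real.exp_pos _).le, Real.exp_le_one_iff.2 (by nlinarith)⟩

lemma summable_laplace_of_abs_le (ha : ∀ i, 0 ≤ a i) (hu : ∀ i, 0 ≤ u i)
    (hs : ∀ δ > 0, Summable fun i => a i * Real.exp (-δ * u i)) {f : ℝ → ℝ} {K : ℝ}
    (hf : ∀ y ∈ Set.Icc (0 : ℝ) 1, |f y| ≤ K * y) {δ : ℝ} (hδ : 0 < δ) :
    Summable fun i => a i * f (Real.exp (-δ * u i)) := by
  refine Summable.of_norm_bounded ((hs δ hδ).mul_left K) fun i => ?_
  rw [Real.norm_eq_abs, abs_mul, abs_of_nonneg (ha i)]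
  calc a i * |f (Real.exp (-δ * u i))| ≤ a i * (K * Real.exp (-δ * u i)) :=
        mul_le_mul_of_nonneg_left (hf _ (exp_neg_mul_mem_Icc hδ (hu i))) (ha i)
    _ = K * (a i * Real.exp (-δ * u i)) := by ring

lemma exists_abs_mul_eval_le (P : Polynomial ℝ) :
    ∃ K, ∀ y ∈ Set.Icc (0 : ℝ) 1, |y * P.eval y| ≤ K * y := by
  obtain ⟨K, hK⟩ := isCompact_Icc.exists_bound_of_continuousOn (s := Set.Icc (0 : ℝ) 1)
    (f := fun y => P.eval y) P.continuous.continuousOn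
  refine ⟨K, fun y hy => ?_⟩
  rw [abs_mul, abs_of_nonneg hy.1, mul_comm]
  exact mul_le_mul_of_nonneg_right (hK y hy) hy.1

lemma summable_laplace_polynomial (ha : ∀ i, 0 ≤ a i) (hu : ∀ i, 0 ≤ u i)
    (hs : ∀ δ > 0, Summable fun i => a i * Real.exp (-δ * u i)) (P : Polynomial ℝ)
    {δ : ℝ} (hδ : 0 < δ) :
    Summable fun i => a i * (Real.exp (-δ * u i) * P.eval (Real.exp (-δ * u i))) := by
  obtain ⟨K, hK⟩ := exists_abs_mul_eval_le P
  exact summable_laplace_of_abs_le ha hu hs (f := fun y => y * P.eval y) hK hδ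

lemma laplaceSum_add {f g : ℝ → ℝ} {δ : ℝ}
    (hf : Summable fun i => a i * f (Real.exp (-δ * u i)))
    (hg : Summable fun i => a i * g (Real.exp (-δ * u i))) :
    laplaceSum a u (fun y => f y + g y) δ = laplaceSum a u f δ + laplaceSum a u g δ := by
  simp only [laplaceSum, mul_add]
  exact hf.tsum_add hg

lemma laplaceSum_monomial (n : ℕ) (c δ : ℝ) :
    laplaceSum a u (fun y => y * (Polynomial.monomial n c).eval y) δ =
      c * laplaceSum a u (fun y => y) (((n : ℝ) + 1) * δ) := by
  simp only [laplaceSum, ← tsum_mul_left]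
  refine tsum_congr fun i => ?_
  have : Real.exp (-(((n : ℝ) + 1) * δ) * u i) = Real.exp (-δ * u i) ^ (n + 1) := by
    rw [← Real.exp_nat_mul]; push_cast; ring_nf
  rw [this, Polynomial.eval_monomial]
  ring

/-- Asymptotics of a difference of Laplace sums passes to polynomials vanishing at `0`. -/
lemma tendsto_laplaceSum_polynomial_sub (ha : ∀ i, 0 ≤ a i) (hu : ∀ i, 0 ≤ u i)
    (hs : ∀ δ > 0, Summable fun i => a i * Real.exp (-δ * u i))
    (hb : ∀ i, 0 ≤ b i) (hv : ∀ i, 0 ≤ v i)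
    (ht : ∀ δ > 0, Summable fun i => b i * Real.exp (-δ * v i)) {C : ℝ}
    (hC : Tendsto (fun δ => laplaceSum a u (fun y => y) δ - laplaceSum b v (fun y => y) δ)
      (𝓝[>] 0) (𝓝 C)) (P : Polynomial ℝ) :
    Tendsto (fun δ => laplaceSum a u (fun y => y * P.eval y) δ -
      laplaceSum b v (fun y => y * P.eval y) δ) (𝓝[>] 0) (𝓝 (C * P.eval 1)) := by
  induction P using Polynomial.induction_on' with
  | add P Q hP hQ =>
    have h := hP.add hQ
    rw [← mul_add, ← Polynomial.eval_add] at h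
    refine h.congr' ?_
    filter_upwards [self_mem_nhdsWithin] with δ hδ
    simp only [Polynomial.eval_add, mul_add]
    rw [laplaceSum_add (f := fun y => y * P.eval y) (g := fun y => y * Q.eval y)
        (summable_laplace_polynomial ha hu hs P hδ) (summable_laplace_polynomial ha hu hs Q hδ),
      laplaceSum_add (f := fun y => y * P.eval y) (g := fun y => y * Q.eval y)
        (summable_laplace_polynomial hb hv ht P hδ) (summable_laplace_polynomial hb hv ht Q hδ)]
    ring
  | monomial n c =>
    have hn : (0 : ℝ) < (n : ℝ) + 1 := by positivity
    have hscale : Tendsto (fun δ : ℝ => ((n : ℝ) + 1) * δ) (𝓝[>] 0) (𝓝[>] 0) := by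
      refine tendsto_nhdsWithin_iff.2 ⟨?_, ?_⟩
      · have : Tendsto (fun δ : ℝ => ((n : ℝ) + 1) * δ) (𝓝 0) (𝓝 (((n : ℝ) + 1) * 0)) :=
          (continuous_const.mul continuous_id).tendsto 0
        rw [mul_zero] at this
        exact this.mono_left nhdsWithin_le_nhds
      · filter_upwards [self_mem_nhdsWithin] with δ hδ
        exact mul_pos hn hδ
    have h := (hC.comp hscale).const_mul c
    simp only [laplaceSum_monomial]
    rw [Polynomial.eval_monomial, one_pow, mul_one]
    rw [mul_comm C c]
    refine h.congr fun δ => ?_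
    simp [mul_sub]

/-- Riemann sums of a polynomial along the geometric partition `e^{-δ n}` of `[0, 1]`. -/
lemma tendsto_geometric_riemann_sum (P : Polynomial ℝ) :
    (∀ δ > 0, Summable fun n : ℕ =>
      δ * (Real.exp (-δ * n) * P.eval (Real.exp (-δ * n)))) ∧
    Tendsto (fun δ : ℝ => ∑' n : ℕ, δ * (Real.exp (-δ * n) * P.eval (Real.exp (-δ * n))))
      (𝓝[>] 0) (𝓝 (∫ y in (0 : ℝ)..1, P.eval y)) := by
  induction P using Polynomial.induction_on' with
  | add P Q hP hQ =>
    simp only [Polynomial.eval_add, mul_add]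
    refine ⟨fun δ hδ => (hP.1 δ hδ).add (hQ.1 δ hδ), ?_⟩
    rw [intervalIntegral.integral_add (P.continuous.intervalIntegrable _ _)
      (Q.continuous.intervalIntegrable _ _)]
    refine (hP.2.add hQ.2).congr' ?_
    filter_upwards [self_mem_nhdsWithin] with δ hδ
    rw [(hP.1 δ hδ).tsum_add (hQ.1 δ hδ)]
  | monomial k c =>
    have hk : (0 : ℝ) < (k : ℝ) + 1 := by positivity
    have hterm : ∀ δ : ℝ, ∀ n : ℕ,
        δ * (Real.exp (-δ * n) * (Polynomial.monomial k c).eval (Real.exp (-δ * n))) =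
          (δ * c) * Real.exp (-(((k : ℝ) + 1) * δ)) ^ n := by
      intro δ n
      have : Real.exp (-(((k : ℝ) + 1) * δ)) ^ n = Real.exp (-δ * n) ^ (k + 1) := by
        rw [← Real.exp_nat_mul, ← Real.exp_nat_mul]; push_cast; ring_nf
      rw [this, Polynomial.eval_monomial]
      ring
    have hsum : ∀ δ : ℝ, 0 < δ → HasSum
        (fun n : ℕ => (δ * c) * Real.exp (-(((k : ℝ) + 1) * δ)) ^ n)
        ((δ * c) * (1 - Real.exp (-(((k : ℝ) + 1) * δ)))⁻¹) := fun δ hδ =>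
      (hasSum_geometric_of_lt_one (Real.exp_pos _).le
        (Real.exp_lt_one_iff.2 (by have := mul_pos hk hδ; linarith))).mul_left _
    simp only [hterm]
    simp only [Polynomial.eval_monomial, intervalIntegral.integral_const_mul, integral_pow]
    refine ⟨fun δ hδ => (hsum δ hδ).summable, ?_⟩
    have hder : HasDerivAt (fun δ : ℝ => 1 - Real.exp (-(((k : ℝ) + 1) * δ))) ((k : ℝ) + 1) 0 := by
      have := (((hasDerivAt_id (0 : ℝ)).const_mul ((k : ℝ) + 1)).neg.exp).const_sub 1
      simpa using this
    have hslope := hder.tendsto_slope_zero_right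
    have := (hslope.inv₀ hk.ne').const_mul c
    have hval : c * ((k : ℝ) + 1)⁻¹ = c * ((1 ^ (k + 1) - 0 ^ (k + 1)) / ((k : ℝ) + 1)) := by
      simp
    rw [hval] at this
    refine this.congr' ?_
    filter_upwards [self_mem_nhdsWithin] with δ hδ
    rw [(hsum δ hδ).tsum_eq]
    simp only [zero_add, mul_zero, neg_zero, Real.exp_zero, sub_self, sub_zero, smul_eq_mul,
      mul_inv, inv_inv]
    ring

/-- One-sided polynomial approximation in mean of the indicator of `[e⁻¹, 1]`, by polynomials
taking the same values as the indicator at `0` and `1`. -/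
lemma exists_polynomial_bracket_indicator {ε : ℝ} (hε : 0 < ε) :
    ∃ P Q : Polynomial ℝ, (∀ y ∈ Set.Icc (0 : ℝ) 1,
      y * (1 + (1 - y) * P.eval y) ≤ (if Real.exp (-1) ≤ y then 1 else 0) ∧
      (if Real.exp (-1) ≤ y then 1 else 0) ≤ y * (1 + (1 - y) * Q.eval y) ∧
      P.eval y ≤ Q.eval y) ∧
      ∫ y in (0 : ℝ)..1, (Q - P).eval y ≤ ε := by
  set c := Real.exp (-1) with hc
  have hc0 : 0 < c := Real.exp_pos _
  have hc1 : c < 1 := Real.exp_lt_one_iff.2 (by norm_num)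
  let A : ℝ → ℝ := fun y => -(1 - min y c)⁻¹
  let B : ℝ → ℝ := fun y => (max y c)⁻¹
  have hA : Continuous A := by
    refine (Continuous.inv₀ (by fun_prop) fun y => ?_).neg
    have := min_le_right y c
    linarith [this]
  have hB : Continuous B := by
    refine Continuous.inv₀ (by fun_prop) fun y => ?_
    have := le_max_right y c
    linarith [this]
  set K := c⁻¹ + (1 - c)⁻¹ with hK
  have hK0 : 0 < K := by have := sub_pos.2 hc1; positivity
  have hA0 : ∀ y, A y ≤ 0 := fun y => by
    have := min_le_right y c
    have h1 : 0 < 1 - min y c := by linarith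
    simpa [A] using h1.le
  have hB0 : ∀ y, 0 ≤ B y := fun y => inv_nonneg.2 (hc0.le.trans (le_max_right y c))
  have hBA : ∀ y, B y - A y ≤ K := fun y => by
    have h1 : B y ≤ c⁻¹ := inv_anti₀ hc0 (le_max_right y c)
    have h2 : (1 - min y c)⁻¹ ≤ (1 - c)⁻¹ :=
      inv_anti₀ (sub_pos.2 hc1) (by linarith [min_le_right y c])
    simp only [A, hK]
    linarith
  set η := ε / (8 * K) with hη
  have hη0 : 0 < η := by positivity
  let up : ℝ → ℝ := fun y => max 0 (min 1 ((y - c) / η + 1))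
  let lo : ℝ → ℝ := fun y => max 0 (min 1 ((y - c) / η))
  have hup : Continuous up := by fun_prop
  have hlo : Continuous lo := by fun_prop
  obtain ⟨Q, hQ⟩ := exists_polynomial_near_of_continuousOn 0 1
    (fun y => A y + up y * (B y - A y) + ε / 8) (by fun_prop) (ε / 8) (by positivity)
  obtain ⟨P, hP⟩ := exists_polynomial_near_of_continuousOn 0 1
    (fun y => A y + lo y * (B y - A y) - ε / 8) (by fun_prop) (ε / 8) (by positivity)
  have hup0 : ∀ y, 0 ≤ up y := fun y => le_max_left _ _
  have hlo1 : ∀ y, lo y ≤ 1 := fun y => max_le zero_le_one (min_le_left _ _)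
  have hlo0 : ∀ y, 0 ≤ lo y := fun y => le_max_left _ _
  have hup1 : ∀ y, up y ≤ 1 := fun y => max_le zero_le_one (min_le_left _ _)
  have hloup : ∀ y, lo y ≤ up y := fun y =>
    max_le_max le_rfl (min_le_min le_rfl (by linarith))
  have hupc : ∀ y, c ≤ y → up y = 1 := fun y hy => by
    have : 0 ≤ (y - c) / η := div_nonneg (by linarith) hη0.le
    simp only [up]
    rw [min_eq_left (by linarith), max_eq_right zero_le_one]
  have hloc : ∀ y, y ≤ c → lo y = 0 := fun y hy => by
    have : (y - c) / η ≤ 0 := div_nonpos_of_nonpos_of_nonneg (by linarith) hη0.le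
    simp only [lo]
    rw [min_eq_right (by linarith), max_eq_left this]
  have hlow : ∀ y ∈ Set.Icc (0 : ℝ) 1, P.eval y ≤ A y + lo y * (B y - A y) := fun y hy => by
    have := (abs_lt.1 (hP y hy)).2
    linarith
  have hupp : ∀ y ∈ Set.Icc (0 : ℝ) 1, A y + up y * (B y - A y) ≤ Q.eval y := fun y hy => by
    have := (abs_lt.1 (hQ y hy)).1
    linarith
  refine ⟨P, Q, fun y hy => ?_, ?_⟩
  · have hy0 : 0 ≤ y := hy.1
    have hy1 : 0 ≤ 1 - y := sub_nonneg.2 hy.2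
    have hPQ : P.eval y ≤ Q.eval y := by
      refine (hlow y hy).trans (le_trans ?_ (hupp y hy))
      have := mul_le_mul_of_nonneg_right (hloup y) (sub_nonneg.2 ((hA0 y).trans (hB0 y)))
      linarith
    refine ⟨?_, ?_, hPQ⟩
    · split_ifs with h
      · have h1 : P.eval y ≤ B y := by
          refine (hlow y hy).trans ?_
          nlinarith [hlo1 y, hA0 y, hB0 y]
        have h2 : B y = y⁻¹ := by simp only [B]; rw [max_eq_left h]
        have hypos : 0 < y := hc0.trans_le h
        calc y * (1 + (1 - y) * P.eval y) ≤ y * (1 + (1 - y) * y⁻¹) := by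
              rw [h2] at h1; gcongr
          _ = 1 := by field_simp; ring
      · have h' : y < c := not_le.1 h
        have h1 : P.eval y ≤ -(1 - y)⁻¹ := by
          have := hlow y hy
          rw [hloc y h'.le] at this
          simp only [A, min_eq_left h'.le] at this
          linarith
        have hpos : 0 < 1 - y := by linarith
        calc y * (1 + (1 - y) * P.eval y) ≤ y * (1 + (1 - y) * -(1 - y)⁻¹) := by gcongr
          _ = 0 := by field_simp; ring
    · split_ifs with h
      · have hypos : 0 < y := hc0.trans_le h
        have h1 : y⁻¹ ≤ Q.eval y := by
          have := hupp y hy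
          rw [hupc y h] at this
          simp only [B, max_eq_left h] at this
          linarith
        calc (1 : ℝ) = y * (1 + (1 - y) * y⁻¹) := by field_simp; ring
          _ ≤ y * (1 + (1 - y) * Q.eval y) := by gcongr
      · have h' : y < c := not_le.1 h
        have h1 : -(1 - y)⁻¹ ≤ Q.eval y := by
          refine le_trans ?_ (hupp y hy)
          have h2 := mul_nonneg (hup0 y) (sub_nonneg.2 ((hA0 y).trans (hB0 y)))
          have h3 : A y = -(1 - y)⁻¹ := by simp only [A, min_eq_left h'.le]
          linarith
        have hpos : 0 < 1 - y := by linarith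
        calc (0 : ℝ) = y * (1 + (1 - y) * -(1 - y)⁻¹) := by field_simp; ring
          _ ≤ y * (1 + (1 - y) * Q.eval y) := by gcongr
  · have hbound : ∀ y ∈ Set.Icc (0 : ℝ) 1, (Q - P).eval y ≤
        ε / 2 + Set.indicator (Set.Icc (c - η) (c + η)) (fun _ => K) y := fun y hy => by
      have h1 := (abs_lt.1 (hQ y hy)).2
      have h2 := (abs_lt.1 (hP y hy)).1
      have h3 : (up y - lo y) * (B y - A y) ≤
          Set.indicator (Set.Icc (c - η) (c + η)) (fun _ => K) y := by
        by_cases hm : y ∈ Set.Icc (c - η) (c + η)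
        · rw [Set.indicator_of_mem hm]
          nlinarith [hBA y, hup1 y, hlo0 y, hA0 y, hB0 y, hloup y]
        · rw [Set.indicator_of_notMem hm]
          have : up y = lo y := by
            rcases lt_or_ge y (c - η) with h | h
            · have h4 : (y - c) / η + 1 ≤ 0 := by
                rw [div_add_one hη0.ne']
                exact div_nonpos_of_nonpos_of_nonneg (by linarith) hη0.le
              simp only [up, lo]
              rw [min_eq_right (by linarith), max_eq_left h4, min_eq_right (by linarith),
                max_eq_left (by linarith)]
            · have h5 : c + η < y := not_le.1 fun h' => hm ⟨h, h'⟩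
              have h4 : 1 ≤ (y - c) / η := (one_le_div hη0).2 (by linarith)
              rw [hupc y (by linarith)]
              simp only [lo]
              rw [min_eq_left h4, max_eq_right zero_le_one]
          rw [this, sub_self, zero_mul]
      rw [Polynomial.eval_sub]
      linarith
    have hind : MeasureTheory.IntegrableOn
        (Set.indicator (Set.Icc (c - η) (c + η)) (fun _ : ℝ => K)) Set.univ := by
      rw [MeasureTheory.integrableOn_univ, MeasureTheory.integrable_indicator_iff measurableSet_Icc]
      exact MeasureTheory.integrableOn_const (by simp)
    have hind' := hind.mono_set (Set.subset_univ (Set.Ioc (0 : ℝ) 1))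
    have hii : IntervalIntegrable
        (Set.indicator (Set.Icc (c - η) (c + η)) (fun _ : ℝ => K)) MeasureTheory.volume 0 1 :=
      (intervalIntegrable_iff_integrableOn_Ioc_of_le zero_le_one).2 hind'
    have hcalc : ∫ y in (0 : ℝ)..1, Set.indicator (Set.Icc (c - η) (c + η)) (fun _ : ℝ => K) y ≤
        K * (2 * η) := by
      rw [intervalIntegral.integral_of_le zero_le_one]
      calc _ ≤ ∫ y, Set.indicator (Set.Icc (c - η) (c + η)) (fun _ : ℝ => K) y :=
            MeasureTheory.setIntegral_le_integral (MeasureTheory.integrableOn_univ.1 hind)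
              (.of_forall fun y => Set.indicator_nonneg (fun _ _ => hK0.le) y)
        _ = K * (2 * η) := by
            rw [MeasureTheory.integral_indicator measurableSet_Icc,
              MeasureTheory.setIntegral_const, MeasureTheory.measureReal_def, Real.volume_Icc,
              ENNReal.toReal_ofReal (by linarith), smul_eq_mul]
            ring
    calc ∫ y in (0 : ℝ)..1, (Q - P).eval y
        ≤ ∫ y in (0 : ℝ)..1, (ε / 2 +
            Set.indicator (Set.Icc (c - η) (c + η)) (fun _ : ℝ => K) y) :=
          intervalIntegral.integral_mono_on zero_le_one
            ((Q - P).continuous.intervalIntegrable _ _)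
            (intervalIntegrable_const.add hii) hbound
      _ ≤ ε := by
          rw [intervalIntegral.integral_add intervalIntegrable_const hii,
            intervalIntegral.integral_const]
          have : K * (2 * η) = ε / 4 := by rw [hη]; field_simp; norm_num
          rw [this] at hcalc
          simp only [sub_zero, one_smul]
          linarith

/-- Karamata's method, relative to the weights `1 / n` at the points `n`. -/
lemma tendsto_laplaceSum_indicator_sub (ha : ∀ i, 0 ≤ a i) (hu : ∀ i, 0 ≤ u i)
    (hs : ∀ δ > 0, Summable fun i => a i * Real.exp (-δ * u i))
    (ht : ∀ δ > 0, Summable fun n : ℕ => (n : ℝ)⁻¹ * Real.exp (-δ * n)) {C : ℝ}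
    (hC : Tendsto (fun δ => laplaceSum a u (fun y => y) δ -
      laplaceSum (fun n : ℕ => (n : ℝ)⁻¹) (fun n => (n : ℝ)) (fun y => y) δ) (𝓝[>] 0) (𝓝 C)) :
    Tendsto (fun δ => laplaceSum a u (fun y => if Real.exp (-1) ≤ y then 1 else 0) δ -
      laplaceSum (fun n : ℕ => (n : ℝ)⁻¹) (fun n => (n : ℝ))
        (fun y => if Real.exp (-1) ≤ y then 1 else 0) δ) (𝓝[>] 0) (𝓝 C) := by
  have hb : ∀ n : ℕ, 0 ≤ (n : ℝ)⁻¹ := fun n => by positivity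
  have hv : ∀ n : ℕ, (0 : ℝ) ≤ n := fun n => Nat.cast_nonneg n
  rw [Metric.tendsto_nhds]
  intro ε hε
  obtain ⟨P, Q, hPQ, hint⟩ := exists_polynomial_bracket_indicator (ε := ε / 3) (by positivity)
  have hlow := tendsto_laplaceSum_polynomial_sub ha hu hs hb hv ht hC (1 + (1 - Polynomial.X) * P)
  have hupp := tendsto_laplaceSum_polynomial_sub ha hu hs hb hv ht hC (1 + (1 - Polynomial.X) * Q)
  obtain ⟨hRs, hR⟩ := tendsto_geometric_riemann_sum (Q - P)
  simp only [Polynomial.eval_add, Polynomial.eval_one, Polynomial.eval_mul, Polynomial.eval_sub,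
    Polynomial.eval_X, sub_self, zero_mul, add_zero, mul_one] at hlow hupp
  filter_upwards [self_mem_nhdsWithin,
    Metric.tendsto_nhds.1 hlow (ε / 3) (by positivity),
    Metric.tendsto_nhds.1 hupp (ε / 3) (by positivity),
    hR.eventually_lt_const (show _ < 2 * ε / 3 by linarith)] with δ hδ h1 h2 h3
  have hδ : 0 < δ := hδ
  rw [Real.dist_eq, abs_lt] at h1 h2 ⊢
  have hg : ∀ y ∈ Set.Icc (0 : ℝ) 1,
      |(if Real.exp (-1) ≤ y then (1 : ℝ) else 0)| ≤ (Real.exp (-1))⁻¹ * y := fun y hy => by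
    split_ifs with h
    · rw [abs_one, inv_mul_eq_div, one_le_div (Real.exp_pos _)]
      exact h
    · rw [abs_zero]
      exact mul_nonneg (by positivity) hy.1
  have hsP := summable_laplace_polynomial ha hu hs (1 + (1 - Polynomial.X) * P) hδ
  have hsQ := summable_laplace_polynomial ha hu hs (1 + (1 - Polynomial.X) * Q) hδ
  have htP := summable_laplace_polynomial hb hv ht (1 + (1 - Polynomial.X) * P) hδ
  have htQ := summable_laplace_polynomial hb hv ht (1 + (1 - Polynomial.X) * Q) hδ
  simp only [Polynomial.eval_add, Polynomial.eval_one, Polynomial.eval_mul, Polynomial.eval_sub,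
    Polynomial.eval_X] at hsP hsQ htP htQ
  have hsg := summable_laplace_of_abs_le ha hu hs hg hδ
  have htg := summable_laplace_of_abs_le hb hv ht hg hδ
  have haP := hsP.tsum_le_tsum (fun i => mul_le_mul_of_nonneg_left
    (hPQ _ (exp_neg_mul_mem_Icc hδ (hu i))).1 (ha i)) hsg
  have haQ := hsg.tsum_le_tsum (fun i => mul_le_mul_of_nonneg_left
    (hPQ _ (exp_neg_mul_mem_Icc hδ (hu i))).2.1 (ha i)) hsQ
  have hbP := htP.tsum_le_tsum (fun i => mul_le_mul_of_nonneg_left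
    (hPQ _ (exp_neg_mul_mem_Icc hδ (hv i))).1 (hb i)) htg
  have hbQ := htg.tsum_le_tsum (fun i => mul_le_mul_of_nonneg_left
    (hPQ _ (exp_neg_mul_mem_Icc hδ (hv i))).2.1 (hb i)) htQ
  have hgap := (htQ.sub htP).tsum_le_tsum (fun n => ?_) (hRs δ hδ)
  · rw [htQ.tsum_sub htP] at hgap
    simp only [laplaceSum] at h1 h2 ⊢
    constructor <;> linarith
  · have hy := exp_neg_mul_mem_Icc hδ (hv n)
    set y := Real.exp (-δ * n) with hy_def
    have hweight : (n : ℝ)⁻¹ * (1 - y) ≤ δ := by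
      rcases Nat.eq_zero_or_pos n with rfl | hn
      · simpa using hδ.le
      · have hn' : (0 : ℝ) < n := Nat.cast_pos.2 hn
        rw [inv_mul_le_iff₀ hn']
        have := Real.add_one_le_exp (-δ * n)
        linarith
    have hnonneg : 0 ≤ y * (Q - P).eval y := by
      rw [Polynomial.eval_sub]
      exact mul_nonneg hy.1 (sub_nonneg.2 (hPQ y hy).2.2)
    have := mul_le_mul_of_nonneg_right hweight hnonneg
    rw [Polynomial.eval_sub] at this ⊢
    linarith

lemma hasSum_inv_mul_exp_neg {δ : ℝ} (hδ : 0 < δ) :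
    HasSum (fun n : ℕ => (n : ℝ)⁻¹ * Real.exp (-δ * n)) (-Real.log (1 - Real.exp (-δ))) := by
  have h := Real.hasSum_pow_div_log_of_abs_lt_one (x := Real.exp (-δ))
    (by rw [abs_of_pos (Real.exp_pos _)]; exact Real.exp_lt_one_iff.2 (by linarith))
  rw [← hasSum_nat_add_iff' 1]
  simp only [Finset.sum_range_one, Nat.cast_zero, inv_zero, zero_mul, sub_zero]
  refine h.congr_fun fun n => ?_
  rw [← Real.exp_nat_mul]
  push_cast
  ring_nf

lemma tendsto_log_one_sub_exp_neg_sub_log :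
    Tendsto (fun δ : ℝ => Real.log (1 - Real.exp (-δ)) - Real.log δ) (𝓝[>] 0) (𝓝 0) := by
  have hder : HasDerivAt (fun δ : ℝ => 1 - Real.exp (-δ)) 1 0 := by
    simpa using ((hasDerivAt_id (0 : ℝ)).neg.exp).const_sub 1
  have h := (Real.continuousAt_log one_ne_zero).tendsto.comp hder.tendsto_slope_zero_right
  rw [Real.log_one] at h
  refine h.congr' ?_
  filter_upwards [self_mem_nhdsWithin] with δ hδ
  have hδ : 0 < δ := hδ
  have : 0 < 1 - Real.exp (-δ) := sub_pos.2 (Real.exp_lt_one_iff.2 (by linarith))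
  simp only [Function.comp, zero_add, neg_zero, Real.exp_zero, sub_self, sub_zero, smul_eq_mul]
  rw [Real.log_mul (inv_ne_zero hδ.ne') this.ne', Real.log_inv]
  ring

lemma tendsto_tsum_inv_sub_log :
    Tendsto (fun U : ℝ => (∑' n : ℕ, if (n : ℝ) ≤ U then (n : ℝ)⁻¹ else 0) - Real.log U) atTop
      (𝓝 Real.eulerMascheroniConstant) := by
  have h1 := Real.tendsto_harmonic_sub_log.comp (tendsto_nat_floor_atTop (α := ℝ))
  have h2 : Tendsto (fun U : ℝ => Real.log ((⌊U⌋₊ : ℝ) / U)) atTop (𝓝 0) := by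
    have := (Real.continuousAt_log one_ne_zero).tendsto.comp
      (tendsto_nat_floor_div_atTop (R := ℝ))
    rwa [Real.log_one] at this
  have h := h1.add h2
  rw [add_zero] at h
  refine h.congr' ?_
  filter_upwards [eventually_ge_atTop 1] with U hU
  have hfl : (0 : ℝ) < ⌊U⌋₊ := Nat.cast_pos.2 (Nat.floor_pos.2 hU)
  have hsum : (∑' n : ℕ, if (n : ℝ) ≤ U then (n : ℝ)⁻¹ else 0) = (harmonic ⌊U⌋₊ : ℝ) := by
    rw [tsum_eq_sum (s := Finset.range (⌊U⌋₊ + 1))]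
    · rw [Finset.sum_range_succ']
      simp only [Nat.cast_zero, inv_zero, ite_self, add_zero, harmonic]
      push_cast
      refine Finset.sum_congr rfl fun n hn => ?_
      have : ((n + 1 : ℕ) : ℝ) ≤ U := (Nat.le_floor_iff (by linarith)).1 (Finset.mem_range.1 hn)
      rw [if_pos (by exact_mod_cast this)]
    · intro n hn
      refine if_neg fun h => hn (Finset.mem_range.2 (Nat.lt_succ_of_le (Nat.le_floor h)))
  rw [hsum, Real.log_div hfl.ne' (by linarith)]
  simp only [Function.comp]
  ring

/-- **Karamata's Tauberian theorem**, logarithmic form: if nonnegative weights `aᵢ` at points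
`uᵢ ≥ 0` satisfy `∑ aᵢ e^{-δ uᵢ} = log (1/δ) + C + o(1)` as `δ → 0⁺`, then
`∑_{uᵢ ≤ U} aᵢ = log U + C + γ + o(1)` as `U → ∞`. -/
theorem tendsto_tsum_sub_log_of_laplace (ha : ∀ i, 0 ≤ a i) (hu : ∀ i, 0 ≤ u i)
    (hs : ∀ δ > 0, Summable fun i => a i * Real.exp (-δ * u i)) {C : ℝ}
    (hC : Tendsto (fun δ => (∑' i, a i * Real.exp (-δ * u i)) + Real.log δ) (𝓝[>] 0) (𝓝 C)) :
    Tendsto (fun U : ℝ => (∑' i, if u i ≤ U then a i else 0) - Real.log U) atTop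
      (𝓝 (C + Real.eulerMascheroniConstant)) := by
  have ht : ∀ δ > 0, Summable fun n : ℕ => (n : ℝ)⁻¹ * Real.exp (-δ * n) :=
    fun δ hδ => (hasSum_inv_mul_exp_neg hδ).summable
  have hdiff : Tendsto (fun δ => laplaceSum a u (fun y => y) δ -
      laplaceSum (fun n : ℕ => (n : ℝ)⁻¹) (fun n => (n : ℝ)) (fun y => y) δ) (𝓝[>] 0) (𝓝 C) := by
    have := hC.add tendsto_log_one_sub_exp_neg_sub_log
    rw [add_zero] at this
    refine this.congr' ?_
    filter_upwards [self_mem_nhdsWithin] with δ hδ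
    simp only [laplaceSum]
    rw [(hasSum_inv_mul_exp_neg hδ).tsum_eq]
    ring
  have h := (tendsto_laplaceSum_indicator_sub ha hu hs ht hdiff).comp
    (tendsto_inv_atTop_nhdsGT_zero (𝕜 := ℝ))
  refine (h.add tendsto_tsum_inv_sub_log).congr' ?_
  filter_upwards [eventually_gt_atTop 0] with U hU
  have hiff : ∀ w : ℝ, Real.exp (-1) ≤ Real.exp (-U⁻¹ * w) ↔ w ≤ U := fun w => by
    rw [Real.exp_le_exp, neg_mul, neg_le_neg_iff, inv_mul_le_iff₀ hU, mul_one]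
  simp only [Function.comp, laplaceSum, hiff, mul_ite, mul_one, mul_zero]
  ring

end Karamata

/-- If `∑ χ(n) yⁿ = y G'(y)` on `(0, 1)` with `G` continuously differentiable up to the endpoints,
then `L(1, χ) = G(1) - G(0)`. -/
theorem DirichletCharacter.LFunction_one_eq_sub {N : ℕ} [NeZero N] [Nontrivial (ZMod N)]
    {χ : DirichletCharacter ℂ N} (hχ : χ ≠ 1) {G r : ℝ → ℝ}
    (hG : ∀ y ∈ Set.Icc (0 : ℝ) 1, HasDerivAt G (r y) y) (hr : ContinuousOn r (Set.Icc 0 1))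
    (hsum : ∀ y ∈ Set.Ioo (0 : ℝ) 1,
      HasSum (fun n : ℕ => χ n * (y : ℂ) ^ n) ((y * r y : ℝ) : ℂ)) :
    χ.LFunction 1 = ((G 1 - G 0 : ℝ) : ℂ) := by
  let f : ℝ → ℝ := fun t => Real.exp (-t) * r (Real.exp (-t))
  have hmem : ∀ t ∈ Set.Ici (0 : ℝ), Real.exp (-t) ∈ Set.Icc (0 : ℝ) 1 := fun t ht =>
    ⟨(Real.exp_pos _).le, Real.exp_le_one_iff.2 (neg_nonpos.2 ht)⟩
  have hfc : ContinuousOn f (Set.Ici 0) :=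
    (Real.continuous_exp.comp continuous_neg).continuousOn.mul
      (hr.comp (Real.continuous_exp.comp continuous_neg).continuousOn hmem)
  obtain ⟨K, hK⟩ := isCompact_Icc.exists_bound_of_continuousOn hr
  have hbound : ∀ t ∈ Set.Ici (0 : ℝ), ‖(f t : ℂ)‖ ≤ K * ‖Real.exp (-1 * t)‖ := fun t ht => by
    rw [Complex.norm_real, norm_mul, mul_comm, neg_one_mul]
    exact mul_le_mul_of_nonneg_right (hK _ (hmem t ht)) (norm_nonneg _)
  have hFc : ContinuousOn (fun t => (f t : ℂ)) (Set.Ici 0) :=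
    Complex.continuous_ofReal.comp_continuousOn hfc
  have hloc : MeasureTheory.LocallyIntegrableOn (fun t => (f t : ℂ)) (Set.Ioi 0) :=
    (hFc.mono Set.Ioi_subset_Ici_self).locallyIntegrableOn measurableSet_Ioi
  have htop : (fun t => (f t : ℂ)) =O[atTop] fun t => Real.exp (-1 * t) :=
    Asymptotics.IsBigO.of_bound K <| by
      filter_upwards [eventually_ge_atTop 0] with t ht using hbound t ht
  have hbot : (fun t => (f t : ℂ)) =O[𝓝[>] 0] fun t : ℝ => t ^ (-(0 : ℝ)) := by
    refine Asymptotics.IsBigO.of_bound (|K|) ?_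
    filter_upwards [self_mem_nhdsWithin] with t ht
    have ht : 0 < t := ht
    refine (hbound t ht.le).trans ?_
    rw [neg_zero, Real.rpow_zero, norm_one, Real.norm_eq_abs, abs_of_pos (Real.exp_pos _)]
    have h1 : Real.exp (-1 * t) ≤ 1 := Real.exp_le_one_iff.2 (by linarith)
    nlinarith [le_abs_self K, abs_nonneg K, Real.exp_pos (-1 * t)]
  have hdiff : DifferentiableAt ℂ (mellin fun t => (f t : ℂ)) 1 :=
    mellin_differentiableAt_of_isBigO_rpow_exp one_pos hloc htop hbot (by simp)
  have hconv : MellinConvergent (fun t => (f t : ℂ)) 1 :=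
    mellinConvergent_of_isBigO_rpow_exp one_pos hloc htop hbot (by simp)
  have hint : MeasureTheory.IntegrableOn (fun t => (f t : ℂ)) (Set.Ioi 0) := by
    simpa [MellinConvergent] using hconv
  have hL : ∀ s : ℝ, 1 < s →
      Complex.Gamma s * χ.LFunction s = mellin (fun t => (f t : ℂ)) s := fun s hs => by
    have hs' : 1 < (s : ℂ).re := by simpa using hs
    have h := hasSum_mellin (a := fun n : ℕ => χ n) (p := fun n => (n : ℝ))
      (F := fun t => (f t : ℂ)) (s := (s : ℂ)) (fun n => ?_) (by linarith) (fun t ht => ?_) ?_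
    · rw [DirichletCharacter.LFunction_eq_LSeries χ hs', LSeries, ← tsum_mul_left, ← h.tsum_eq]
      refine tsum_congr fun n => ?_
      rcases eq_or_ne n 0 with rfl | hn
      · simp [MulChar.map_zero]
      · rw [LSeries.term_of_ne_zero hn]
        push_cast
        ring
    · rcases Nat.eq_zero_or_pos n with rfl | hn
      · left; simp [MulChar.map_zero]
      · right; exact_mod_cast hn
    · have ht : 0 < t := ht
      refine (hsum (Real.exp (-t)) ⟨Real.exp_pos _, Real.exp_lt_one_iff.2 (by linarith)⟩).congr_fun
        fun n => ?_
      rw [← Complex.ofReal_pow, ← Real.exp_nat_mul]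
      ring_nf
    · refine Summable.of_nonneg_of_le (fun n => by positivity) (fun n => ?_)
        (Real.summable_one_div_nat_rpow.2 hs')
      exact div_le_div_of_nonneg_right (χ.norm_le_one _) (by positivity)
  have hcast : Tendsto (fun s : ℝ => (s : ℂ)) (𝓝[>] 1) (𝓝 1) := by
    have := Complex.continuous_ofReal.tendsto (1 : ℝ)
    rw [Complex.ofReal_one] at this
    exact this.mono_left nhdsWithin_le_nhds
  have hlim1 : Tendsto (fun s : ℝ => Complex.Gamma s * χ.LFunction s) (𝓝[>] 1)
      (𝓝 (Complex.Gamma 1 * χ.LFunction 1)) := by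
    refine Tendsto.mul ?_ ?_
    · exact (Complex.differentiableAt_Gamma 1 fun m h => by
        have := congrArg Complex.re h
        simp at this
        linarith [Nat.cast_nonneg (α := ℝ) m]).continuousAt.tendsto.comp hcast
    · exact (DirichletCharacter.differentiable_LFunction hχ 1).continuousAt.tendsto.comp hcast
  have hlim2 := hdiff.continuousAt.tendsto.comp hcast
  have heq := tendsto_nhds_unique (hlim1.congr' <| by
    filter_upwards [self_mem_nhdsWithin] with s hs using hL s hs) hlim2
  rw [Complex.Gamma_one, one_mul] at heq
  rw [heq, mellin]
  simp only [sub_self, Complex.cpow_zero, one_smul]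
  rw [integral_complex_ofReal]
  congr 1
  have hint' : MeasureTheory.IntegrableOn f (Set.Ioi 0) := by
    have := hint.re
    simpa [MeasureTheory.IntegrableOn] using this
  have hderiv : ∀ t ∈ Set.Ici (0 : ℝ), HasDerivAt (fun t => -G (Real.exp (-t))) (f t) t :=
    fun t ht => by
      have h1 : HasDerivAt (fun t : ℝ => Real.exp (-t)) (-Real.exp (-t)) t := by
        simpa using (hasDerivAt_id t).neg.exp
      have h2 := ((hG _ (hmem t ht)).comp t h1).neg
      refine h2.congr_deriv ?_
      simp only [f]
      ring
  have htend : Tendsto (fun t : ℝ => -G (Real.exp (-t))) atTop (𝓝 (-G 0)) :=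
    ((hG 0 ⟨le_rfl, zero_le_one⟩).continuousAt.tendsto.comp
      (Real.tendsto_exp_neg_atTop_nhds_zero)).neg
  rw [MeasureTheory.integral_Ioi_of_hasDerivAt_of_tendsto' hderiv hint' htend]
  simp
  ring

section Characters

/-- The integer-valued character modulo `24` with a given table of values. The units modulo `24`
are the solutions of `a² = 1`. -/
def charOfTable (f : Fin 24 → ℤ) (h1 : f 1 = 1) (hmul : ∀ a b, f (a * b) = f a * f b)
    (h0 : ∀ a, a * a = 1 ∨ f a = 0) : MulChar (ZMod 24) ℤ where
  toFun := f
  map_one' := h1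
  map_mul' := hmul
  map_nonunit' a ha := (h0 a).resolve_left fun h => ha (IsUnit.of_mul_eq_one a h)

/-- The character `n ↦ (-4 / n)` modulo `24`. -/
def chiNegFour : MulChar (ZMod 24) ℤ :=
  charOfTable ![0, 1, 0, 0, 0, 1, 0, -1, 0, 0, 0, -1, 0, 1, 0, 0, 0, 1, 0, -1, 0, 0, 0, -1]
    rfl (by decide +kernel) (by decide +kernel)

/-- The character `n ↦ (8 / n)` modulo `24`. -/
def chiEight : MulChar (ZMod 24) ℤ :=
  charOfTable ![0, 1, 0, 0, 0, -1, 0, 1, 0, 0, 0, -1, 0, -1, 0, 0, 0, 1, 0, -1, 0, 0, 0, 1]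
    rfl (by decide +kernel) (by decide +kernel)

/-- The character `n ↦ (-3 / n)` modulo `24`. -/
def chiNegThree : MulChar (ZMod 24) ℤ :=
  charOfTable ![0, 1, 0, 0, 0, -1, 0, 1, 0, 0, 0, -1, 0, 1, 0, 0, 0, -1, 0, 1, 0, 0, 0, -1]
    rfl (by decide +kernel) (by decide +kernel)

lemma chi_values (a : ZMod 24) :
    (a = 1 ∧ chiNegFour a = 1 ∧ chiEight a = 1 ∧ chiNegThree a = 1) ∨
    (a ≠ 1 ∧ a * a = 1 ∧ (chiNegFour a = 1 ∨ chiNegFour a = -1) ∧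
      (chiEight a = 1 ∨ chiEight a = -1) ∧ (chiNegThree a = 1 ∨ chiNegThree a = -1) ∧
      ¬(chiNegFour a = 1 ∧ chiEight a = 1 ∧ chiNegThree a = 1)) ∨
    (a ≠ 1 ∧ (∀ b, a * b ≠ 1) ∧ chiNegFour a = 0 ∧ chiEight a = 0 ∧ chiNegThree a = 0) := by
  revert a
  decide +kernel

/-- The complex Dirichlet character attached to an integer-valued one. -/
noncomputable abbrev toDirichlet (ψ : MulChar (ZMod 24) ℤ) : DirichletCharacter ℂ 24 :=
  ψ.ringHomComp (Int.castRingHom ℂ)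

lemma toDirichlet_ne_one {ψ : MulChar (ZMod 24) ℤ} {a : ZMod 24} (ha : ψ a = -1) :
    toDirichlet ψ ≠ 1 := by
  intro h
  have h1 : toDirichlet ψ a = -1 := by simp [MulChar.ringHomComp_apply, ha]
  rw [h] at h1
  by_cases hu : IsUnit a
  · rw [MulChar.one_apply hu] at h1
    norm_num at h1
  · rw [MulChar.map_nonunit _ hu] at h1
    norm_num at h1

lemma hasSum_toDirichlet_mul_pow (ψ : MulChar (ZMod 24) ℤ) {y : ℝ} (hy : y ∈ Set.Ioo (0 : ℝ) 1)
    {S : ℝ} (hS : S * (1 - y ^ 24) = ∑ n : Fin 24, (ψ ((n : ℕ) : ZMod 24) : ℝ) * y ^ (n : ℕ)) :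
    HasSum (fun n : ℕ => toDirichlet ψ n * (y : ℂ) ^ n) (S : ℂ) := by
  have hsum : Summable fun n : ℕ => toDirichlet ψ n * (y : ℂ) ^ n := by
    refine Summable.of_norm_bounded (summable_geometric_of_lt_one hy.1.le hy.2) fun n => ?_
    rw [norm_mul, norm_pow, Complex.norm_real, Real.norm_of_nonneg hy.1.le]
    exact mul_le_of_le_one_left (by have := hy.1; positivity)
      (DirichletCharacter.norm_le_one _ _)
  have hshift : ∑' n : ℕ, toDirichlet ψ ((n + 24 : ℕ) : ZMod 24) * (y : ℂ) ^ (n + 24) =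
      (y : ℂ) ^ 24 * ∑' n : ℕ, toDirichlet ψ n * (y : ℂ) ^ n := by
    rw [← tsum_mul_left]
    refine tsum_congr fun n => ?_
    have : ((n + 24 : ℕ) : ZMod 24) = n := by
      rw [Nat.cast_add, ZMod.natCast_self, add_zero]
    rw [this]
    ring
  have h := hsum.sum_add_tsum_nat_add 24
  rw [hshift, Finset.sum_range] at h
  have hfin : ∑ n : Fin 24, toDirichlet ψ ((n : ℕ) : ZMod 24) * (y : ℂ) ^ (n : ℕ) =
      (S : ℂ) * (1 - (y : ℂ) ^ 24) := by
    rw [show (S : ℂ) * (1 - (y : ℂ) ^ 24) = ((S * (1 - y ^ 24) : ℝ) : ℂ) by push_cast; ring, hS]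
    push_cast
    simp [MulChar.ringHomComp_apply]
  rw [hfin] at h
  have hne : (1 - (y : ℂ) ^ 24) ≠ 0 := by
    rw [show (1 - (y : ℂ) ^ 24) = ((1 - y ^ 24 : ℝ) : ℂ) by push_cast; ring]
    exact Complex.ofReal_ne_zero.2 (sub_pos.2 (pow_lt_one₀ hy.1.le hy.2 (by norm_num))).ne'
  have hval : ∑' n : ℕ, toDirichlet ψ n * (y : ℂ) ^ n = S := by
    apply mul_right_cancel₀ hne
    linear_combination -h
  rw [← hval]
  exact hsum.hasSum

lemma LFunction_one_of_hasDerivAt {ψ : MulChar (ZMod 24) ℤ} (hψ : ∃ a, ψ a = -1) {G r : ℝ → ℝ}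
    (hG : ∀ y ∈ Set.Icc (0 : ℝ) 1, HasDerivAt G (r y) y) (hr : ContinuousOn r (Set.Icc 0 1))
    (hS : ∀ y ∈ Set.Ioo (0 : ℝ) 1, y * r y * (1 - y ^ 24) =
      ∑ n : Fin 24, (ψ ((n : ℕ) : ZMod 24) : ℝ) * y ^ (n : ℕ)) :
    (toDirichlet ψ).LFunction 1 = ((G 1 - G 0 : ℝ) : ℂ) := by
  obtain ⟨a, ha⟩ := hψ
  have : Nontrivial (ZMod 24) := ⟨0, 1, by decide⟩
  exact DirichletCharacter.LFunction_one_eq_sub (toDirichlet_ne_one ha) hG hr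
    fun y hy => hasSum_toDirichlet_mul_pow ψ hy (hS y hy)

lemma quadratic_pos {a : ℝ} (ha : a ^ 2 < 4) (y : ℝ) : 0 < y ^ 2 + a * y + 1 := by
  nlinarith [sq_nonneg (y + a / 2)]

lemma hasDerivAt_quadratic (a y : ℝ) :
    HasDerivAt (fun y : ℝ => y ^ 2 + a * y + 1) (2 * y + a) y := by
  refine ((((hasDerivAt_id y).pow 2).add ((hasDerivAt_id y).const_mul a)).add_const 1).congr_deriv
    ?_
  simp

/-- An antiderivative of `2a(1 - y²) / (y⁴ + (2 - a²)y² + 1)`. -/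
noncomputable def logPrimitive (a y : ℝ) : ℝ :=
  Real.log (y ^ 2 + a * y + 1) - Real.log (y ^ 2 + -a * y + 1)

lemma hasDerivAt_logPrimitive {a : ℝ} (ha : a ^ 2 < 4) (y : ℝ) :
    HasDerivAt (logPrimitive a) (2 * a * (1 - y ^ 2) / (y ^ 4 + (2 - a ^ 2) * y ^ 2 + 1)) y := by
  have h1 := quadratic_pos ha y
  have h2 := quadratic_pos (a := -a) (by simpa using ha) y
  have h := ((hasDerivAt_quadratic a y).log h1.ne').sub ((hasDerivAt_quadratic (-a) y).log h2.ne')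
  refine h.congr_deriv ?_
  have h3 : y ^ 4 + (2 - a ^ 2) * y ^ 2 + 1 = (y ^ 2 + a * y + 1) * (y ^ 2 + -a * y + 1) := by ring
  rw [h3, div_sub_div _ _ h1.ne' h2.ne']
  congr 1
  ring

@[simp]
lemma logPrimitive_zero (a : ℝ) : logPrimitive a 0 = 0 := by simp [logPrimitive]

lemma logPrimitive_one {a : ℝ} (ha : a ^ 2 < 4) :
    logPrimitive a 1 = Real.log ((2 + a) / (2 - a)) := by
  have h1 := quadratic_pos ha 1
  have h2 := quadratic_pos (a := -a) (by simpa using ha) 1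
  rw [Real.log_div (by linarith) (by linarith), logPrimitive]
  ring_nf

/-- An antiderivative of `b(1 + y²) / (y⁴ + (2 - a²)y² + 1)` when `a² + b² = 4`. -/
noncomputable def arctanPrimitive (a b y : ℝ) : ℝ :=
  Real.arctan ((2 * y + a) / b) + Real.arctan ((2 * y - a) / b)

lemma hasDerivAt_arctan_affine {a b : ℝ} (hb : b ≠ 0) (hab : a ^ 2 + b ^ 2 = 4) (y : ℝ) :
    HasDerivAt (fun y : ℝ => Real.arctan ((2 * y + a) / b)) (b / (2 * (y ^ 2 + a * y + 1))) y := by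
  have ha : a ^ 2 < 4 := by have := sq_pos_of_ne_zero hb; linarith
  have h1 := quadratic_pos ha y
  have h := ((((hasDerivAt_id y).const_mul 2).add_const a).div_const b).arctan
  refine h.congr_deriv ?_
  simp only [id, mul_one]
  have h2 : 1 + ((2 * y + a) / b) ^ 2 = 4 * (y ^ 2 + a * y + 1) / b ^ 2 := by
    field_simp
    linear_combination hab
  rw [h2]
  field_simp
  norm_num

lemma hasDerivAt_arctanPrimitive {a b : ℝ} (hb : b ≠ 0) (hab : a ^ 2 + b ^ 2 = 4) (y : ℝ) :
    HasDerivAt (arctanPrimitive a b)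
      (b * (1 + y ^ 2) / (y ^ 4 + (2 - a ^ 2) * y ^ 2 + 1)) y := by
  have ha : a ^ 2 < 4 := by have := sq_pos_of_ne_zero hb; linarith
  have h1 := quadratic_pos ha y
  have h2 := quadratic_pos (a := -a) (by simpa using ha) y
  have h := (hasDerivAt_arctan_affine hb hab y).add
    (hasDerivAt_arctan_affine (a := -a) hb (by linarith [neg_sq a]) y)
  refine h.congr_deriv ?_
  have h3 : y ^ 4 + (2 - a ^ 2) * y ^ 2 + 1 = (y ^ 2 + a * y + 1) * (y ^ 2 + -a * y + 1) := by ring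
  rw [h3, div_add_div _ _ (by positivity) (by positivity), div_eq_div_iff (by positivity)
    (by positivity)]
  ring

@[simp]
lemma arctanPrimitive_zero (a b : ℝ) : arctanPrimitive a b 0 = 0 := by
  simp [arctanPrimitive, neg_div, Real.arctan_neg]

lemma arctanPrimitive_one {a b : ℝ} (ha : 0 < a) (hb : 0 < b) (hab : a ^ 2 + b ^ 2 = 4) :
    arctanPrimitive a b 1 = Real.pi / 2 := by
  have h1 : (2 * 1 - a) / b = ((2 * 1 + a) / b)⁻¹ := by
    rw [inv_div, div_eq_div_iff hb.ne' (by positivity)]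
    linear_combination -hab
  rw [arctanPrimitive, h1, Real.arctan_inv_of_pos (by positivity)]
  ring

end Characters

section SpecialValues

lemma LFunction_chiNegFour_one :
    (toDirichlet chiNegFour).LFunction 1 = ((Real.pi / 3 : ℝ) : ℂ) := by
  have h := LFunction_one_of_hasDerivAt (ψ := chiNegFour) (by decide +kernel)
    (G := fun y => Real.arctan y + Real.arctan (y ^ 3) / 3)
    (r := fun y => 1 / (1 + y ^ 2) + y ^ 2 / (1 + y ^ 6)) ?_ ?_ ?_
  · rw [h]
    congr 1
    simp only [one_pow, Real.arctan_one, Real.arctan_zero, ne_eq, OfNat.ofNat_ne_zero,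
      not_false_eq_true, zero_pow]
    ring
  · intro y _
    refine ((Real.hasDerivAt_arctan y).add
      ((hasDerivAt_pow 3 y).arctan.div_const 3)).congr_deriv ?_
    simp only [Nat.cast_ofNat, Nat.add_one_sub_one]
    field_simp
  · refine Continuous.continuousOn ?_
    exact (continuous_const.div (by fun_prop) fun y => by positivity).add
      (Continuous.div (by fun_prop) (by fun_prop) fun y => by positivity)
  · intro y _
    have ht : ∀ n : Fin 24, chiNegFour ((n : ℕ) : ZMod 24) =
      ![0, 1, 0, 0, 0, 1, 0, -1, 0, 0, 0, -1, 0, 1, 0, 0, 0, 1, 0, -1, 0, 0, 0, -1] n := by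
      decide +kernel
    simp only [ht]
    simp [Fin.sum_univ_succ]
    field_simp
    ring

lemma LFunction_chiNegThree_one :
    (toDirichlet chiNegThree).LFunction 1 = ((Real.pi / (2 * √3) : ℝ) : ℂ) := by
  have h3 : (√3 : ℝ) ^ 2 = 3 := Real.sq_sqrt (by norm_num)
  have h3' : (0 : ℝ) < √3 := by positivity
  have hq (y : ℝ) : 0 < y ^ 2 + 1 * y + 1 := quadratic_pos (by norm_num) y
  have hF (y : ℝ) := hasDerivAt_arctan_affine (a := 1) h3'.ne' (by rw [h3]; norm_num) y
  have h := LFunction_one_of_hasDerivAt (ψ := chiNegThree) (by decide +kernel)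
    (G := fun y => 2 / √3 * (Real.arctan ((2 * y + 1) / √3) +
      Real.arctan ((2 * y ^ 2 + 1) / √3) / 2))
    (r := fun y => 1 / (y ^ 2 + 1 * y + 1) + y / ((y ^ 2) ^ 2 + 1 * y ^ 2 + 1)) ?_ ?_ ?_
  · rw [h]
    congr 1
    have e1 : ((2 : ℝ) * 1 + 1) / √3 = √3 := by
      rw [div_eq_iff h3'.ne', ← pow_two, h3]; norm_num
    have e2 : ((2 : ℝ) * 0 + 1) / √3 = (√3)⁻¹ := by simp
    simp only [one_pow, e1, ne_eq, OfNat.ofNat_ne_zero,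
      not_false_eq_true, zero_pow, e2, Real.arctan_sqrt_three, Real.arctan_inv_sqrt_three]
    field_simp
    norm_num
  · intro y _
    have hc := (hF (y ^ 2)).comp y (hasDerivAt_pow 2 y)
    refine (((hF y).add (hc.div_const 2)).const_mul (2 / √3)).congr_deriv ?_
    have := hq y
    have := hq (y ^ 2)
    simp only [Nat.cast_ofNat, Nat.add_one_sub_one, pow_one]
    field_simp
  · refine Continuous.continuousOn ?_
    exact (continuous_const.div (by fun_prop) fun y => (hq y).ne').add
      (Continuous.div (by fun_prop) (by fun_prop) fun y => (hq (y ^ 2)).ne')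
  · intro y _
    have ht : ∀ n : Fin 24, chiNegThree ((n : ℕ) : ZMod 24) =
      ![0, 1, 0, 0, 0, -1, 0, 1, 0, 0, 0, -1, 0, 1, 0, 0, 0, -1, 0, 1, 0, 0, 0, -1] n := by
      decide +kernel
    simp only [ht]
    have h1 := (hq y).ne'
    have h2 := (hq (y ^ 2)).ne'
    rw [mul_assoc, div_add_div _ _ h1 h2, div_mul_eq_mul_div, mul_div_assoc',
      div_eq_iff (mul_ne_zero h1 h2)]
    simp [Fin.sum_univ_succ]
    ring

lemma LFunction_chiEight_one :
    (toDirichlet chiEight).LFunction 1 = ((4 / 3 * (Real.log (1 + √2) / √2) : ℝ) : ℂ) := by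
  have h2 : (√2 : ℝ) ^ 2 = 2 := Real.sq_sqrt (by norm_num)
  have h2' : (0 : ℝ) < √2 := by positivity
  have hF (y : ℝ) := hasDerivAt_logPrimitive (a := √2) (by rw [h2]; norm_num) y
  simp only [h2, sub_self, zero_mul, add_zero] at hF
  have h := LFunction_one_of_hasDerivAt (ψ := chiEight) (by decide +kernel)
    (G := fun y => (logPrimitive √2 y + logPrimitive √2 (y ^ 3) / 3) / (2 * √2))
    (r := fun y => (1 - y ^ 2) / (y ^ 4 + 1) + y ^ 2 * (1 - y ^ 6) / (y ^ 12 + 1)) ?_ ?_ ?_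
  · rw [h]
    congr 1
    have hlt : √2 < 2 := by nlinarith
    have e1 : (2 + √2) / (2 - √2) = (1 + √2) ^ 2 := by
      rw [div_eq_iff (by linarith)]
      nlinarith
    simp only [one_pow, ne_eq, OfNat.ofNat_ne_zero, not_false_eq_true, zero_pow,
      logPrimitive_zero, logPrimitive_one (a := √2) (by rw [h2]; norm_num), e1, Real.log_pow]
    field_simp
    ring
  · intro y _
    have hc := (hF (y ^ 3)).comp y (hasDerivAt_pow 3 y)
    refine (((hF y).add (hc.div_const 3)).div_const (2 * √2)).congr_deriv ?_
    simp only [Nat.cast_ofNat, Nat.add_one_sub_one]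
    field_simp
  · refine Continuous.continuousOn ?_
    exact (Continuous.div (by fun_prop) (by fun_prop) fun y => by positivity).add
      (Continuous.div (by fun_prop) (by fun_prop) fun y => by positivity)
  · intro y _
    have ht : ∀ n : Fin 24, chiEight ((n : ℕ) : ZMod 24) =
      ![0, 1, 0, 0, 0, -1, 0, 1, 0, 0, 0, -1, 0, -1, 0, 0, 0, 1, 0, -1, 0, 0, 0, 1] n := by
      decide +kernel
    simp only [ht]
    simp [Fin.sum_univ_succ]
    field_simp
    ring

lemma LFunction_chiNegFour_mul_chiEight_one :
    (toDirichlet (chiNegFour * chiEight)).LFunction 1 = ((Real.pi / (3 * √2) : ℝ) : ℂ) := by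
  have h2 : (√2 : ℝ) ^ 2 = 2 := Real.sq_sqrt (by norm_num)
  have h2' : (0 : ℝ) < √2 := by positivity
  have hF (y : ℝ) := hasDerivAt_arctanPrimitive (a := √2) h2'.ne' (by rw [h2]; norm_num) y
  simp only [h2, sub_self, zero_mul, add_zero] at hF
  have h := LFunction_one_of_hasDerivAt (ψ := chiNegFour * chiEight) (by decide +kernel)
    (G := fun y => (arctanPrimitive √2 √2 y - arctanPrimitive √2 √2 (y ^ 3) / 3) / √2)
    (r := fun y => (1 + y ^ 2) / (y ^ 4 + 1) - y ^ 2 * (1 + y ^ 6) / (y ^ 12 + 1)) ?_ ?_ ?_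
  · rw [h]
    congr 1
    simp only [one_pow, ne_eq, OfNat.ofNat_ne_zero, not_false_eq_true, zero_pow,
      arctanPrimitive_zero, arctanPrimitive_one h2' h2' (by rw [h2]; norm_num)]
    field_simp
    ring
  · intro y _
    have hc := (hF (y ^ 3)).comp y (hasDerivAt_pow 3 y)
    refine (((hF y).sub (hc.div_const 3)).div_const √2).congr_deriv ?_
    simp only [Nat.cast_ofNat, Nat.add_one_sub_one]
    field_simp
  · refine Continuous.continuousOn ?_
    exact (Continuous.div (by fun_prop) (by fun_prop) fun y => by positivity).sub
      (Continuous.div (by fun_prop) (by fun_prop) fun y => by positivity)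
  · intro y _
    have ht : ∀ n : Fin 24, (chiNegFour * chiEight) ((n : ℕ) : ZMod 24) =
      ![0, 1, 0, 0, 0, -1, 0, -1, 0, 0, 0, 1, 0, -1, 0, 0, 0, 1, 0, 1, 0, 0, 0, -1] n := by
      decide +kernel
    simp only [ht]
    simp [Fin.sum_univ_succ]
    field_simp
    ring

lemma LFunction_chiNegFour_mul_chiNegThree_one :
    (toDirichlet (chiNegFour * chiNegThree)).LFunction 1 =
      ((Real.log (2 + √3) / √3 : ℝ) : ℂ) := by
  have h3 : (√3 : ℝ) ^ 2 = 3 := Real.sq_sqrt (by norm_num)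
  have h3' : (0 : ℝ) < √3 := by positivity
  have hF (y : ℝ) := hasDerivAt_logPrimitive (a := √3) (by rw [h3]; norm_num) y
  have hq (y : ℝ) : 0 < y ^ 4 + (2 - 3) * y ^ 2 + 1 := by
    nlinarith [sq_nonneg (y ^ 2 - 1 / 2)]
  rw [h3] at hF
  have h := LFunction_one_of_hasDerivAt (ψ := chiNegFour * chiNegThree) (by decide +kernel)
    (G := fun y => logPrimitive √3 y / (2 * √3))
    (r := fun y => (1 - y ^ 2) / (y ^ 4 + (2 - 3) * y ^ 2 + 1)) ?_ ?_ ?_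
  · rw [h]
    congr 1
    have hlt : √3 < 2 := by nlinarith
    have e1 : (2 + √3) / (2 - √3) = (2 + √3) ^ 2 := by
      rw [div_eq_iff (by linarith)]
      linear_combination (2 + √3) * h3
    simp only [logPrimitive_zero, logPrimitive_one (a := √3) (by rw [h3]; norm_num), e1,
      Real.log_pow]
    field_simp
    norm_num
  · intro y _
    refine ((hF y).div_const (2 * √3)).congr_deriv ?_
    have := hq y
    field_simp
  · refine Continuous.continuousOn ?_
    exact Continuous.div (by fun_prop) (by fun_prop) fun y => (hq y).ne'
  · intro y _
    have ht : ∀ n : Fin 24, (chiNegFour * chiNegThree) ((n : ℕ) : ZMod 24) =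
      ![0, 1, 0, 0, 0, -1, 0, -1, 0, 0, 0, 1, 0, 1, 0, 0, 0, -1, 0, -1, 0, 0, 0, 1] n := by
      decide +kernel
    simp only [ht]
    rw [mul_assoc, div_mul_eq_mul_div, mul_div_assoc', div_eq_iff (hq y).ne']
    simp [Fin.sum_univ_succ]
    ring

/-- The parameters `α = (√6 + √2) / 2` and `β = (√6 - √2) / 2` with
`y⁸ - y⁴ + 1 = (y⁴ + (2 - α²) y² + 1) (y⁴ + (2 - β²) y² + 1)`. -/
lemma exists_quartic_parameters : ∃ a b : ℝ, 0 < a ∧ 0 < b ∧ a * b = 1 ∧ a ^ 2 + b ^ 2 = 4 ∧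
    a + b = √6 := by
  have h2 : (√2 : ℝ) ^ 2 = 2 := Real.sq_sqrt (by norm_num)
  have h6 : (√6 : ℝ) ^ 2 = 6 := Real.sq_sqrt (by norm_num)
  have hlt : √2 < √6 := Real.sqrt_lt_sqrt (by norm_num) (by norm_num)
  refine ⟨(√6 + √2) / 2, (√6 - √2) / 2, by positivity, by linarith, ?_, ?_, by ring⟩
  · linear_combination (h6 - h2) / 4
  · linear_combination (h6 + h2) / 2

lemma quartic_mul_quartic {a b : ℝ} (hab : a * b = 1) (hab4 : a ^ 2 + b ^ 2 = 4) (y : ℝ) :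
    (y ^ 4 + (2 - a ^ 2) * y ^ 2 + 1) * (y ^ 4 + (2 - b ^ 2) * y ^ 2 + 1) =
      y ^ 8 - y ^ 4 + 1 := by
  linear_combination (-y ^ 6 - 2 * y ^ 4 - y ^ 2) * hab4 + y ^ 4 * (a * b + 1) * hab

lemma quartic_pos {a : ℝ} (ha : a ^ 2 < 4) (y : ℝ) : 0 < y ^ 4 + (2 - a ^ 2) * y ^ 2 + 1 := by
  have h := mul_pos (quadratic_pos ha y) (quadratic_pos (a := -a) (by simpa using ha) y)
  nlinarith

lemma LFunction_chiNegFour_mul_chiEight_mul_chiNegThree_one :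
    (toDirichlet (chiNegFour * chiEight * chiNegThree)).LFunction 1 =
      ((Real.log (5 + 2 * √6) / √6 : ℝ) : ℂ) := by
  obtain ⟨a, b, ha, hb, hab, hab4, hsum⟩ := exists_quartic_parameters
  have h6 : (√6 : ℝ) ^ 2 = 6 := Real.sq_sqrt (by norm_num)
  have h6' : (0 : ℝ) < √6 := by positivity
  have ha4 : a ^ 2 < 4 := by nlinarith
  have hb4 : b ^ 2 < 4 := by nlinarith
  have hq (y : ℝ) : 0 < y ^ 8 - y ^ 4 + 1 := by
    nlinarith [sq_nonneg (y ^ 4 - 1 / 2)]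
  have h := LFunction_one_of_hasDerivAt (ψ := chiNegFour * chiEight * chiNegThree)
    (by decide +kernel)
    (G := fun y => (logPrimitive a y + logPrimitive b y) / (2 * √6))
    (r := fun y => (1 - y ^ 6) / (y ^ 8 - y ^ 4 + 1)) ?_ ?_ ?_
  · rw [h]
    congr 1
    have hla : 0 < 2 - a := by nlinarith
    have hlb : 0 < 2 - b := by nlinarith
    have e1 : (2 + a) / (2 - a) * ((2 + b) / (2 - b)) = (5 + 2 * √6) ^ 2 := by
      rw [div_mul_div_comm, div_eq_iff (by positivity), ← hsum]
      have h62 : (a + b) ^ 2 = 6 := by rw [hsum, h6]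
      linear_combination (1 - (5 + 2 * (a + b)) ^ 2) * hab + (4 * (5 + 2 * (a + b))) * h62

    simp only [logPrimitive_zero, logPrimitive_one ha4, logPrimitive_one hb4]
    rw [← Real.log_mul (by positivity) (by positivity), e1, Real.log_pow]
    field_simp
    norm_num
  · intro y _
    refine (((hasDerivAt_logPrimitive ha4 y).add (hasDerivAt_logPrimitive hb4 y)).div_const
      (2 * √6)).congr_deriv ?_
    have h1 := quartic_pos ha4 y
    have h2 := quartic_pos hb4 y
    rw [div_add_div _ _ h1.ne' h2.ne', quartic_mul_quartic hab hab4, div_div,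
      div_eq_div_iff (by have := hq y; positivity) (hq y).ne', ← hsum]
    linear_combination (-2 * (a + b) * y ^ 2 * (1 - y ^ 2) * (y ^ 8 - y ^ 4 + 1)) * hab
  · refine Continuous.continuousOn ?_
    exact Continuous.div (by fun_prop) (by fun_prop) fun y => (hq y).ne'
  · intro y _
    have ht : ∀ n : Fin 24, (chiNegFour * chiEight * chiNegThree) ((n : ℕ) : ZMod 24) =
      ![0, 1, 0, 0, 0, 1, 0, -1, 0, 0, 0, -1, 0, -1, 0, 0, 0, -1, 0, 1, 0, 0, 0, 1] n := by
      decide +kernel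
    simp only [ht]
    rw [mul_assoc, div_mul_eq_mul_div, mul_div_assoc', div_eq_iff (hq y).ne']
    simp [Fin.sum_univ_succ]
    ring

lemma LFunction_chiEight_mul_chiNegThree_one :
    (toDirichlet (chiEight * chiNegThree)).LFunction 1 =
      ((Real.pi / √6 : ℝ) : ℂ) := by
  obtain ⟨a, b, ha, hb, hab, hab4, hsum⟩ := exists_quartic_parameters
  have h6 : (√6 : ℝ) ^ 2 = 6 := Real.sq_sqrt (by norm_num)
  have h6' : (0 : ℝ) < √6 := by positivity
  have ha4 : a ^ 2 < 4 := by nlinarith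
  have hb4 : b ^ 2 < 4 := by nlinarith
  have hq (y : ℝ) : 0 < y ^ 8 - y ^ 4 + 1 := by
    nlinarith [sq_nonneg (y ^ 4 - 1 / 2)]
  have h := LFunction_one_of_hasDerivAt (ψ := chiEight * chiNegThree)
    (by decide +kernel)
    (G := fun y => (arctanPrimitive a b y + arctanPrimitive b a y) / √6)
    (r := fun y => (1 + y ^ 6) / (y ^ 8 - y ^ 4 + 1)) ?_ ?_ ?_
  · rw [h]
    congr 1
    simp only [arctanPrimitive_zero, arctanPrimitive_one ha hb hab4,
      arctanPrimitive_one hb ha (by linarith)]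
    field_simp
    ring
  · intro y _
    have h1 := hasDerivAt_arctanPrimitive hb.ne' hab4 y
    have h2 := hasDerivAt_arctanPrimitive (a := b) ha.ne' (by linarith) y
    refine ((h1.add h2).div_const √6).congr_deriv ?_
    have h1 := quartic_pos ha4 y
    have h2 := quartic_pos hb4 y
    rw [div_add_div _ _ h1.ne' h2.ne', quartic_mul_quartic hab hab4, div_div,
      div_eq_div_iff (by have := hq y; positivity) (hq y).ne', ← hsum]
    linear_combination (-(a + b) * y ^ 2 * (1 + y ^ 2) * (y ^ 8 - y ^ 4 + 1)) * (hab4 - hab)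
  · refine Continuous.continuousOn ?_
    exact Continuous.div (by fun_prop) (by fun_prop) fun y => (hq y).ne'
  · intro y _
    have ht : ∀ n : Fin 24, (chiEight * chiNegThree) ((n : ℕ) : ZMod 24) =
      ![0, 1, 0, 0, 0, 1, 0, 1, 0, 0, 0, 1, 0, -1, 0, 0, 0, -1, 0, -1, 0, 0, 0, -1] n := by
      decide +kernel
    simp only [ht]
    rw [mul_assoc, div_mul_eq_mul_div, mul_div_assoc', div_eq_iff (hq y).ne']
    simp [Fin.sum_univ_succ]
    ring

end SpecialValues

section EulerProduct

/-- The primes congruent to `1` modulo `24`. -/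
abbrev PrimesOneMod24 : Type := {p : ℕ // p.Prime ∧ p % 24 = 1}

namespace PrimesOneMod24

lemma two_le (p : PrimesOneMod24) : (2 : ℝ) ≤ (p : ℕ) := by exact_mod_cast p.2.1.two_le

lemma summable_rpow {r : ℝ} (hr : r < -1) :
    Summable fun p : PrimesOneMod24 => ((p : ℕ) : ℝ) ^ r :=
  (Nat.Primes.summable_rpow.2 hr).comp_injective
    (i := fun p : PrimesOneMod24 => (⟨p, p.2.1⟩ : Nat.Primes))
    fun _ _ h => Subtype.ext (congrArg (fun q : Nat.Primes => (q : ℕ)) h)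

lemma rpow_neg_le_half (p : PrimesOneMod24) {s : ℝ} (hs : 1 ≤ s) :
    ((p : ℕ) : ℝ) ^ (-s) ≤ 1 / 2 := by
  have h2 := p.two_le
  calc ((p : ℕ) : ℝ) ^ (-s) ≤ ((p : ℕ) : ℝ) ^ (-1 : ℝ) :=
        Real.rpow_le_rpow_of_exponent_le (by linarith) (by linarith)
    _ ≤ 1 / 2 := by
        rw [Real.rpow_neg_one, one_div]
        exact inv_anti₀ (by norm_num) h2

end PrimesOneMod24

lemma abs_log_one_sub_le {x : ℝ} (h0 : 0 ≤ x) (h1 : x ≤ 1 / 2) : |Real.log (1 - x)| ≤ 2 * x := by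
  have h := Real.abs_log_sub_add_sum_range_le (x := x) (by rw [abs_of_nonneg h0]; linarith) 0
  rw [abs_of_nonneg h0] at h
  simp only [range_zero, sum_empty, zero_add, pow_one] at h
  refine h.trans ?_
  rw [div_le_iff₀ (by linarith)]
  nlinarith

lemma abs_add_log_one_sub_le {x : ℝ} (h0 : 0 ≤ x) (h1 : x ≤ 1 / 2) :
    |x + Real.log (1 - x)| ≤ 2 * x ^ 2 := by
  have h := Real.abs_log_sub_add_sum_range_le (x := x) (by rw [abs_of_nonneg h0]; linarith) 1
  rw [abs_of_nonneg h0] at h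
  simp only [range_one, sum_singleton, zero_add, pow_one, Nat.cast_zero, div_one] at h
  refine h.trans ?_
  rw [div_le_iff₀ (by linarith)]
  norm_num
  nlinarith [sq_nonneg x]

lemma summable_log_one_sub {s : ℝ} (hs : 1 < s) :
    Summable fun p : PrimesOneMod24 => Real.log (1 - ((p : ℕ) : ℝ) ^ (-s)) :=
  Summable.of_norm_bounded ((PrimesOneMod24.summable_rpow (by linarith : -s < -1)).mul_left 2)
    fun p => abs_log_one_sub_le (by positivity) (p.rpow_neg_le_half hs.le)

lemma hasProd_one_sub_rpow {s : ℝ} (hs : 1 < s) :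
    HasProd (fun p : PrimesOneMod24 => 1 - ((p : ℕ) : ℝ) ^ (-s))
      (Real.exp (∑' p : PrimesOneMod24, Real.log (1 - ((p : ℕ) : ℝ) ^ (-s)))) := by
  refine (summable_log_one_sub hs).hasSum.rexp.congr_fun fun p => ?_
  exact (Real.exp_log (by linarith [p.rpow_neg_le_half hs.le])).symm

/-- The product of the `L`-functions of the seven nontrivial characters modulo `24`. -/
noncomputable def nontrivialLProduct (s : ℂ) : ℂ :=
  (toDirichlet chiNegFour).LFunction s * (toDirichlet chiEight).LFunction s *
  (toDirichlet chiNegThree).LFunction s * (toDirichlet (chiNegFour * chiEight)).LFunction s *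
  (toDirichlet (chiNegFour * chiNegThree)).LFunction s *
  (toDirichlet (chiEight * chiNegThree)).LFunction s *
  (toDirichlet (chiNegFour * chiEight * chiNegThree)).LFunction s

lemma hasProd_extend {f : ℕ → ℝ} {a : ℝ} (hf : HasProd (fun p : PrimesOneMod24 => f p) a) :
    HasProd (fun p : Nat.Primes => if (p : ℕ) % 24 = 1 then (f p : ℂ) else 1) (a : ℂ) := by
  have hinj : Function.Injective fun p : PrimesOneMod24 => (⟨p, p.2.1⟩ : Nat.Primes) :=
    fun _ _ h => Subtype.ext (congrArg (fun q : Nat.Primes => (q : ℕ)) h)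
  refine (hinj.hasProd_iff ?_).1 ?_
  · intro p hp
    exact if_neg fun h => hp ⟨⟨p, p.2, h⟩, rfl⟩
  · refine (hf.map Complex.ofRealHom Complex.continuous_ofReal).congr_fun fun p => ?_
    exact if_pos p.2.2

lemma natCast_eq_one_iff (p : ℕ) : (p : ZMod 24) = 1 ↔ p % 24 = 1 := by
  simpa using ZMod.natCast_eq_natCast_iff' p 1 24

lemma isUnit_natCast_of_prime {p : ℕ} (hp : p.Prime) (h2 : p ≠ 2) (h3 : p ≠ 3) :
    IsUnit (p : ZMod 24) := by
  rw [ZMod.isUnit_iff_coprime, show 24 = 2 ^ 3 * 3 from rfl]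
  exact Nat.Coprime.mul_right (((Nat.coprime_primes hp Nat.prime_two).2 h2).pow_right 3)
    ((Nat.coprime_primes hp Nat.prime_three).2 h3)

lemma local_factor {p : ℕ} (hp : p.Prime) {x : ℂ} (hx : ‖x‖ < 1) :
    (if p % 24 = 1 then (1 - x) else 1) ^ 8 *
      ((1 - (1 : DirichletCharacter ℂ 24) p * x)⁻¹ *
      ((1 - toDirichlet chiNegFour p * x)⁻¹ * (1 - toDirichlet chiEight p * x)⁻¹ *
      (1 - toDirichlet chiNegThree p * x)⁻¹ * (1 - toDirichlet (chiNegFour * chiEight) p * x)⁻¹ *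
      (1 - toDirichlet (chiNegFour * chiNegThree) p * x)⁻¹ *
      (1 - toDirichlet (chiEight * chiNegThree) p * x)⁻¹ *
      (1 - toDirichlet (chiNegFour * chiEight * chiNegThree) p * x)⁻¹)) =
    (if p % 24 = 1 then (1 - x ^ 2) else 1) ^ 4 * (1 - x ^ 2)⁻¹ ^ 4 *
      (if p = 2 ∨ p = 3 then (1 - x ^ 2) else 1) ^ 4 := by
  have h1 : 1 - x ≠ 0 := by
    intro h
    rw [← sub_eq_zero.1 h, norm_one] at hx
    exact lt_irrefl _ hx
  have h2 : 1 + x ≠ 0 := by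
    intro h
    rw [← norm_neg, ← eq_neg_of_add_eq_zero_left h, norm_one] at hx
    exact lt_irrefl _ hx
  have h3 : 1 - x ^ 2 = (1 - x) * (1 + x) := by ring
  simp only [toDirichlet, MulChar.ringHomComp_apply, MulChar.coeToFun_mul, Pi.mul_apply,
    ← natCast_eq_one_iff, h3]
  rcases chi_values p with ⟨ha, e1, e2, e3⟩ | ⟨ha, hu, e1, e2, e3, hne⟩ | ⟨ha, hu, e1, e2, e3⟩
  · have hp23 : ¬(p = 2 ∨ p = 3) := by
      rintro (rfl | rfl) <;> revert ha <;> decide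
    rw [if_pos ha, if_pos ha, if_neg hp23, e1, e2, e3, MulChar.one_apply (ha ▸ isUnit_one)]
    simp only [eq_intCast, Int.cast_one, one_mul, mul_one]
    field_simp
  · have hp23 : ¬(p = 2 ∨ p = 3) := by
      rintro (rfl | rfl) <;> revert hu <;> decide
    rw [if_neg ha, if_neg ha, if_neg hp23, MulChar.one_apply (IsUnit.of_mul_eq_one _ hu)]
    rcases e1 with e1 | e1 <;> rcases e2 with e2 | e2 <;> rcases e3 with e3 | e3 <;>
      first
      | exact (hne ⟨e1, e2, e3⟩).elim
      | rw [e1, e2, e3]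
        simp only [eq_intCast, Int.cast_one, Int.cast_neg, one_mul, mul_one, neg_mul, mul_neg,
          neg_neg, sub_neg_eq_add]
        field_simp
  · have hnu : ¬IsUnit (p : ZMod 24) := fun h => by
      obtain ⟨b, hb⟩ := h.exists_right_inv
      exact hu b hb
    have hp23 : p = 2 ∨ p = 3 := by
      by_contra! h
      exact hnu (isUnit_natCast_of_prime hp h.1 h.2)
    rw [if_neg ha, if_neg ha, if_pos hp23, e1, e2, e3, MulChar.map_nonunit _ hnu]
    simp only [eq_intCast, Int.cast_zero, zero_mul, mul_zero, sub_zero]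
    field_simp

lemma hasProd_primes_two_three (f : ℕ → ℂ) :
    HasProd (fun p : Nat.Primes => if (p : ℕ) = 2 ∨ (p : ℕ) = 3 then f p else 1) (f 2 * f 3) := by
  obtain ⟨a, ha⟩ : ∃ a : Nat.Primes, (a : ℕ) = 2 := ⟨⟨2, Nat.prime_two⟩, rfl⟩
  obtain ⟨b, hb⟩ : ∃ b : Nat.Primes, (b : ℕ) = 3 := ⟨⟨3, Nat.prime_three⟩, rfl⟩
  have hab : a ≠ b := by
    rintro rfl
    omega
  have h : HasProd (fun p : Nat.Primes => if (p : ℕ) = 2 ∨ (p : ℕ) = 3 then f p else 1)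
      (∏ p ∈ {a, b}, if (p : ℕ) = 2 ∨ (p : ℕ) = 3 then f p else 1) := by
    refine hasProd_prod_of_ne_finset_one fun p hp => if_neg ?_
    rw [Finset.mem_insert, Finset.mem_singleton, not_or] at hp
    rintro (h | h)
    · exact hp.1 (Nat.Primes.coe_nat_injective (h.trans ha.symm))
    · exact hp.2 (Nat.Primes.coe_nat_injective (h.trans hb.symm))
  rwa [Finset.prod_pair hab, if_pos (Or.inl ha), if_pos (Or.inr hb), ha, hb] at h

/-- The sum of `log (1 - p^{-s})` over the primes `p ≡ 1 (mod 24)`. -/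
noncomputable def logSum (s : ℝ) : ℝ :=
  ∑' p : PrimesOneMod24, Real.log (1 - ((p : ℕ) : ℝ) ^ (-s))

lemma eulerProduct_identity {s : ℝ} (hs : 1 < s) :
    (Real.exp (logSum s) : ℂ) ^ 8 *
      (DirichletCharacter.LFunctionTrivChar 24 s * nontrivialLProduct s) =
    (Real.exp (logSum (2 * s)) : ℂ) ^ 4 * riemannZeta (2 * s) ^ 4 *
      ((1 - ((2 : ℕ) ^ (-s : ℂ)) ^ 2) * (1 - ((3 : ℕ) ^ (-s : ℂ)) ^ 2)) ^ 4 := by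
  have hre : 1 < (s : ℂ).re := by simpa using hs
  have hre2 : 1 < (2 * s : ℂ).re := by
    have : (2 * s : ℂ).re = 2 * s := by simp
    linarith
  have hG := hasProd_extend (f := fun p => 1 - (p : ℝ) ^ (-s)) (hasProd_one_sub_rpow hs)
  have hP := hasProd_extend (f := fun p => 1 - (p : ℝ) ^ (-(2 * s)))
    (hasProd_one_sub_rpow (s := 2 * s) (by linarith))
  have hZ := riemannZeta_eulerProduct_hasProd hre2
  have hR := hasProd_primes_two_three fun p => 1 - ((p : ℂ) ^ (-s : ℂ)) ^ 2
  have hL (χ : DirichletCharacter ℂ 24) :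
      HasProd (fun p : Nat.Primes => (1 - χ (p : ℕ) * ((p : ℕ) : ℂ) ^ (-s : ℂ))⁻¹)
        (χ.LFunction s) := by
    rw [χ.LFunction_eq_LSeries hre]
    exact χ.LSeries_eulerProduct_hasProd hre
  have hleft := (hG.pow 8).mul ((hL 1).mul (((((((hL (toDirichlet chiNegFour)).mul
    (hL (toDirichlet chiEight))).mul (hL (toDirichlet chiNegThree))).mul
    (hL (toDirichlet (chiNegFour * chiEight)))).mul
    (hL (toDirichlet (chiNegFour * chiNegThree)))).mul
    (hL (toDirichlet (chiEight * chiNegThree)))).mul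
    (hL (toDirichlet (chiNegFour * chiEight * chiNegThree)))))
  refine hleft.unique ((((hP.pow 4).mul (hZ.pow 4)).mul (hR.pow 4)).congr_fun fun p => ?_)
  have hx2 : ((p : ℕ) : ℂ) ^ (-(2 * s) : ℂ) = (((p : ℕ) : ℂ) ^ (-s : ℂ)) ^ 2 := by
    rw [← Complex.cpow_nat_mul]
    push_cast
    ring_nf
  have hxr (t : ℝ) : ((((p : ℕ) : ℝ) ^ t : ℝ) : ℂ) = ((p : ℕ) : ℂ) ^ (t : ℂ) := by
    rw [Complex.ofReal_cpow (by positivity)]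
    simp
  have hnorm : ‖((p : ℕ) : ℂ) ^ (-s : ℂ)‖ < 1 := by
    rw [← Complex.ofReal_neg, ← hxr, Complex.norm_real, Real.norm_of_nonneg (by positivity)]
    exact Real.rpow_lt_one_of_one_lt_of_neg (by exact_mod_cast p.2.one_lt) (by linarith)
  have h := local_factor p.2 hnorm
  simp only [Complex.ofReal_sub, Complex.ofReal_one, hxr, Complex.ofReal_neg, Complex.ofReal_mul,
    Complex.ofReal_ofNat, hx2]
  exact h

end EulerProduct

section LimitAtOne

lemma nontrivialLProduct_one : nontrivialLProduct 1 =
    ((Real.pi ^ 4 * (Real.log (2 + √3) * Real.log (1 + √2) * Real.log (5 + 2 * √6)) / 486 : ℝ) :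
      ℂ) := by
  rw [nontrivialLProduct, LFunction_chiNegFour_one, LFunction_chiEight_one,
    LFunction_chiNegThree_one, LFunction_chiNegFour_mul_chiEight_one,
    LFunction_chiNegFour_mul_chiNegThree_one, LFunction_chiEight_mul_chiNegThree_one,
    LFunction_chiNegFour_mul_chiEight_mul_chiNegThree_one]
  norm_cast
  have h2 : (√2 : ℝ) ^ 2 = 2 := Real.sq_sqrt (by norm_num)
  have h3 : (√3 : ℝ) ^ 2 = 3 := Real.sq_sqrt (by norm_num)
  have h6 : (√6 : ℝ) ^ 2 = 6 := Real.sq_sqrt (by norm_num)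
  field_simp
  rw [h2, h3, h6]
  ring

lemma continuous_nontrivialLProduct : Continuous nontrivialLProduct := by
  have h (ψ : MulChar (ZMod 24) ℤ) (hψ : ∃ a, ψ a = -1) :
      Continuous (toDirichlet ψ).LFunction := by
    obtain ⟨a, ha⟩ := hψ
    exact (DirichletCharacter.differentiable_LFunction (toDirichlet_ne_one ha)).continuous
  unfold nontrivialLProduct
  exact ((((((h _ (by decide +kernel)).mul (h _ (by decide +kernel))).mul
    (h _ (by decide +kernel))).mul (h _ (by decide +kernel))).mul (h _ (by decide +kernel))).mul
    (h _ (by decide +kernel))).mul (h _ (by decide +kernel))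

lemma tendsto_logSum_two_mul :
    Tendsto (fun s : ℝ => logSum (2 * s)) (𝓝[>] 1) (𝓝 (logSum 2)) := by
  refine tendsto_tsum_of_dominated_convergence
    ((PrimesOneMod24.summable_rpow (r := -2) (by norm_num)).mul_left 2) (fun p => ?_) ?_
  · have hp := p.two_le
    have h1 : 1 - ((p : ℕ) : ℝ) ^ (-2 : ℝ) ≠ 0 := by
      linarith [p.rpow_neg_le_half (s := 2) (by norm_num)]
    refine Tendsto.mono_left ?_ nhdsWithin_le_nhds
    have : ContinuousAt (fun s : ℝ => Real.log (1 - ((p : ℕ) : ℝ) ^ (-(2 * s)))) 1 := by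
      refine ContinuousAt.log ?_ (by simpa using h1)
      exact continuousAt_const.sub (ContinuousAt.rpow continuousAt_const (by fun_prop)
        (Or.inl (by linarith)))
    simpa [ContinuousAt] using this
  · filter_upwards [self_mem_nhdsWithin] with s hs p
    have hs : 1 < s := hs
    refine (abs_log_one_sub_le (by positivity) (p.rpow_neg_le_half (by linarith))).trans ?_
    gcongr
    · linarith [p.two_le]
    · linarith

lemma tendsto_LFunctionTrivChar_mul :
    Tendsto (fun s : ℝ => ((s : ℂ) - 1) * DirichletCharacter.LFunctionTrivChar 24 s)
      (𝓝[>] 1) (𝓝 (1 / 3)) := by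
  have h := DirichletCharacter.LFunctionTrivChar_residue_one (N := 24)
  have hpf : (24 : ℕ).primeFactors = {2, 3} := by
    rw [show 24 = 2 ^ 3 * 3 from rfl, Nat.primeFactors_mul (by norm_num) (by norm_num),
      Nat.primeFactors_prime_pow (by norm_num) Nat.prime_two,
      Nat.Prime.primeFactors Nat.prime_three]
    rfl
  have hval : (1 - ((2 : ℕ) : ℂ)⁻¹) * (1 - ((3 : ℕ) : ℂ)⁻¹) = 1 / 3 := by norm_num
  rw [hpf, Finset.prod_pair (by norm_num), hval] at h
  have hlim : Tendsto (fun s : ℝ => (s : ℂ)) (𝓝[>] 1) (𝓝[≠] 1) := by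
    refine tendsto_nhdsWithin_iff.2 ⟨?_, ?_⟩
    · exact (Complex.continuous_ofReal.tendsto' 1 1 (by simp)).mono_left nhdsWithin_le_nhds
    · filter_upwards [self_mem_nhdsWithin] with s hs
      have hs : 1 < s := hs
      rw [Set.mem_compl_singleton_iff]
      exact_mod_cast hs.ne'
  exact h.comp hlim

lemma tendsto_exp_logSum :
    Tendsto (fun s : ℝ => Real.exp (logSum s) ^ 8 / (s - 1)) (𝓝[>] 1)
      (𝓝 (2 * Real.pi ^ 4 / (9 * Real.log (2 + √3) * Real.log (1 + √2) *
        Real.log (5 + 2 * √6)) * Real.exp (logSum 2) ^ 4)) := by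
  have hof : Tendsto (fun s : ℝ => (s : ℂ)) (𝓝[>] 1) (𝓝 1) :=
    (Complex.continuous_ofReal.tendsto' 1 1 (by simp)).mono_left nhdsWithin_le_nhds
  have hl2 : 0 < Real.log (1 + √2) :=
    Real.log_pos (by linarith [Real.sqrt_pos.2 (two_pos (α := ℝ))])
  have hl3 : 0 < Real.log (2 + √3) := Real.log_pos (by linarith [Real.sqrt_nonneg 3])
  have hl6 : 0 < Real.log (5 + 2 * √6) := Real.log_pos (by linarith [Real.sqrt_nonneg 6])
  set P : ℝ := Real.pi ^ 4 *
    (Real.log (2 + √3) * Real.log (1 + √2) * Real.log (5 + 2 * √6)) / 486 with hP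
  have hP0 : 0 < P := by positivity
  have hN : Tendsto (fun s : ℝ => nontrivialLProduct s) (𝓝[>] 1) (𝓝 (P : ℂ)) := by
    rw [hP, ← nontrivialLProduct_one]
    exact (continuous_nontrivialLProduct.tendsto 1).comp hof
  have hD := tendsto_LFunctionTrivChar_mul.mul hN
  have hD0 : (1 / 3 * P : ℂ) ≠ 0 :=
    mul_ne_zero (by norm_num) (Complex.ofReal_ne_zero.2 hP0.ne')
  have hE : Tendsto (fun s : ℝ => (Real.exp (logSum (2 * s)) : ℂ)) (𝓝[>] 1)
      (𝓝 (Real.exp (logSum 2) : ℂ)) :=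
    (Complex.continuous_ofReal.comp Real.continuous_exp).continuousAt.tendsto.comp
      tendsto_logSum_two_mul
  have hZ : Tendsto (fun s : ℝ => riemannZeta (2 * s)) (𝓝[>] 1) (𝓝 (Real.pi ^ 2 / 6 : ℂ)) := by
    rw [← riemannZeta_two]
    refine (differentiableAt_riemannZeta (by norm_num)).continuousAt.tendsto.comp ?_
    simpa using hof.const_mul 2
  have hR (n : ℕ) (hn : n ≠ 0) : Tendsto (fun s : ℝ => 1 - ((n : ℂ) ^ (-s : ℂ)) ^ 2) (𝓝[>] 1)
      (𝓝 (1 - ((n : ℂ)⁻¹) ^ 2)) := by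
    refine tendsto_const_nhds.sub (Tendsto.pow ?_ 2)
    rw [← Complex.cpow_neg_one]
    exact hof.neg.const_cpow (Or.inl (Nat.cast_ne_zero.2 hn))
  have hlim := (((hE.pow 4).mul (hZ.pow 4)).mul
    (((hR 2 (by norm_num)).mul (hR 3 (by norm_num))).pow 4)).div hD hD0
  have hre := (Complex.continuous_re.tendsto _).comp hlim
  convert hre.congr' ?_ using 2
  · have : ((Real.exp (logSum 2) : ℂ) ^ 4 * (Real.pi ^ 2 / 6 : ℂ) ^ 4 *
        ((1 - (((2 : ℕ) : ℂ)⁻¹) ^ 2) * (1 - (((3 : ℕ) : ℂ)⁻¹) ^ 2)) ^ 4) / (1 / 3 * P) =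
        ((Real.exp (logSum 2) ^ 4 * (Real.pi ^ 2 / 6) ^ 4 *
        ((1 - (2⁻¹) ^ 2) * (1 - (3⁻¹) ^ 2)) ^ 4 / (1 / 3 * P) : ℝ) : ℂ) := by
      push_cast
      rfl
    rw [this, Complex.ofReal_re, hP]
    field_simp
    norm_num
  · filter_upwards [self_mem_nhdsWithin, hD.eventually_ne hD0] with s hs hne
    have hs : 1 < s := hs
    have hs0 : (s : ℂ) - 1 ≠ 0 := by
      rw [sub_ne_zero]
      exact_mod_cast hs.ne'
    have : ((Real.exp (logSum s) ^ 8 / (s - 1) : ℝ) : ℂ) =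
        ((Real.exp (logSum (2 * s)) : ℂ) ^ 4 * riemannZeta (2 * s) ^ 4 *
        ((1 - (((2 : ℕ) : ℂ) ^ (-s : ℂ)) ^ 2) * (1 - (((3 : ℕ) : ℂ) ^ (-s : ℂ)) ^ 2)) ^ 4) /
        (((s : ℂ) - 1) * DirichletCharacter.LFunctionTrivChar 24 s * nontrivialLProduct s) := by
      rw [← eulerProduct_identity hs, eq_div_iff hne]
      push_cast
      field_simp
    simp only [Function.comp_apply, Pi.div_apply]
    rw [← this, Complex.ofReal_re]

end LimitAtOne

section Mertens

lemma exp_neg_mul_log {p : ℝ} (hp : 0 < p) (δ : ℝ) : Real.exp (-δ * Real.log p) = p ^ (-δ) := by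
  rw [Real.rpow_def_of_pos hp, mul_comm]

lemma summable_log_mul_exp {δ : ℝ} (hδ : 0 < δ) : Summable fun p : PrimesOneMod24 =>
    -8 * Real.log (1 - 1 / ((p : ℕ) : ℝ)) * Real.exp (-δ * Real.log (p : ℕ)) := by
  refine Summable.of_norm_bounded
    ((PrimesOneMod24.summable_rpow (r := -1 - δ) (by linarith)).mul_left 16) fun p => ?_
  have hp := p.two_le
  have hp0 : (0 : ℝ) < (p : ℕ) := by linarith
  have h1 := abs_log_one_sub_le (x := 1 / ((p : ℕ) : ℝ)) (by positivity)
    (one_div_le_one_div_of_le (by norm_num) hp)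
  rw [exp_neg_mul_log hp0, norm_mul, norm_mul, Real.norm_eq_abs (Real.log _),
    Real.norm_of_nonneg (Real.rpow_nonneg hp0.le _), sub_eq_add_neg (-1) δ, Real.rpow_add hp0,
    Real.rpow_neg_one, ← one_div, ← mul_assoc]
  refine mul_le_mul_of_nonneg_right ?_ (by positivity)
  rw [show ‖(-8 : ℝ)‖ = 8 by norm_num]
  linarith

lemma tendsto_tsum_log_sub :
    Tendsto (fun δ : ℝ => ∑' p : PrimesOneMod24,
      (-8 * Real.log (1 - 1 / ((p : ℕ) : ℝ)) * Real.exp (-δ * Real.log (p : ℕ)) +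
        8 * Real.log (1 - ((p : ℕ) : ℝ) ^ (-(1 + δ))))) (𝓝[>] 0) (𝓝 0) := by
  refine Tendsto.mono_right (tendsto_tsum_of_dominated_convergence
    ((PrimesOneMod24.summable_rpow (r := -2) (by norm_num)).mul_left 32) (fun p => ?_) ?_)
    (congrArg 𝓝 (tsum_zero (β := PrimesOneMod24))).le
  · have hp := p.two_le
    have h1 : 1 - ((p : ℕ) : ℝ) ^ (-(1 + 0) : ℝ) ≠ 0 := by
      exact (sub_pos.2 ((p.rpow_neg_le_half (by norm_num)).trans_lt (by norm_num))).ne'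
    have hc : ContinuousAt (fun δ : ℝ =>
        -8 * Real.log (1 - 1 / ((p : ℕ) : ℝ)) * Real.exp (-δ * Real.log (p : ℕ)) +
        8 * Real.log (1 - ((p : ℕ) : ℝ) ^ (-(1 + δ)))) 0 := by
      refine ContinuousAt.add (by fun_prop) (continuousAt_const.mul (ContinuousAt.log ?_ h1))
      exact continuousAt_const.sub (ContinuousAt.rpow continuousAt_const (by fun_prop)
        (Or.inl (by linarith)))
    refine Tendsto.mono_left ?_ nhdsWithin_le_nhds
    simpa [ContinuousAt, Real.rpow_neg_one] using hc
  · filter_upwards [self_mem_nhdsWithin] with δ hδ p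
    have hδ : 0 < δ := hδ
    have hp := p.two_le
    have hp0 : (0 : ℝ) < (p : ℕ) := by linarith
    have h1 := abs_add_log_one_sub_le (x := 1 / ((p : ℕ) : ℝ)) (by positivity)
      (one_div_le_one_div_of_le (by norm_num) hp)
    have h2 := abs_add_log_one_sub_le (x := ((p : ℕ) : ℝ) ^ (-(1 + δ))) (by positivity)
      (p.rpow_neg_le_half (by linarith))
    have hle : ((p : ℕ) : ℝ) ^ (-δ) ≤ 1 := Real.rpow_le_one_of_one_le_of_nonpos (by linarith)
      (by linarith)
    have hpos : 0 < ((p : ℕ) : ℝ) ^ (-δ) := by positivity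
    have hsq : ((p : ℕ) : ℝ) ^ (-2 : ℝ) = (1 / ((p : ℕ) : ℝ)) ^ 2 := by
      rw [Real.rpow_neg hp0.le, one_div, inv_pow]
      norm_num
    have hx : ((p : ℕ) : ℝ) ^ (-(1 + δ)) = 1 / ((p : ℕ) : ℝ) * ((p : ℕ) : ℝ) ^ (-δ) := by
      rw [neg_add, Real.rpow_add hp0, Real.rpow_neg_one, one_div]
    rw [exp_neg_mul_log hp0, hsq, hx]
    rw [hx] at h2
    set x := 1 / ((p : ℕ) : ℝ)
    set t := ((p : ℕ) : ℝ) ^ (-δ)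
    have ht : (x * t) ^ 2 ≤ x ^ 2 := by
      rw [mul_pow]
      exact mul_le_of_le_one_right (by positivity) (pow_le_one₀ hpos.le hle)
    calc ‖-8 * Real.log (1 - x) * t + 8 * Real.log (1 - x * t)‖
        = |8 * (x * t + Real.log (1 - x * t)) - 8 * (t * (x + Real.log (1 - x)))| := by
          rw [Real.norm_eq_abs]
          congr 1
          ring
      _ ≤ |8 * (x * t + Real.log (1 - x * t))| + |8 * (t * (x + Real.log (1 - x)))| :=
          abs_sub _ _
      _ = 8 * |x * t + Real.log (1 - x * t)| + 8 * (t * |x + Real.log (1 - x)|) := by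
          rw [abs_mul, abs_mul, abs_mul, abs_of_pos hpos, abs_of_pos (by norm_num : (0 : ℝ) < 8)]
      _ ≤ 8 * (2 * x ^ 2) + 8 * (1 * (2 * x ^ 2)) := by
          gcongr
          linarith
      _ = 32 * x ^ 2 := by ring

lemma tendsto_laplace_log {K : ℝ} (hK : 0 < K)
    (h : Tendsto (fun s : ℝ => Real.exp (logSum s) ^ 8 / (s - 1)) (𝓝[>] 1) (𝓝 K)) :
    Tendsto (fun δ : ℝ => (∑' p : PrimesOneMod24,
      -8 * Real.log (1 - 1 / ((p : ℕ) : ℝ)) * Real.exp (-δ * Real.log (p : ℕ))) + Real.log δ)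
      (𝓝[>] 0) (𝓝 (-Real.log K)) := by
  have hshift : Tendsto (fun δ : ℝ => 1 + δ) (𝓝[>] 0) (𝓝[>] 1) := by
    refine tendsto_nhdsWithin_iff.2 ⟨?_, ?_⟩
    · exact ((continuous_const.add continuous_id).tendsto' 0 1 (by simp)).mono_left
        nhdsWithin_le_nhds
    · filter_upwards [self_mem_nhdsWithin] with δ hδ
      have hδ : 0 < δ := hδ
      exact Set.mem_Ioi.2 (by linarith)
  have hlog := (((Real.continuousAt_log hK.ne').tendsto.comp h).comp hshift).neg
  have hsum := tendsto_tsum_log_sub.add hlog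
  rw [zero_add] at hsum
  refine hsum.congr' ?_
  filter_upwards [self_mem_nhdsWithin] with δ hδ
  have hδ : 0 < δ := hδ
  rw [(summable_log_mul_exp hδ).tsum_add
    ((summable_log_one_sub (by linarith : 1 < 1 + δ)).mul_left 8), tsum_mul_left]
  simp only [Function.comp_apply, add_sub_cancel_left]
  rw [Real.log_div (by positivity) hδ.ne', Real.log_pow, Real.log_exp, logSum]
  push_cast
  ring

lemma tsum_if_log_le {x : ℝ} (hx : 1 < x) (a : ℕ → ℝ) :
    ∑' p : PrimesOneMod24, (if Real.log (p : ℕ) ≤ Real.log x then a p else 0) =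
      ∑ p ∈ (Nat.floor x + 1).primesBelow.filter (fun p => p % 24 = 1), a p := by
  have hiff (p : PrimesOneMod24) : Real.log (p : ℕ) ≤ Real.log x ↔
      (p : ℕ) ∈ (Nat.floor x + 1).primesBelow.filter (fun p => p % 24 = 1) := by
    rw [Real.log_le_log_iff (by linarith [p.two_le]) (by linarith), Finset.mem_filter,
      Nat.mem_primesBelow, Nat.lt_succ_iff, Nat.le_floor_iff (by linarith)]
    simp [p.2.1, p.2.2]
  rw [tsum_eq_sum (s := ((Nat.floor x + 1).primesBelow.filter (fun p => p % 24 = 1)).subtype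
    (fun p => p.Prime ∧ p % 24 = 1)) fun p hp => if_neg fun h =>
      hp (Finset.mem_subtype.2 ((hiff p).1 h))]
  rw [Finset.sum_congr rfl fun p hp => if_pos ((hiff p).2 (Finset.mem_subtype.1 hp)),
    Finset.sum_subtype_eq_sum_filter (f := a), Finset.filter_true_of_mem]
  intro p hp
  rw [Finset.mem_filter, Nat.mem_primesBelow] at hp
  exact ⟨hp.1.2, hp.2⟩

lemma tendsto_log_mul_prod {K : ℝ} (hK : 0 < K)
    (h : Tendsto (fun s : ℝ => Real.exp (logSum s) ^ 8 / (s - 1)) (𝓝[>] 1) (𝓝 K)) :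
    Tendsto (fun x : ℝ => Real.log x *
      (∏ p ∈ (Nat.floor x + 1).primesBelow.filter (fun p => p % 24 = 1), (1 - 1 / (p : ℝ))) ^ 8)
      atTop (𝓝 (K * Real.exp (-Real.eulerMascheroniConstant))) := by
  have hpos {p : ℕ} (hp : p.Prime) : 0 < 1 - 1 / (p : ℝ) := by
    rw [sub_pos, div_lt_one (by exact_mod_cast hp.pos)]
    exact_mod_cast hp.one_lt
  have hT := tendsto_tsum_sub_log_of_laplace (ι := PrimesOneMod24)
    (a := fun p => -8 * Real.log (1 - 1 / ((p : ℕ) : ℝ))) (u := fun p => Real.log (p : ℕ))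
    (fun p => mul_nonneg_of_nonpos_of_nonpos (by norm_num)
      (Real.log_nonpos (hpos p.2.1).le (by simp)))
    (fun p => Real.log_natCast_nonneg _) (fun δ hδ => summable_log_mul_exp hδ)
    (tendsto_laplace_log hK h)
  have hexp := (Real.continuous_exp.tendsto _).comp (hT.comp Real.tendsto_log_atTop).neg
  have hval : Real.exp (-(-Real.log K + Real.eulerMascheroniConstant)) =
      K * Real.exp (-Real.eulerMascheroniConstant) := by
    rw [neg_add, neg_neg, Real.exp_add, Real.exp_log hK]
  rw [hval] at hexp
  refine hexp.congr' ?_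
  filter_upwards [eventually_gt_atTop 1] with x hx
  simp only [Function.comp_apply]
  rw [tsum_if_log_le hx fun p => -8 * Real.log (1 - 1 / (p : ℝ)), neg_sub, Real.exp_sub,
    Real.exp_log (Real.log_pos hx), ← Finset.mul_sum, ← Real.log_prod, neg_mul, Real.exp_neg,
    div_inv_eq_mul, mul_comm (8 : ℝ), Real.exp_mul, Real.exp_log]
  · norm_num
  · refine Finset.prod_pos fun p hp => hpos ?_
    rw [Finset.mem_filter, Nat.mem_primesBelow] at hp
    exact hp.1.2
  · intro p hp
    rw [Finset.mem_filter, Nat.mem_primesBelow] at hp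
    exact (hpos hp.1.2).ne'

end Mertens

/-- **Williams's formula for `C(24,1)`:**
`log x · (∏_{p ≤ x, p ≡ 1 (24)} (1 - 1/p))⁸
  → (2π⁴ e^{-γ} / (9 log(2+√3) log(1+√2) log(5+2√6))) (∏_{p ≡ 1 (24)} (1 - 1/p²))⁴`,
the product over all primes `p ≡ 1 (mod 24)` being absolutely convergent. -/
theorem williams_C241 :
    Multipliable (fun p : {p : ℕ // p.Prime ∧ p % 24 = 1} =>
      1 - 1 / ((p : ℕ) : ℝ) ^ 2) ∧
    Tendsto (fun x : ℝ => Real.log x *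
        (∏ p ∈ (Nat.floor x + 1).primesBelow.filter (fun p => p % 24 = 1),
          (1 - 1 / (p : ℝ))) ^ 8)
      atTop (𝓝 (2 * Real.pi ^ 4 * Real.exp (-Real.eulerMascheroniConstant) /
          (9 * Real.log (2 + Real.sqrt 3) * Real.log (1 + Real.sqrt 2) *
            Real.log (5 + 2 * Real.sqrt 6)) *
        (∏' p : {p : ℕ // p.Prime ∧ p % 24 = 1}, (1 - 1 / ((p : ℕ) : ℝ) ^ 2)) ^ 4)) := by
  have hprod : HasProd (fun p : PrimesOneMod24 => 1 - 1 / ((p : ℕ) : ℝ) ^ 2)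
      (Real.exp (logSum 2)) := by
    refine (hasProd_one_sub_rpow (s := 2) (by norm_num)).congr_fun fun p => ?_
    rw [Real.rpow_neg (by positivity), one_div]
    norm_num
  refine ⟨hprod.multipliable, ?_⟩
  rw [hprod.tprod_eq]
  have hl2 : 0 < Real.log (1 + √2) :=
    Real.log_pos (by linarith [Real.sqrt_pos.2 (two_pos (α := ℝ))])
  have hl3 : 0 < Real.log (2 + √3) := Real.log_pos (by linarith [Real.sqrt_nonneg 3])
  have hl6 : 0 < Real.log (5 + 2 * √6) := Real.log_pos (by linarith [Real.sqrt_nonneg 6])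
  convert tendsto_log_mul_prod (by positivity) tendsto_exp_logSum using 2
  ring
end
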